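/- Let E ⊂ ℝ² be Ahlfors regular with constant A and suppose E has uniformly large Favard length: there is κ > 0 such that Fav(E ∩ B(x,r)) ≥ κ·r for all x ∈ E and 0 < r < diam(E). Then E has big pieces of Lipschitz graphs: there exist L > 0 and θ ∈ (0,1), depending only on κ and A, such that for every x ∈ E and 0 < r < diam(E) there exists a Lipschitz graph Γ_{x,r} with lip(Γ_{x,r}) ≤ L and ℋ¹(E ∩ B(x,r) ∩ Γ_{x,r}) ≥ θ·r. -/

import Mathlib

open MeasureTheory Metric Set
open scoped ENNReal NNReal

noncomputable section

abbrev R2 := EuclideanSpace ℝ (Fin 2)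

/-- The unit vector in direction `2πθ`. -/
def dir (θ : ℝ) : R2 :=
  (EuclideanSpace.equiv (Fin 2) ℝ).symm ![Real.cos (2 * Real.pi * θ), Real.sin (2 * Real.pi * θ)]

/-- Orthogonal projection `π_θ`. -/
def proj (θ : ℝ) (x : R2) : ℝ :=
  x 0 * Real.cos (2 * Real.pi * θ) + x 1 * Real.sin (2 * Real.pi * θ)

/-- `π_θ^⊥ = π_{θ+1/4}`. -/
def projPerp (θ : ℝ) (x : R2) : ℝ := proj (θ + 1/4) x

/-- Favard length. -/
def Fav (E : Set R2) : ℝ≥0∞ := ∫⁻ θ in Set.Icc (0:ℝ) 1, μH[1] (proj θ '' E)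

/-- Ahlfors regularity with constant `A`. -/
def AhlforsRegular (A : ℝ) (E : Set R2) : Prop :=
  IsClosed E ∧ ∀ x ∈ E, ∀ r : ℝ, 0 < r → ENNReal.ofReal r < EMetric.diam E →
    ENNReal.ofReal (A⁻¹ * r) ≤ μH[1] (E ∩ ball x r) ∧
      μH[1] (E ∩ ball x r) ≤ ENNReal.ofReal (A * r)

/-- A Lipschitz graph with constant `L`: rotated graph of an `L`-Lipschitz function. -/
def IsLipschitzGraph (L : ℝ) (Γ : Set R2) : Prop :=
  ∃ (R : R2 ≃ₗᵢ[ℝ] R2) (f : ℝ → ℝ), LipschitzWith (Real.toNNReal L) f ∧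
    Γ = R '' {x : R2 | x 1 = f (x 0)}

/-- The (untruncated) cone `X(x,G)`. -/
def cone (x : R2) (G : Set ℝ) : Set R2 := ⋃ θ ∈ G, {y | ∃ t : ℝ, y = x + t • dir θ}

/-- The truncated cone `X(x,G,r)`. -/
def coneT (x : R2) (G : Set ℝ) (r : ℝ) : Set R2 := cone x G ∩ ball x r

/-- The doubly truncated cone `X(x,G,r,R)`. -/
def coneA (x : R2) (G : Set ℝ) (r R : ℝ) : Set R2 := coneT x G R \ ball x r

/-- Hardy–Littlewood maximal function of a measure on `ℝ`. -/
def maximalFn (ν : Measure ℝ) (t : ℝ) : ℝ≥0∞ :=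
  ⨆ (r : ℝ) (_ : 0 < r), ν (Set.Ioo (t - r) (t + r)) / ENNReal.ofReal (2 * r)

/-- `μ_θ(x) = M(π_θ μ)(π_θ x)`. -/
def projMax (μ : Measure R2) (θ : ℝ) (x : R2) : ℝ≥0∞ :=
  maximalFn (μ.map (proj θ)) (proj θ x)

/-- `μ_θ^⊥(x) = M(π_θ^⊥ μ)(π_θ^⊥ x)`. -/
def projMaxPerp (μ : Measure R2) (θ : ℝ) (x : R2) : ℝ≥0∞ :=
  maximalFn (μ.map (projPerp θ)) (projPerp θ x)

/-- The interval with center `c` and length `ℓ`. -/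
def itv (c ℓ : ℝ) : Set ℝ := Set.Icc (c - ℓ/2) (c + ℓ/2)

/-- The metric `d_I` associated to the interval with center `c` and length `ℓ`. -/
def dmet (c ℓ : ℝ) (x y : R2) : ℝ :=
  Real.sqrt ((ℓ^2)⁻¹ * (projPerp c x - projPerp c y)^2 + (proj c x - proj c y)^2)

/-- The open `d_I`-ball `B_I(x,r)`. -/
def bmet (c ℓ : ℝ) (x : R2) (r : ℝ) : Set R2 := {y | dmet c ℓ x y < r}

/-- Triadic intervals of `[0,1)`. -/
def IsTriadic (I : Set ℝ) : Prop :=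
  ∃ (j k : ℕ), k < 3^j ∧ I = Set.Ico ((k : ℝ)/3^j) ((k+1 : ℝ)/3^j)

/-- 1-dimensional Hausdorff content. -/
def hContent {X : Type*} [EMetricSpace X] (s : Set X) : ℝ≥0∞ :=
  ⨅ (t : ℕ → Set X) (_ : s ⊆ ⋃ n, t n), ∑' n, EMetric.diam (t n)

/-- `E` is a finite union of parallel segments. -/
def FinUnionParallelSegments (E : Set R2) : Prop :=
  ∃ (n : ℕ) (d : R2) (p q : Fin n → R2), d ≠ 0 ∧
    (∀ i, ∃ t : ℝ, q i - p i = t • d) ∧ E = ⋃ i, segment ℝ (p i) (q i)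

namespace FavardGraph

lemma exists_antiderivative (P : Polynomial ℝ) : ∃ Q : Polynomial ℝ,
    Q.natDegree ≤ P.natDegree + 1 ∧ ∀ a b : ℝ, ∫ t in a..b, P.eval t = Q.eval b - Q.eval a := by
  refine ⟨∑ i ∈ Finset.range (P.natDegree + 1),
    Polynomial.C (P.coeff i / (i + 1)) * Polynomial.X ^ (i + 1), ?_, ?_⟩
  · refine Polynomial.natDegree_sum_le_of_forall_le _ _ fun i hi => ?_
    refine (Polynomial.natDegree_C_mul_X_pow_le _ _).trans ?_
    simpa using Nat.lt_succ_iff.1 (Finset.mem_range.1 hi)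
  · intro a b
    refine intervalIntegral.integral_eq_sub_of_hasDerivAt
      (f := fun t => (∑ i ∈ Finset.range (P.natDegree + 1),
        Polynomial.C (P.coeff i / (i + 1)) * Polynomial.X ^ (i + 1)).eval t) (fun t _ => ?_)
      (P.continuous.intervalIntegrable _ _)
    have h := Polynomial.hasDerivAt (∑ i ∈ Finset.range (P.natDegree + 1),
      Polynomial.C (P.coeff i / (i + 1)) * Polynomial.X ^ (i + 1)) t
    have hd : Polynomial.derivative (∑ i ∈ Finset.range (P.natDegree + 1),
        Polynomial.C (P.coeff i / (i + 1)) * Polynomial.X ^ (i + 1)) = P := by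
      conv_rhs => rw [P.as_sum_range_C_mul_X_pow]
      rw [Polynomial.derivative_sum]
      refine Finset.sum_congr rfl fun i _ => ?_
      rw [Polynomial.derivative_C_mul_X_pow]
      congr 2
      push_cast
      field_simp
    rwa [hd] at h

lemma polynomial_rigidity (D : ℕ) : ∃ C : ℝ, 0 < C ∧ ∀ P : Polynomial ℝ, P.natDegree ≤ D →
    ∀ c t : ℝ, 0 ≤ t → (∀ x ∈ Ioo (-1 : ℝ) 1, |P.eval x - c| ≤ t) →
      ∀ x ∈ Icc (-7 : ℝ) 7, |P.eval x - c| ≤ C * t := by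
  let v : ℕ → ℝ := fun i => i / (D + 1)
  have hv : Set.InjOn v (Finset.range (D + 1)) := by
    intro i _ j _ hij
    have : (D : ℝ) + 1 ≠ 0 := by positivity
    simpa [v, div_left_inj' this] using hij
  have hb : ∀ i, ∃ c : ℝ, ∀ x ∈ Icc (-7 : ℝ) 7,
      ‖(Lagrange.basis (Finset.range (D + 1)) v i).eval x‖ ≤ c := fun i =>
    isCompact_Icc.exists_bound_of_continuousOn (Polynomial.continuous _).continuousOn
  choose c hc using hb
  have hc0 : ∀ i, 0 ≤ c i := fun i =>
    (norm_nonneg _).trans (hc i 0 (by constructor <;> norm_num))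
  refine ⟨1 + ∑ i ∈ Finset.range (D + 1), c i, ?_, ?_⟩
  · have := Finset.sum_nonneg fun i (_ : i ∈ Finset.range (D + 1)) => hc0 i
    linarith
  intro P hP a t ht h x hx
  have hdeg : (P - Polynomial.C a).degree < (Finset.range (D + 1)).card := by
    rw [Finset.card_range]
    have h1 : (P - Polynomial.C a).degree ≤ D :=
      Polynomial.degree_le_of_natDegree_le ((Polynomial.natDegree_sub_C (a := a) (p := P)).le.trans hP)
    exact h1.trans_lt (by exact_mod_cast Nat.lt_succ_self D)
  have heq := Lagrange.eq_interpolate (f := P - Polynomial.C a) hv hdeg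
  have hev : P.eval x - a = ∑ i ∈ Finset.range (D + 1),
      (P.eval (v i) - a) * (Lagrange.basis (Finset.range (D + 1)) v i).eval x := by
    have := congrArg (Polynomial.eval x) heq
    rw [Lagrange.interpolate_apply, Polynomial.eval_finsetSum] at this
    simpa using this
  rw [hev]
  calc _ ≤ ∑ i ∈ Finset.range (D + 1), |(P.eval (v i) - a) *
        (Lagrange.basis (Finset.range (D + 1)) v i).eval x| := Finset.abs_sum_le_sum_abs _ _
    _ ≤ ∑ i ∈ Finset.range (D + 1), t * c i := by
      refine Finset.sum_le_sum fun i hi => ?_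
      rw [abs_mul]
      refine mul_le_mul (h _ ?_) (hc i x hx) (abs_nonneg _) ht
      have hi' : (i : ℝ) < D + 1 := by exact_mod_cast Finset.mem_range.1 hi
      have h0 : (0 : ℝ) ≤ i := by positivity
      constructor
      · have : (0 : ℝ) ≤ v i := by positivity
        linarith
      · simp only [v]
        rw [div_lt_one (by positivity)]
        exact hi'
    _ ≤ _ := by rw [← Finset.mul_sum]; nlinarith

lemma pos_part_comparison (x d : ℝ) :
    |(max (x - d) 0 - max x 0) + d * (if 0 ≤ x then 1 else 0)| ≤
      |d| * (if |x| ≤ |d| then 1 else 0) := by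
  rcases le_or_gt 0 x with hx | hx
  · rcases le_or_gt x |d| with h | h
    · have : |x| ≤ |d| := by rwa [abs_of_nonneg hx]
      simp only [hx, this, if_true, max_eq_left]
      rcases le_total 0 d with hd | hd
      · rw [abs_of_nonneg hd] at *
        rcases le_total (x - d) 0 with h1 | h1
        · rw [max_eq_right h1, abs_le]; constructor <;> linarith
        · rw [max_eq_left h1, abs_le]; constructor <;> linarith
      · rw [max_eq_left (by linarith)]
        simp
    · have h2 : d < x := lt_of_le_of_lt (le_abs_self d) h
      simp only [hx, if_true, max_eq_left]
      rw [max_eq_left (by linarith)]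
      have : x - d - x + d * 1 = 0 := by ring
      rw [this, abs_zero]
      positivity
  · have h0 : ¬ 0 ≤ x := not_le.2 hx
    simp only [h0, if_false, max_eq_right hx.le]
    rcases le_or_gt (x - d) 0 with h1 | h1
    · rw [max_eq_right h1]
      simp; positivity
    · have : |x| ≤ |d| := by
        rw [abs_of_neg hx, abs_of_neg (by linarith)]; linarith
      simp only [this, if_true]
      rw [max_eq_left h1.le, abs_of_neg (by linarith : d < 0), abs_le]
      constructor <;> linarith

lemma integral_heaviside (q a t : ℝ) (hat : a ≤ t) :
    ∫ r in a..t, (if q ≤ r then (1 : ℝ) else 0) = max (t - q) 0 - max (a - q) 0 := by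
  have h1 : ∀ r, (if q ≤ r then (1 : ℝ) else 0) = (Ici q).indicator (fun _ => 1) r := by
    intro r; simp [indicator]
  simp_rw [h1]
  rw [intervalIntegral.integral_of_le hat, integral_indicator measurableSet_Ici,
    Measure.restrict_restrict measurableSet_Ici]
  simp only [integral_const, smul_eq_mul, mul_one]
  rw [measureReal_restrict_apply MeasurableSet.univ, univ_inter]
  have : volume.real (Ici q ∩ Ioc a t) = volume.real (Ioc (max a q) t) := by
    refine measureReal_congr ?_
    have : (Ioi q ∩ Ioc a t : Set ℝ) = Ioc (max a q) t := by
      ext x; simp only [mem_inter_iff, mem_Ioi, mem_Ioc, max_lt_iff]; tauto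
    rw [← this]
    exact (Ioi_ae_eq_Ici.symm).inter (ae_eq_refl _)
  rw [this, Measure.real, Real.volume_Ioc]
  rw [ENNReal.toReal_ofReal']
  rcases le_total a q with h | h <;> rcases le_total t q with h' | h' <;>
    simp only [max_def] <;> split_ifs <;> linarith

lemma integral_distribution {α : Type*} [MeasurableSpace α] (ν : Measure α) [IsFiniteMeasure ν]
    {g q : α → ℝ} (hg : Measurable g) (hq : Measurable q) {C : ℝ} (hC : ∀ᵐ z ∂ν, |g z| ≤ C)
    {a t : ℝ} (hat : a ≤ t) :
    ∫ r in a..t, (∫ z in {z | q z ≤ r}, g z ∂ν) =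
      ∫ z, g z * (max (t - q z) 0 - max (a - q z) 0) ∂ν := by
  have hset : ∀ r, MeasurableSet {z | q z ≤ r} := fun r => measurableSet_le hq measurable_const
  have h1 : ∀ r, (∫ z in {z | q z ≤ r}, g z ∂ν) =
      ∫ z, g z * (if q z ≤ r then 1 else 0) ∂ν := by
    intro r
    rw [← integral_indicator (hset r)]
    refine integral_congr_ae (Filter.Eventually.of_forall fun z => ?_)
    by_cases h : q z ≤ r <;> simp [indicator, h]
  simp_rw [h1]
  rw [intervalIntegral_integral_swap]
  · refine integral_congr_ae (Filter.Eventually.of_forall fun z => ?_)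
    simp only
    rw [intervalIntegral.integral_const_mul, integral_heaviside _ _ _ hat]
  · have : IsFiniteMeasure (volume.restrict (uIoc a t)) :=
      ⟨by rw [Measure.restrict_apply_univ, uIoc_of_le hat]; exact measure_Ioc_lt_top⟩
    refine Integrable.of_bound (C := C) ?_ ?_
    · refine Measurable.aestronglyMeasurable ?_
      refine (hg.comp measurable_snd).mul ?_
      exact Measurable.ite (measurableSet_le (hq.comp measurable_snd) measurable_fst)
        measurable_const measurable_const
    · have h2 : ∀ᵐ p ∂((volume.restrict (uIoc a t)).prod ν), |g p.2| ≤ C :=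
        Measure.quasiMeasurePreserving_snd.ae hC
      filter_upwards [h2] with p hp
      simp only [Function.uncurry, Real.norm_eq_abs, abs_mul]
      have h0 : 0 ≤ |g p.2| := abs_nonneg _
      split_ifs <;> simp <;> linarith

/-- The linear functional `(u, v) ↦ u + s v`. -/
def lin (s : ℝ) (z : ℝ × ℝ) : ℝ := z.1 + s * z.2

lemma continuous_lin (s : ℝ) : Continuous (lin s) := by unfold lin; fun_prop

lemma measurable_lin (s : ℝ) : Measurable (lin s) := (continuous_lin s).measurable

/-- The part of the measure carried by `|v| < R`. -/
def slab (μ : Measure (ℝ × ℝ)) (R : ℝ) : Measure (ℝ × ℝ) := μ.restrict {z | |z.2| < R}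

instance (μ : Measure (ℝ × ℝ)) [IsFiniteMeasure μ] (R : ℝ) : IsFiniteMeasure (slab μ R) := by
  unfold slab; infer_instance

lemma measurableSet_abs_snd_lt (R : ℝ) : MeasurableSet {z : ℝ × ℝ | |z.2| < R} :=
  measurableSet_lt (by fun_prop) measurable_const

lemma measurableSet_lin_le (s t : ℝ) : MeasurableSet {z : ℝ × ℝ | lin s z ≤ t} :=
  measurableSet_le (measurable_lin s) measurable_const

/-- The weighted distribution function of the projection of the part of `μ` in `|v| < R`. -/
def wdist (μ : Measure (ℝ × ℝ)) (R : ℝ) (w : ℝ → ℝ) (s t : ℝ) : ℝ :=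
  ∫ z in {z | lin s z ≤ t}, w z.2 ∂(slab μ R)

/-- `wdist` is uniformly close to a polynomial of degree at most `d` on `[-7, 7]`. -/
def PolyApprox (μ : Measure (ℝ × ℝ)) (R : ℝ) (w : ℝ → ℝ) (s : ℝ) (d : ℕ) (tol : ℝ) : Prop :=
  ∃ P : Polynomial ℝ, P.natDegree ≤ d ∧
    ∀ t ∈ Icc (-7 : ℝ) 7, |wdist μ R w s t - P.eval t| ≤ tol

lemma ae_slab (μ : Measure (ℝ × ℝ)) (R : ℝ) {p : ℝ → Prop} (h : ∀ v, |v| < R → p v) :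
    ∀ᵐ z ∂(slab μ R), p z.2 := by
  unfold slab
  filter_upwards [ae_restrict_mem (measurableSet_abs_snd_lt R)] with z hz using h _ hz

lemma wdist_integrable (μ : Measure (ℝ × ℝ)) [IsFiniteMeasure μ] {R : ℝ} {w : ℝ → ℝ}
    (hw : Measurable w) {C : ℝ} (hC : ∀ v, |v| < R → |w v| ≤ C) :
    Integrable (fun z : ℝ × ℝ => w z.2) (slab μ R) :=
  Integrable.of_bound (hw.comp measurable_snd).aestronglyMeasurable C (ae_slab μ R hC)

lemma wdist_eq (μ : Measure (ℝ × ℝ)) (R : ℝ) (w : ℝ → ℝ) (s t : ℝ) :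
    wdist μ R w s t = ∫ z, w z.2 * (if lin s z ≤ t then 1 else 0) ∂(slab μ R) := by
  unfold wdist
  rw [← integral_indicator (measurableSet_lin_le s t)]
  refine integral_congr_ae (Filter.Eventually.of_forall fun z => ?_)
  by_cases h : lin s z ≤ t <;> simp [indicator, h]

lemma pos_part_lipschitz (t a q : ℝ) : |max (t - q) 0 - max (a - q) 0| ≤ |t - a| := by
  have := abs_max_sub_max_le_abs (t - q) (a - q) 0
  simpa using this

lemma wdist_primitive (μ : Measure (ℝ × ℝ)) [IsFiniteMeasure μ] {R : ℝ} {w : ℝ → ℝ}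
    (hw : Measurable w) {C : ℝ} (hC : ∀ v, |v| < R → |w v| ≤ C) {s : ℝ} {d : ℕ} {tol : ℝ}
    (h : PolyApprox μ R w s d tol) :
    ∃ Q : Polynomial ℝ, Q.natDegree ≤ d + 1 ∧ ∀ t ∈ Icc (-7 : ℝ) 7,
      |∫ z, w z.2 * (max (t - lin s z) 0 - max (-7 - lin s z) 0) ∂(slab μ R) - Q.eval t| ≤
        14 * tol := by
  obtain ⟨P, hP, hPt⟩ := h
  obtain ⟨Q, hQ, hQi⟩ := exists_antiderivative P
  refine ⟨Q - Polynomial.C (Q.eval (-7)), ?_, fun t ht => ?_⟩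
  · rw [Polynomial.natDegree_sub_C]; omega
  have htol : 0 ≤ tol := (abs_nonneg _).trans (hPt t ht)
  rw [← integral_distribution (slab μ R) (g := fun z => w z.2) (hw.comp measurable_snd)
    (measurable_lin s)
    (ae_slab μ R hC) ht.1]
  rw [Polynomial.eval_sub, Polynomial.eval_C, ← hQi]
  change |(∫ r in (-7 : ℝ)..t, wdist μ R w s r) - _| ≤ _
  have hint : IntervalIntegrable (fun r => wdist μ R w s r) volume (-7) t := by
    have hpos : ∀ v, |v| < R → |max (w v) 0| ≤ C := fun v hv => by
      rw [abs_le]; have := abs_le.1 (hC v hv)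
      constructor
      · linarith [le_max_right (w v) 0, (abs_nonneg _).trans (hC v hv)]
      · exact max_le this.2 ((abs_nonneg _).trans (hC v hv))
    have hneg : ∀ v, |v| < R → |max (-w v) 0| ≤ C := fun v hv => by
      rw [abs_le]; have := abs_le.1 (hC v hv)
      constructor
      · linarith [le_max_right (-w v) 0, (abs_nonneg _).trans (hC v hv)]
      · exact max_le (by linarith) ((abs_nonneg _).trans (hC v hv))
    have hmono : ∀ w' : ℝ → ℝ, Measurable w' → (∀ v, |v| < R → |w' v| ≤ C) → (∀ v, 0 ≤ w' v) →
        Monotone fun r => wdist μ R w' s r := by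
      intro w' hw' hC' h0 r r' hr
      unfold wdist
      refine setIntegral_mono_set (wdist_integrable μ hw' hC').integrableOn
        (Filter.Eventually.of_forall fun z => h0 _) ?_
      exact (show {z | lin s z ≤ r} ⊆ {z | lin s z ≤ r'} from
        fun z hz => le_trans hz hr).eventuallyLE
    have hmp : Measurable fun v => max (w v) 0 := hw.max measurable_const
    have hmn : Measurable fun v => max (-w v) 0 := hw.neg.max measurable_const
    have e : (fun r => wdist μ R w s r) = fun r =>
        wdist μ R (fun v => max (w v) 0) s r - wdist μ R (fun v => max (-w v) 0) s r := by
      funext r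
      unfold wdist
      rw [← integral_sub (wdist_integrable μ hmp hpos).integrableOn
        (wdist_integrable μ hmn hneg).integrableOn]
      refine integral_congr_ae (Filter.Eventually.of_forall fun z => ?_)
      simp only
      rcases le_total (w z.2) 0 with h | h
      · rw [max_eq_right h, max_eq_left (by linarith)]; ring
      · rw [max_eq_left h, max_eq_right (by linarith)]; ring
    rw [e]
    exact ((hmono _ hmp hpos fun v => le_max_right _ _).intervalIntegrable).sub
      (hmono _ hmn hneg fun v => le_max_right _ _).intervalIntegrable
  rw [← intervalIntegral.integral_sub hint (P.continuous.intervalIntegrable _ _)]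
  have := intervalIntegral.norm_integral_le_of_norm_le_const (a := (-7 : ℝ)) (b := t) (C := tol)
    (f := fun r => wdist μ R w s r - P.eval r) (fun x hx => by
      rw [uIoc_of_le ht.1] at hx
      exact hPt x ⟨hx.1.le, hx.2.trans ht.2⟩)
  rw [Real.norm_eq_abs] at this
  refine this.trans ?_
  rw [abs_of_nonneg (by linarith [ht.1])]
  nlinarith [ht.2]

lemma PolyApprox.mono {μ : Measure (ℝ × ℝ)} {R : ℝ} {w : ℝ → ℝ} {s : ℝ} {d d' : ℕ}
    {tol tol' : ℝ} (h : PolyApprox μ R w s d tol) (hd : d ≤ d') (ht : tol ≤ tol') :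
    PolyApprox μ R w s d' tol' := by
  obtain ⟨P, hP, hPt⟩ := h
  exact ⟨P, hP.trans hd, fun t h => (hPt t h).trans ht⟩

lemma PolyApprox.add {μ : Measure (ℝ × ℝ)} [IsFiniteMeasure μ] {R : ℝ} {w w' : ℝ → ℝ} {s : ℝ}
    {d : ℕ} {tol tol' C : ℝ} (hw : Measurable w) (hC : ∀ v, |v| < R → |w v| ≤ C)
    (hw' : Measurable w') (hC' : ∀ v, |v| < R → |w' v| ≤ C)
    (h : PolyApprox μ R w s d tol) (h' : PolyApprox μ R w' s d tol') :
    PolyApprox μ R (fun v => w v + w' v) s d (tol + tol') := by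
  obtain ⟨P, hP, hPt⟩ := h
  obtain ⟨P', hP', hPt'⟩ := h'
  refine ⟨P + P', (Polynomial.natDegree_add_le _ _).trans (max_le hP hP'), fun t ht => ?_⟩
  have : wdist μ R (fun v => w v + w' v) s t = wdist μ R w s t + wdist μ R w' s t := by
    unfold wdist
    exact integral_add (wdist_integrable μ hw hC).integrableOn
      (wdist_integrable μ hw' hC').integrableOn
  rw [this, Polynomial.eval_add]
  calc _ = |(wdist μ R w s t - P.eval t) + (wdist μ R w' s t - P'.eval t)| := by ring_nf
    _ ≤ _ := (abs_add_le _ _).trans (add_le_add (hPt t ht) (hPt' t ht))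

lemma PolyApprox.const_mul {μ : Measure (ℝ × ℝ)} {R : ℝ} {w : ℝ → ℝ} {s : ℝ}
    {d : ℕ} {tol : ℝ} (a : ℝ) (h : PolyApprox μ R w s d tol) :
    PolyApprox μ R (fun v => a * w v) s d (|a| * tol) := by
  obtain ⟨P, hP, hPt⟩ := h
  refine ⟨Polynomial.C a * P, (Polynomial.natDegree_C_mul_le _ _).trans hP, fun t ht => ?_⟩
  have : wdist μ R (fun v => a * w v) s t = a * wdist μ R w s t := by
    unfold wdist
    exact integral_const_mul _ _
  rw [this, Polynomial.eval_mul, Polynomial.eval_C, ← mul_sub, abs_mul]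
  exact mul_le_mul_of_nonneg_left (hPt t ht) (abs_nonneg _)

lemma integral_sub_add_mul_sub {α : Type*} [MeasurableSpace α] {ν : Measure α}
    {f g h k : α → ℝ} (hf : Integrable f ν) (hg : Integrable g ν) (hh : Integrable h ν)
    (hk : Integrable k ν) (c : ℝ) :
    ∫ z, (f z - g z + c * (h z - k z)) ∂ν =
      ∫ z, f z ∂ν - ∫ z, g z ∂ν + c * (∫ z, h z ∂ν - ∫ z, k z ∂ν) := by
  rw [← integral_sub hf hg, ← integral_sub hh hk, ← integral_const_mul, ← integral_add]
  · exact hf.sub hg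
  · exact (hh.sub hk).const_mul c

lemma PolyApprox.tilt {μ : Measure (ℝ × ℝ)} [IsFiniteMeasure μ] {R : ℝ} (hR : 0 < R)
    {w : ℝ → ℝ} {C : ℝ} (hw : Measurable w) (hC : ∀ v, |v| < R → |w v| ≤ C)
    {s h η m : ℝ} {d : ℕ} {tol : ℝ} (h0 : h ≠ 0) (hη : |h| * R ≤ η)
    (hm : ∀ t ∈ Icc (-7 : ℝ) 7, μ.real {z | |lin s z - t| ≤ η} ≤ m)
    (h1 : PolyApprox μ R w s d tol) (h2 : PolyApprox μ R w (s + h) d tol) :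
    PolyApprox μ R (fun v => v / R * w v) s (d + 1) (28 * tol / (|h| * R) + 2 * C * m) := by
  obtain ⟨Q0, hQ0, hQ0t⟩ := wdist_primitive μ hw hC h1
  obtain ⟨Q1, hQ1, hQ1t⟩ := wdist_primitive μ hw hC h2
  have hC0 : 0 ≤ C := (abs_nonneg _).trans (hC 0 (by simpa using hR))
  have hhR : 0 < |h| * R := mul_pos (abs_pos.2 h0) hR
  have hw' : Measurable fun v : ℝ => v / R * w v := (measurable_id.div_const R).mul hw
  have hC' : ∀ v, |v| < R → |v / R * w v| ≤ C := fun v hv => by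
    rw [abs_mul, abs_div, abs_of_pos hR]
    have : |v| / R ≤ 1 := (div_le_one hR).2 hv.le
    calc _ ≤ 1 * C := mul_le_mul this (hC v hv) (abs_nonneg _) zero_le_one
      _ = C := one_mul C
  refine ⟨Polynomial.C (wdist μ R (fun v => v / R * w v) s (-7)) +
    Polynomial.C ((h * R)⁻¹) * (Q0 - Q1), ?_, fun t ht => ?_⟩
  · refine (Polynomial.natDegree_add_le _ _).trans (max_le ?_ ?_)
    · simp
    · exact (Polynomial.natDegree_C_mul_le _ _).trans
        ((Polynomial.natDegree_sub_le _ _).trans (max_le hQ0 hQ1))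
  set ν := slab μ R with hν
  set W := fun r => wdist μ R (fun v => v / R * w v) s r with hW
  set D0 := ∫ z, w z.2 * (max (t - lin s z) 0 - max (-7 - lin s z) 0) ∂ν with hD0
  set D1 := ∫ z, w z.2 * (max (t - lin (s + h) z) 0 - max (-7 - lin (s + h) z) 0) ∂ν with hD1
  have hbd : ∀ s', Integrable
      (fun z => w z.2 * (max (t - lin s' z) 0 - max (-7 - lin s' z) 0)) ν := by
    intro s'
    refine Integrable.of_bound (C := C * |t - -7|) ?_ ?_
    · have := measurable_lin s'
      exact (by fun_prop : Measurable _).aestronglyMeasurable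
    · filter_upwards [ae_slab μ R hC] with z hz
      rw [Real.norm_eq_abs, abs_mul]
      exact mul_le_mul hz (pos_part_lipschitz _ _ _) (abs_nonneg _) hC0
  have hind : ∀ r, Integrable
      (fun z => z.2 / R * w z.2 * (if lin s z ≤ r then 1 else 0)) ν := by
    intro r
    refine Integrable.of_bound (C := C) ?_ ?_
    · exact ((hw'.comp measurable_snd).mul (Measurable.ite (measurableSet_lin_le s r)
        measurable_const measurable_const)).aestronglyMeasurable
    · filter_upwards [ae_slab μ R hC'] with z hz
      rw [Real.norm_eq_abs, abs_mul]
      have h3 : |(if lin s z ≤ r then (1 : ℝ) else 0)| ≤ 1 := by split_ifs <;> simp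
      calc _ ≤ C * 1 := mul_le_mul hz h3 (abs_nonneg _) hC0
        _ = C := mul_one C
  have hstrip : ∀ r, MeasurableSet {z : ℝ × ℝ | |lin s z - r| ≤ η} := fun r =>
    measurableSet_le (by have := measurable_lin s; fun_prop) measurable_const
  have key : |D1 - D0 + h * R * (W t - W (-7))| ≤ C * (|h| * R) * (2 * m) := by
    have e1 : D1 - D0 + h * R * (W t - W (-7)) =
        ∫ z, (w z.2 * (max (t - lin (s + h) z) 0 - max (-7 - lin (s + h) z) 0)
          - w z.2 * (max (t - lin s z) 0 - max (-7 - lin s z) 0)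
          + h * R * (z.2 / R * w z.2 * (if lin s z ≤ t then 1 else 0)
            - z.2 / R * w z.2 * (if lin s z ≤ -7 then 1 else 0))) ∂ν := by
      rw [integral_sub_add_mul_sub (hbd _) (hbd _) (hind _) (hind _)]
      simp only [hW, wdist_eq]
      rfl
    rw [e1]
    have hg : Integrable (fun z => C * (|h| * R) *
        ({z | |lin s z - t| ≤ η}.indicator (fun _ => (1 : ℝ)) z +
          {z | |lin s z - -7| ≤ η}.indicator (fun _ => (1 : ℝ)) z)) ν :=
      (((integrable_const _).indicator (hstrip _)).add
        ((integrable_const _).indicator (hstrip _))).const_mul _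
    have hmono : ∀ r ∈ Icc (-7 : ℝ) 7,
        ∫ z, {z | |lin s z - r| ≤ η}.indicator (fun _ => (1 : ℝ)) z ∂ν ≤ m := by
      intro r hr
      rw [integral_indicator (hstrip r), integral_const, smul_eq_mul, mul_one,
        measureReal_restrict_apply MeasurableSet.univ, univ_inter]
      refine le_trans ?_ (hm r hr)
      refine ENNReal.toReal_mono (measure_ne_top _ _) ?_
      exact Measure.restrict_apply_le _ _
    have hle := norm_integral_le_of_norm_le hg (μ := ν) (f := fun z =>
      (w z.2 * (max (t - lin (s + h) z) 0 - max (-7 - lin (s + h) z) 0)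
          - w z.2 * (max (t - lin s z) 0 - max (-7 - lin s z) 0)
          + h * R * (z.2 / R * w z.2 * (if lin s z ≤ t then 1 else 0)
            - z.2 / R * w z.2 * (if lin s z ≤ -7 then 1 else 0)))) ?_
    · refine hle.trans ?_
      rw [integral_const_mul, integral_add ((integrable_const _).indicator (hstrip _))
        ((integrable_const _).indicator (hstrip _))]
      refine mul_le_mul_of_nonneg_left ?_ (by positivity)
      linarith [hmono t ht, hmono (-7) (by constructor <;> norm_num)]
    · have hvR := ae_slab μ R (p := fun v => |v| < R ∧ |w v| ≤ C) fun v hv => ⟨hv, hC v hv⟩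
      filter_upwards [hvR] with z hz
      have hd : |h * z.2| ≤ |h| * R := by
        rw [abs_mul]; exact mul_le_mul_of_nonneg_left hz.1.le (abs_nonneg _)
      have hpt : ∀ r, |(max (r - lin (s + h) z) 0 - max (r - lin s z) 0) +
          h * z.2 * (if lin s z ≤ r then 1 else 0)| ≤
          |h| * R * {z | |lin s z - r| ≤ η}.indicator (fun _ => (1 : ℝ)) z := by
        intro r
        have e2 : r - lin (s + h) z = (r - lin s z) - h * z.2 := by unfold lin; ring
        have := pos_part_comparison (r - lin s z) (h * z.2)
        rw [e2]
        simp only [sub_nonneg] at this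
        refine this.trans (mul_le_mul hd ?_ ?_ hhR.le)
        · split_ifs with hh
          · rw [abs_sub_comm] at hh
            have : |lin s z - r| ≤ η := hh.trans (hd.trans hη)
            simp [indicator, this]
          · exact indicator_nonneg (fun _ _ => zero_le_one) _
        · split_ifs <;> norm_num
      have e3 : w z.2 * (max (t - lin (s + h) z) 0 - max (-7 - lin (s + h) z) 0)
          - w z.2 * (max (t - lin s z) 0 - max (-7 - lin s z) 0)
          + h * R * (z.2 / R * w z.2 * (if lin s z ≤ t then 1 else 0)
            - z.2 / R * w z.2 * (if lin s z ≤ -7 then 1 else 0)) =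
          w z.2 * (((max (t - lin (s + h) z) 0 - max (t - lin s z) 0) +
          h * z.2 * (if lin s z ≤ t then 1 else 0)) -
          ((max (-7 - lin (s + h) z) 0 - max (-7 - lin s z) 0) +
          h * z.2 * (if lin s z ≤ -7 then 1 else 0))) := by
        field_simp; ring
      rw [Real.norm_eq_abs, e3, abs_mul, mul_assoc C, mul_add]
      refine mul_le_mul hz.2 ?_ (abs_nonneg _) hC0
      exact (abs_sub _ _).trans (add_le_add (hpt t) (hpt (-7)))
  have hQ0' := hQ0t t ht
  have hQ1' := hQ1t t ht
  have hne : h * R ≠ 0 := mul_ne_zero h0 hR.ne'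
  have e4 : W t - Polynomial.eval t (Polynomial.C (W (-7)) +
      Polynomial.C ((h * R)⁻¹) * (Q0 - Q1)) = (h * R)⁻¹ *
      ((D1 - D0 + h * R * (W t - W (-7))) + (D0 - Q0.eval t) - (D1 - Q1.eval t)) := by
    simp only [Polynomial.eval_add, Polynomial.eval_mul, Polynomial.eval_C, Polynomial.eval_sub]
    field_simp; ring
  change |W t - _| ≤ _
  rw [e4, abs_mul, abs_inv, abs_mul, abs_of_pos hR]
  have : |(D1 - D0 + h * R * (W t - W (-7))) + (D0 - Q0.eval t) - (D1 - Q1.eval t)| ≤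
      C * (|h| * R) * (2 * m) + 14 * tol + 14 * tol :=
    (abs_sub _ _).trans (add_le_add ((abs_add_le _ _).trans (add_le_add key hQ0')) hQ1')
  calc (|h| * R)⁻¹ * _ ≤ (|h| * R)⁻¹ * (C * (|h| * R) * (2 * m) + 14 * tol + 14 * tol) :=
        mul_le_mul_of_nonneg_left this (by positivity)
    _ = _ := by field_simp; ring

/-- A measure carried by `E` together with a decreasing family of sets of slopes for which the
projections are almost uniform in a window around the origin. -/
structure Config (μ : Measure (ℝ × ℝ)) (E : Set (ℝ × ℝ)) (S : ℕ → Set ℝ) (c B ε : ℝ) (N : ℕ) :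
    Prop where
  supp : μ Eᶜ = 0
  anti : Antitone S
  thick : ∀ i, ∀ s ∈ S (i + 1), ∀ h, 0 < h → h ≤ 1 → ∃ s' ∈ S i, c * h ≤ |s' - s| ∧ |s' - s| ≤ h
  unif : ∀ s ∈ S 0, ∃ γ, 0 ≤ γ ∧ γ ≤ B ∧ ∀ a b : ℝ, -8 ≤ a → a ≤ b → b ≤ 8 →
    |μ.real {z | a < lin s z ∧ lin s z ≤ b} - γ * (b - a)| ≤ ε
  sep : ∀ s ∈ S 0, ∀ X : Finset ℝ, (∀ v ∈ X, ∃ z ∈ E, |lin s z| ≤ 10 ∧ z.2 = v) →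
    (∀ v ∈ X, ∀ v' ∈ X, v ≠ v' → 2 ≤ |v - v'|) → X.card ≤ N

/-- A family `F R` of multipliers in the variable `v` is admissible of order `n` if multiplying a
weight by a member of it preserves polynomial approximability, at the cost of `n` levels of the
slope sets and an increase of the degree by `n`. -/
def Admissible (c B : ℝ) (n : ℕ) (F : ℝ → (ℝ → ℝ) → Prop) : Prop :=
  (∃ M : ℝ, 0 ≤ M ∧ ∀ R f, 1 ≤ R → F R f → Measurable f ∧ ∀ v, |v| < R → |f v| ≤ M) ∧
  ∀ (C : ℝ) (d : ℕ) (tol' η : ℝ), 0 < tol' → 0 < η → ∃ tol > 0, ∃ ε₁ > 0,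
    ∀ (μ : Measure (ℝ × ℝ)) [IsFiniteMeasure μ] (E : Set (ℝ × ℝ)) (S : ℕ → Set ℝ) (ε : ℝ) (N : ℕ),
      Config μ E S c B ε N → ε ≤ ε₁ → ∀ (R : ℝ) (f w : ℝ → ℝ), 1 ≤ R → F R f → Measurable w →
        (∀ v, |v| < R → |w v| ≤ C) → ∀ (j : ℕ) (s : ℝ), s ∈ S (j + n) →
          (∀ s' ∈ S j, |s' - s| ≤ η / R → PolyApprox μ R w s' d tol) →
            PolyApprox μ R (fun v => f v * w v) s (d + n) tol'

lemma Admissible.subset {c B : ℝ} {n : ℕ} {F G : ℝ → (ℝ → ℝ) → Prop} (h : Admissible c B n F)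
    (hG : ∀ R f, 1 ≤ R → G R f → F R f) : Admissible c B n G := by
  obtain ⟨⟨M, hM, hF⟩, h2⟩ := h
  refine ⟨⟨M, hM, fun R f hR hf => hF R f hR (hG R f hR hf)⟩, fun C d tol' η ht hη => ?_⟩
  obtain ⟨tol, htol, ε₁, hε, h3⟩ := h2 C d tol' η ht hη
  exact ⟨tol, htol, ε₁, hε, fun μ _ E S ε N hc he R f w hR hf =>
    h3 μ E S ε N hc he R f w hR (hG R f hR hf)⟩

lemma Admissible.one (c B : ℝ) (n : ℕ) : Admissible c B n (fun _ f => f = fun _ => 1) := by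
  refine ⟨⟨1, zero_le_one, ?_⟩, fun C d tol' η ht hη => ⟨tol', ht, 1, one_pos, ?_⟩⟩
  · rintro R f - rfl
    exact ⟨measurable_const, by simp⟩
  · rintro μ _ E S ε N hc he R f w hR rfl hw hC j s hs h
    simp only [one_mul]
    refine (h s (hc.anti (Nat.le_add_right _ _) hs) ?_).mono (Nat.le_add_right _ _) le_rfl
    simp only [sub_self, abs_zero]
    positivity

lemma Admissible.mul {c B : ℝ} {n m : ℕ} {F G : ℝ → (ℝ → ℝ) → Prop} (hF : Admissible c B n F)
    (hG : Admissible c B m G) : Admissible c B (n + m)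
      (fun R h => ∃ f g, F R f ∧ G R g ∧ h = fun v => f v * g v) := by
  obtain ⟨⟨M, hM, hF1⟩, hF2⟩ := hF
  obtain ⟨⟨M', hM', hG1⟩, hG2⟩ := hG
  refine ⟨⟨M * M', by positivity, ?_⟩, fun C d tol' η ht hη => ?_⟩
  · rintro R h hR ⟨f, g, hf, hg, rfl⟩
    refine ⟨(hF1 R f hR hf).1.mul (hG1 R g hR hg).1, fun v hv => ?_⟩
    rw [abs_mul]
    exact mul_le_mul ((hF1 R f hR hf).2 v hv) ((hG1 R g hR hg).2 v hv) (abs_nonneg _) hM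
  obtain ⟨t1, ht1, e1, he1, h1⟩ := hF2 (M' * C) (d + m) tol' (η / 2) ht (by positivity)
  obtain ⟨t2, ht2, e2, he2, h2⟩ := hG2 C d t1 (η / 2) ht1 (by positivity)
  refine ⟨t2, ht2, min e1 e2, lt_min he1 he2, ?_⟩
  rintro μ _ E S ε N hc he R h w hR ⟨f, g, hf, hg, rfl⟩ hw hC j s hs hyp
  have e : (fun v => f v * g v * w v) = fun v => f v * (g v * w v) := by funext v; ring
  rw [e]
  have hs' : s ∈ S (j + m + n) := by rwa [show j + m + n = j + (n + m) by ring]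
  have := h1 μ E S ε N hc (he.trans (min_le_left _ _)) R f (fun v => g v * w v) hR hf
    ((hG1 R g hR hg).1.mul hw) (fun v hv => by
      rw [abs_mul]
      exact mul_le_mul ((hG1 R g hR hg).2 v hv) (hC v hv) (abs_nonneg _) hM') (j + m) s hs'
    (fun s' hs' hss => h2 μ E S ε N hc (he.trans (min_le_right _ _)) R g w hR hg hw hC j s' hs'
      fun s'' hs'' hss' => hyp s'' hs'' (by
        calc |s'' - s| = |(s'' - s') + (s' - s)| := by ring_nf
          _ ≤ η / 2 / R + η / 2 / R := (abs_add_le _ _).trans (add_le_add hss' hss)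
          _ = η / R := by ring))
  rwa [show d + m + n = d + (n + m) by ring] at this

lemma Admissible.prod {c B : ℝ} {n : ℕ} {F : ℝ → (ℝ → ℝ) → Prop} (hF : Admissible c B n F)
    (k : ℕ) : Admissible c B (k * n)
      (fun R h => ∃ l : List (ℝ → ℝ), l.length ≤ k ∧ (∀ f ∈ l, F R f) ∧
        h = fun v => (l.map fun f => f v).prod) := by
  induction k with
  | zero =>
    refine (Admissible.one c B (0 * n)).subset ?_
    rintro R h - ⟨l, hl, -, rfl⟩
    obtain rfl : l = [] := List.length_eq_zero_iff.1 (Nat.le_zero.1 hl)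
    simp
  | succ k ih =>
    have h1 := ih.mul hF
    obtain ⟨⟨M, hM, hb⟩, h2⟩ := h1
    obtain ⟨⟨M', hM', hb'⟩, h2'⟩ := Admissible.one c B (k * n + n)
    rw [show (k + 1) * n = k * n + n by ring]
    have key : ∀ R h, (∃ l : List (ℝ → ℝ), l.length ≤ k + 1 ∧ (∀ f ∈ l, F R f) ∧
        h = fun v => (l.map fun f => f v).prod) → (h = fun _ => 1) ∨
        (∃ f g, (∃ l : List (ℝ → ℝ), l.length ≤ k ∧ (∀ f ∈ l, F R f) ∧
        f = fun v => (l.map fun f => f v).prod) ∧ F R g ∧ h = fun v => f v * g v) := by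
      rintro R h ⟨l, hl, hlF, rfl⟩
      cases l with
      | nil => left; simp
      | cons g l =>
        right
        refine ⟨_, g, ⟨l, by simpa using hl, fun f hf => hlF f (List.mem_cons_of_mem _ hf), rfl⟩,
          hlF g List.mem_cons_self, ?_⟩
        funext v; simp [mul_comm]
    refine ⟨⟨max M M', le_max_of_le_left hM, fun R f hR hf => ?_⟩, fun C d tol' η ht hη => ?_⟩
    · rcases key R f hf with h | h
      · exact ⟨(hb' R f hR h).1, fun v hv => ((hb' R f hR h).2 v hv).trans (le_max_right _ _)⟩
      · exact ⟨(hb R f hR h).1, fun v hv => ((hb R f hR h).2 v hv).trans (le_max_left _ _)⟩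
    · obtain ⟨t1, ht1, e1, he1, h3⟩ := h2 C d tol' η ht hη
      obtain ⟨t2, ht2, e2, he2, h4⟩ := h2' C d tol' η ht hη
      refine ⟨min t1 t2, lt_min ht1 ht2, min e1 e2, lt_min he1 he2, ?_⟩
      intro μ _ E S ε N hc he R f w hR hf hw hC j s hs hyp
      rcases key R f hf with h | h
      · exact h4 μ E S ε N hc (he.trans (min_le_right _ _)) R f w hR h hw hC j s hs
          fun s' h' h'' => (hyp s' h' h'').mono le_rfl (min_le_right _ _)
      · exact h3 μ E S ε N hc (he.trans (min_le_left _ _)) R f w hR h hw hC j s hs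
          fun s' h' h'' => (hyp s' h' h'').mono le_rfl (min_le_left _ _)

lemma Admissible.one_sub {c B : ℝ} {n : ℕ} {F : ℝ → (ℝ → ℝ) → Prop} (hF : Admissible c B n F)
    {K : ℝ} (hK : 0 ≤ K) : Admissible c B n
      (fun R h => ∃ ζ f, |ζ| ≤ K ∧ F R f ∧ h = fun v => 1 - ζ * f v) := by
  obtain ⟨⟨M, hM, hF1⟩, hF2⟩ := hF
  refine ⟨⟨1 + K * M, by positivity, ?_⟩, fun C d tol' η ht hη => ?_⟩
  · rintro R h hR ⟨ζ, f, hζ, hf, rfl⟩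
    refine ⟨measurable_const.sub ((hF1 R f hR hf).1.const_mul _), fun v hv => ?_⟩
    refine (abs_sub _ _).trans ?_
    rw [abs_one, abs_mul]
    gcongr
    exact (hF1 R f hR hf).2 v hv
  obtain ⟨t1, ht1, e1, he1, h1⟩ := hF2 C d (tol' / (2 * (K + 1))) η (by positivity) hη
  refine ⟨min t1 (tol' / 2), lt_min ht1 (by positivity), e1, he1, ?_⟩
  rintro μ _ E S ε N hc he R h w hR ⟨ζ, f, hζ, hf, rfl⟩ hw hC j s hs hyp
  have hC0 : 0 ≤ C := (abs_nonneg _).trans (hC 0 (by simp; linarith))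
  have hA := h1 μ E S ε N hc he R f w hR hf hw hC j s hs
    fun s' h' h'' => (hyp s' h' h'').mono le_rfl (min_le_left _ _)
  have hB := (hyp s (hc.anti (Nat.le_add_right _ _) hs)
    (by simp only [sub_self, abs_zero]; positivity)).mono (Nat.le_add_right d n) (min_le_right _ _)
  have hfw : ∀ v, |v| < R → |(-ζ) * (f v * w v)| ≤ max C (K * (M * C)) := fun v hv => by
    rw [abs_mul, abs_neg, abs_mul]
    refine le_trans ?_ (le_max_right _ _)
    exact mul_le_mul hζ (mul_le_mul ((hF1 R f hR hf).2 v hv) (hC v hv) (abs_nonneg _) hM)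
      (by positivity) hK
  have := hB.add hw (fun v hv => (hC v hv).trans (le_max_left C (K * (M * C))))
    ((((hF1 R f hR hf).1.mul hw).const_mul (-ζ))) hfw (hA.const_mul (-ζ))
  have e : (fun v => (1 - ζ * f v) * w v) = fun v => w v + -ζ * (f v * w v) := by funext v; ring
  rw [e]
  refine this.mono le_rfl ?_
  rw [abs_neg]
  have : |ζ| * (tol' / (2 * (K + 1))) ≤ tol' / 2 := by
    calc _ ≤ (K + 1) * (tol' / (2 * (K + 1))) := by gcongr; linarith
      _ = tol' / 2 := by field_simp
  linarith

lemma strip_mass {μ : Measure (ℝ × ℝ)} [IsFiniteMeasure μ] {E : Set (ℝ × ℝ)} {S : ℕ → Set ℝ}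
    {c B ε : ℝ} {N : ℕ} (hc : Config μ E S c B ε N) {s : ℝ} (hs : s ∈ S 0) {η : ℝ} (hη : 0 < η)
    (hη' : η ≤ 1 / 2) : ∀ t ∈ Icc (-7 : ℝ) 7, μ.real {z | |lin s z - t| ≤ η} ≤ 3 * B * η + ε := by
  intro t ht
  obtain ⟨γ, h0, hB, h⟩ := hc.unif s hs
  have h1 := h (t - 2 * η) (t + η) (by linarith [ht.1]) (by linarith) (by linarith [ht.2])
  have h2 : μ.real {z | |lin s z - t| ≤ η} ≤
      μ.real {z | t - 2 * η < lin s z ∧ lin s z ≤ t + η} := by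
    refine measureReal_mono ?_
    intro z hz
    have := abs_le.1 (show |lin s z - t| ≤ η from hz)
    exact ⟨by linarith, by linarith⟩
  have h3 := (abs_le.1 h1).2
  have : γ * (t + η - (t - 2 * η)) ≤ 3 * B * η := by nlinarith
  linarith

lemma admissible_linear {c B : ℝ} (hc0 : 0 < c) (hB : 0 ≤ B) {K : ℝ} (hK : 0 < K) :
    Admissible c B 1 (fun R f => ∃ α β : ℝ, |α| ≤ K ∧ |β| ≤ K ∧ f = fun v => α + β * (v / R)) := by
  have hbound : ∀ R : ℝ, 1 ≤ R → ∀ v, |v| < R → |v / R| ≤ 1 := fun R hR v hv => by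
    rw [abs_div, abs_of_pos (by linarith : 0 < R)]
    exact (div_le_one (by linarith)).2 hv.le
  refine ⟨⟨2 * K, by positivity, ?_⟩, fun C₀ d tol' η₀ ht hη₀ => ?_⟩
  · rintro R f hR ⟨α, β, hα, hβ, rfl⟩
    refine ⟨by fun_prop, fun v hv => (abs_add_le _ _).trans ?_⟩
    rw [abs_mul]
    have := mul_le_mul hβ (hbound R hR v hv) (abs_nonneg _) hK.le
    linarith
  set C := max C₀ 1 with hCdef
  have hC1 : 1 ≤ C := le_max_right _ _
  set η := min (min η₀ (1 / 2)) (tol' / (18 * K * C * (B + 1))) with hηdef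
  have hη : 0 < η := lt_min (lt_min hη₀ (by norm_num)) (by positivity)
  have hη1 : η ≤ η₀ := (min_le_left _ _).trans (min_le_left _ _)
  have hη2 : η ≤ 1 / 2 := (min_le_left _ _).trans (min_le_right _ _)
  have hη3 : η ≤ tol' / (18 * K * C * (B + 1)) := min_le_right _ _
  set tol := tol' / (3 * K * (1 + 28 / (c * η))) with htol
  refine ⟨tol, by positivity, tol' / (6 * K * C), by positivity, ?_⟩
  rintro μ _ E S ε N hc he R f w hR ⟨α, β, hα, hβ, rfl⟩ hw hC₀ j s hs hyp
  have hC : ∀ v, |v| < R → |w v| ≤ C := fun v hv => (hC₀ v hv).trans (le_max_left _ _)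
  have hR0 : 0 < R := by linarith
  obtain ⟨s', hs', hlo, hhi⟩ := hc.thick j s hs (η / R) (by positivity)
    ((div_le_one hR0).2 (by linarith))
  have hself := hyp s (hc.anti (Nat.le_succ _) hs) (by simp only [sub_self, abs_zero]; positivity)
  have hother := hyp s' hs' (hhi.trans (by gcongr))
  have hne : s' - s ≠ 0 := by
    intro h
    rw [h, abs_zero] at hlo
    have : 0 < c * (η / R) := by positivity
    linarith
  have hdR : |s' - s| * R ≤ η := by
    rw [← le_div_iff₀ hR0]; exact hhi
  have hdR' : c * η ≤ |s' - s| * R := by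
    rw [← div_le_iff₀ hR0, mul_div_assoc]; exact hlo
  rw [show s' = s + (s' - s) by ring] at hother
  have htilt := PolyApprox.tilt hR0 hw hC hne hdR
    (strip_mass hc (hc.anti (Nat.zero_le _) hs) hη hη2) hself hother
  have hwb : ∀ v, |v| < R → |α * w v| ≤ K * C := fun v hv => by
    rw [abs_mul]; exact mul_le_mul hα (hC v hv) (abs_nonneg _) hK.le
  have hwb' : ∀ v, |v| < R → |β * (v / R * w v)| ≤ K * C := fun v hv => by
    rw [abs_mul, abs_mul]
    have := mul_le_mul (hbound R hR v hv) (hC v hv) (abs_nonneg _) zero_le_one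
    rw [one_mul] at this
    exact mul_le_mul hβ this (by positivity) hK.le
  have := PolyApprox.add (hw.const_mul α) hwb (((measurable_id.div_const R).mul hw).const_mul β)
    hwb' ((hself.const_mul α).mono (Nat.le_succ d) le_rfl) (htilt.const_mul β)
  have e : (fun v => (α + β * (v / R)) * w v) = fun v => α * w v + β * (v / R * w v) := by
    funext v; ring
  rw [e]
  refine this.mono le_rfl ?_
  have htol0 : 0 < tol := by positivity
  have hm0 : 0 ≤ 3 * B * η + ε :=
    measureReal_nonneg.trans (strip_mass hc (hc.anti (Nat.zero_le _) hs) hη hη2 0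
      (by constructor <;> norm_num))
  have b1 : 28 * tol / (|s' - s| * R) ≤ 28 * tol / (c * η) := by gcongr
  have b2 : |α| * tol + |β| * (28 * tol / (|s' - s| * R) + 2 * C * (3 * B * η + ε)) ≤
      K * tol + K * (28 * tol / (c * η) + 2 * C * (3 * B * η + tol' / (6 * K * C))) := by
    gcongr
  have b3 : K * tol + K * (28 * tol / (c * η)) = tol' / 3 := by
    rw [htol]; field_simp
  have b4 : K * (2 * C * (tol' / (6 * K * C))) = tol' / 3 := by field_simp; norm_num
  have b5 : K * (2 * C * (3 * B * η)) ≤ tol' / 3 := by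
    have : η * (18 * K * C * (B + 1)) ≤ tol' := by
      rwa [← le_div_iff₀ (by positivity)]
    have h0 : 0 ≤ K * C * η := by positivity
    nlinarith
  nlinarith

/-- The `i`-th triadic level contains a point of `E` projecting into `[-b, b]`. -/
def Occupied (E : Set (ℝ × ℝ)) (s b : ℝ) (i : ℕ) : Prop :=
  ∃ z ∈ E, (3 : ℝ) ^ i ≤ |z.2| ∧ |z.2| < 3 ^ (i + 1) ∧ |lin s z| ≤ b

lemma Occupied.mono {E : Set (ℝ × ℝ)} {s b b' : ℝ} {i : ℕ} (h : Occupied E s b i) (hb : b ≤ b') :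
    Occupied E s b' i := by
  obtain ⟨z, hz, h1, h2, h3⟩ := h
  exact ⟨z, hz, h1, h2, h3.trans hb⟩

lemma level_gap {i j : ℕ} (hij : i + 2 ≤ j) {v w : ℝ} (hv : |v| < 3 ^ (i + 1))
    (hw : (3 : ℝ) ^ j ≤ |w|) : 2 ≤ |v - w| := by
  have h1 : (3 : ℝ) ^ (i + 2) ≤ 3 ^ j := pow_le_pow_right₀ (by norm_num) hij
  have h2 : (1 : ℝ) ≤ 3 ^ (i + 1) := one_le_pow₀ (by norm_num)
  have h3 : (3 : ℝ) ^ (i + 2) = 3 * 3 ^ (i + 1) := by ring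
  have := abs_sub_abs_le_abs_sub w v
  rw [abs_sub_comm w v] at this
  linarith

lemma card_occupied_le {E : Set (ℝ × ℝ)} {N : ℕ} {s : ℝ}
    (hsep : ∀ X : Finset ℝ, (∀ v ∈ X, ∃ z ∈ E, |lin s z| ≤ 10 ∧ z.2 = v) →
      (∀ v ∈ X, ∀ v' ∈ X, v ≠ v' → 2 ≤ |v - v'|) → X.card ≤ N) (T : Finset ℕ)
    (hT : ∀ i ∈ T, Occupied E s 10 i) : T.card ≤ 2 * N := by
  classical
  have key : ∀ T' ⊆ T, (∀ i ∈ T', ∀ j ∈ T', i < j → i + 2 ≤ j) → T'.card ≤ N := by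
    intro T' hT' hgap
    choose! z hz using hT
    have hgaps : ∀ i ∈ T', ∀ j ∈ T', i ≠ j → 2 ≤ |(z i).2 - (z j).2| := by
      intro i hi j hj hij
      rcases lt_or_gt_of_ne hij with h | h
      · exact level_gap (hgap i hi j hj h) (hz i (hT' hi)).2.2.1 (hz j (hT' hj)).2.1
      · rw [abs_sub_comm]
        exact level_gap (hgap j hj i hi h) (hz j (hT' hj)).2.2.1 (hz i (hT' hi)).2.1
    have hinj : Set.InjOn (fun i => (z i).2) T' := by
      intro i hi j hj hij
      by_contra hne
      have := hgaps i hi j hj hne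
      rw [show (z i).2 = (z j).2 from hij, sub_self, abs_zero] at this
      linarith
    rw [← Finset.card_image_of_injOn hinj]
    refine hsep _ ?_ ?_
    · intro v hv
      obtain ⟨i, hi, rfl⟩ := Finset.mem_image.1 hv
      exact ⟨z i, (hz i (hT' hi)).1, (hz i (hT' hi)).2.2.2, rfl⟩
    · intro v hv w hw hvw
      obtain ⟨i, hi, rfl⟩ := Finset.mem_image.1 hv
      obtain ⟨j, hj, rfl⟩ := Finset.mem_image.1 hw
      exact hgaps i hi j hj fun h => hvw (by rw [h])
  have h1 := key (T.filter fun i => i % 2 = 0) (Finset.filter_subset _ _) (by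
    intro i hi j hj hij
    have := (Finset.mem_filter.1 hi).2
    have := (Finset.mem_filter.1 hj).2
    omega)
  have h2 := key (T.filter fun i => ¬ i % 2 = 0) (Finset.filter_subset _ _) (by
    intro i hi j hj hij
    have := (Finset.mem_filter.1 hi).2
    have := (Finset.mem_filter.1 hj).2
    omega)
  have := Finset.card_filter_add_card_filter_not (s := T) (fun i => i % 2 = 0)
  omega

lemma Config.card_occupied {μ : Measure (ℝ × ℝ)} {E : Set (ℝ × ℝ)} {S : ℕ → Set ℝ}
    {c B ε : ℝ} {N : ℕ} (hc : Config μ E S c B ε N) {s : ℝ} (hs : s ∈ S 0) (T : Finset ℕ)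
    (hT : ∀ i ∈ T, Occupied E s 10 i) : T.card ≤ 2 * N :=
  card_occupied_le (hc.sep s hs) T hT

lemma exists_net {V : Set ℝ} {N : ℕ} (h : ∀ X : Finset ℝ, (∀ v ∈ X, v ∈ V) →
    (∀ v ∈ X, ∀ v' ∈ X, v ≠ v' → 2 ≤ |v - v'|) → X.card ≤ N) :
    ∃ X : Finset ℝ, (∀ v ∈ X, v ∈ V) ∧ X.card ≤ N ∧ ∀ v ∈ V, ∃ x ∈ X, |v - x| < 2 := by
  classical
  let P : ℕ → Prop := fun k => ∃ X : Finset ℝ, (∀ v ∈ X, v ∈ V) ∧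
    (∀ v ∈ X, ∀ v' ∈ X, v ≠ v' → 2 ≤ |v - v'|) ∧ X.card = k
  have hP0 : P 0 := ⟨∅, by simp, by simp, by simp⟩
  obtain ⟨X, hXV, hXs, hXc⟩ := Nat.findGreatest_spec (P := P) (Nat.zero_le N) hP0
  refine ⟨X, hXV, h X hXV hXs, fun v hv => ?_⟩
  by_contra hcon
  push Not at hcon
  have hvX : v ∉ X := fun hvX => by
    have := hcon v hvX; rw [sub_self, abs_zero] at this; linarith
  have hP : P (X.card + 1) := by
    refine ⟨insert v X, ?_, ?_, Finset.card_insert_of_notMem hvX⟩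
    · intro w hw
      rcases Finset.mem_insert.1 hw with rfl | hw
      exacts [hv, hXV w hw]
    · intro w hw w' hw' hne
      rcases Finset.mem_insert.1 hw with h1 | h1 <;> rcases Finset.mem_insert.1 hw' with h2 | h2
      · exact absurd (h1.trans h2.symm) hne
      · rw [h1]; exact hcon w' h2
      · rw [h2, abs_sub_comm]; exact hcon w h1
      · exact hXs w h1 w' h2 hne
  have hle : X.card + 1 ≤ N := by
    obtain ⟨Y, hY1, hY2, hY3⟩ := hP
    rw [← hY3]; exact h Y hY1 hY2
  have := Nat.le_findGreatest hle hP
  omega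

lemma abs_list_prod_one_sub_sub_one {x : ℝ} (hx : 0 ≤ x) (l : List ℝ) (hl : ∀ y ∈ l, |y| ≤ x) :
    |(l.map fun y => 1 - y).prod - 1| ≤ (1 + x) ^ l.length - 1 := by
  induction l with
  | nil => simp
  | cons y l ih =>
    have ih' := ih fun z hz => hl z (List.mem_cons_of_mem _ hz)
    have hy := hl y List.mem_cons_self
    rw [List.map_cons, List.prod_cons, List.length_cons, pow_succ]
    set P := (l.map fun y => 1 - y).prod
    have e : (1 - y) * P - 1 = (1 - y) * (P - 1) + -y := by ring
    rw [e]
    refine (abs_add_le _ _).trans ?_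
    rw [abs_mul, abs_neg]
    have h1 : |1 - y| ≤ 1 + x := (abs_sub _ _).trans (by rw [abs_one]; linarith)
    have := mul_le_mul h1 ih' (abs_nonneg _) (by linarith)
    nlinarith

lemma abs_list_prod_le {ι : Type*} {f : ι → ℝ} {M : ℝ} (hM : 1 ≤ M) (l : List ι)
    (h : ∀ i ∈ l, |f i| ≤ M) : |(l.map f).prod| ≤ M ^ l.length := by
  induction l with
  | nil => simp
  | cons i l ih =>
    rw [List.map_cons, List.prod_cons, List.length_cons, pow_succ, abs_mul, mul_comm]
    exact mul_le_mul (ih fun j hj => h j (List.mem_cons_of_mem _ hj)) (h i List.mem_cons_self)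
      (abs_nonneg _) (by positivity)

lemma abs_list_prod_le_of_small {ι : Type*} {f : ι → ℝ} {M x : ℝ} (hM : 1 ≤ M) (l : List ι)
    (h : ∀ i ∈ l, |f i| ≤ M) (hx : ∃ i ∈ l, |f i| ≤ x) :
    |(l.map f).prod| ≤ M ^ l.length * x := by
  induction l with
  | nil => simp at hx
  | cons i l ih =>
    rw [List.map_cons, List.prod_cons, List.length_cons, abs_mul]
    have h0 := abs_list_prod_le hM l fun j hj => h j (List.mem_cons_of_mem _ hj)
    obtain ⟨j, hj, hjx⟩ := hx
    have hx0 : 0 ≤ x := (abs_nonneg _).trans hjx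
    rcases List.mem_cons.1 hj with rfl | hj
    · calc |f j| * |(l.map f).prod| ≤ x * M ^ l.length := mul_le_mul hjx h0 (abs_nonneg _) hx0
        _ ≤ M ^ (l.length + 1) * x := by
          rw [mul_comm]
          exact mul_le_mul_of_nonneg_right (pow_le_pow_right₀ hM (Nat.le_succ _)) hx0
    · have := ih (fun j hj => h j (List.mem_cons_of_mem _ hj)) ⟨j, hj, hjx⟩
      calc |f i| * |(l.map f).prod| ≤ M * (M ^ l.length * x) :=
            mul_le_mul (h i List.mem_cons_self) this (abs_nonneg _) (by linarith)
        _ = _ := by ring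

lemma abs_list_prod_sub_prod_le {ι : Type*} {f g : ι → ℝ} {M x : ℝ} (hM : 1 ≤ M) (hx : 0 ≤ x)
    (l : List ι) (hf : ∀ i ∈ l, |f i| ≤ M) (hg : ∀ i ∈ l, |g i| ≤ M)
    (h : ∀ i ∈ l, |f i - g i| ≤ x) :
    |(l.map f).prod - (l.map g).prod| ≤ l.length * M ^ l.length * x := by
  induction l with
  | nil => simp
  | cons i l ih =>
    have ih' := ih (fun j hj => hf j (List.mem_cons_of_mem _ hj))
      (fun j hj => hg j (List.mem_cons_of_mem _ hj)) (fun j hj => h j (List.mem_cons_of_mem _ hj))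
    have h0 := abs_list_prod_le hM l fun j hj => hf j (List.mem_cons_of_mem _ hj)
    rw [List.map_cons, List.prod_cons, List.map_cons, List.prod_cons, List.length_cons]
    set F := (l.map f).prod
    set G := (l.map g).prod
    have e : f i * F - g i * G = (f i - g i) * F + g i * (F - G) := by ring
    rw [e]
    refine (abs_add_le _ _).trans ?_
    rw [abs_mul, abs_mul]
    have h1 := mul_le_mul (h i List.mem_cons_self) h0 (abs_nonneg _) hx
    have h2 := mul_le_mul (hg i List.mem_cons_self) ih' (abs_nonneg _) (by linarith)
    have h3 : x * M ^ l.length ≤ x * M ^ (l.length + 1) :=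
      mul_le_mul_of_nonneg_left (pow_le_pow_right₀ hM (Nat.le_succ _)) hx
    push_cast
    calc _ ≤ x * M ^ (l.length + 1) + M * (l.length * M ^ l.length * x) := by linarith
      _ = _ := by ring

/-- Linear multipliers with coefficients bounded by `K`. -/
def LinearMult (K R : ℝ) (f : ℝ → ℝ) : Prop :=
  ∃ α β : ℝ, |α| ≤ K ∧ |β| ≤ K ∧ f = fun v => α + β * (v / R)

/-- The multipliers used to separate a cluster from the points near the origin. -/
def SepMult (n : ℕ) (K R : ℝ) (h : ℝ → ℝ) : Prop :=
  ∃ l : List (ℝ → ℝ), l.length ≤ n ∧ (∀ g ∈ l, ∃ ζ f, |ζ| ≤ K ∧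
    (∃ l' : List (ℝ → ℝ), l'.length ≤ n ∧ (∀ f' ∈ l', LinearMult K R f') ∧
      f = fun v => (l'.map fun f' => f' v).prod) ∧ g = fun v => 1 - ζ * f v) ∧
    h = fun v => (l.map fun g => g v).prod

lemma admissible_sepMult {c B : ℝ} (hc0 : 0 < c) (hB : 0 ≤ B) (n : ℕ) {K : ℝ} (hK : 0 < K) :
    Admissible c B (n * (n * 1)) (SepMult n K) :=
  (((admissible_linear hc0 hB hK).prod n).one_sub hK.le).prod n

lemma pow_le_list_prod {ι : Type*} {f : ι → ℝ} {b : ℝ} (hb : 0 ≤ b) (l : List ι)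
    (h : ∀ i ∈ l, b ≤ f i) : b ^ l.length ≤ (l.map f).prod := by
  induction l with
  | nil => simp
  | cons i l ih =>
    rw [List.map_cons, List.prod_cons, List.length_cons, pow_succ, mul_comm]
    exact mul_le_mul (h i List.mem_cons_self) (ih fun j hj => h j (List.mem_cons_of_mem _ hj))
      (by positivity) (hb.trans (h i List.mem_cons_self))

lemma exists_separating_weight (n : ℕ) : ∃ K : ℝ, 0 < K ∧ ∀ e : ℝ, 0 < e → ∃ m₀ : ℕ,
    ∀ m i m' : ℕ, m₀ ≤ m → m < i → i ≤ m' → m' ≤ i + n → ∀ X₀ X₁ : List ℝ,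
      X₀.length ≤ n → X₁.length ≤ n → (∀ x ∈ X₀, |x| < 3 ^ m) → (∀ x ∈ X₁, (3 : ℝ) ^ i ≤ |x|) →
      ∃ h, SepMult n K (3 ^ m') h ∧
        (∀ v, |v| < 3 ^ m → (∃ x ∈ X₀, |v - x| < 2) → |h v| ≤ e) ∧
        (∀ v, |v| < 3 ^ m' → (∃ x ∈ X₁, |v - x| < 2) → |1 - h v| ≤ e) := by
  refine ⟨3 ^ n, by positivity, fun e he => ?_⟩
  have hlim : ∀ A : ℝ, Filter.Tendsto (fun m : ℕ => A * (1 / 3 : ℝ) ^ m) Filter.atTop (nhds 0) := by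
    intro A
    have := (tendsto_pow_atTop_nhds_zero_of_lt_one (by norm_num : (0 : ℝ) ≤ 1 / 3)
      (by norm_num)).const_mul A
    simpa using this
  set A : ℝ := 3 ^ n * ((1 + 3 ^ n) ^ n * 2) with hA
  set A' : ℝ := (1 + 3 ^ n * 2 ^ n) ^ n * (3 ^ n * (n * 2 ^ n * 2)) with hA'
  have h1 : ∀ᶠ m : ℕ in Filter.atTop, (1 + A * (1 / 3 : ℝ) ^ m) ^ n - 1 < e := by
    have : Filter.Tendsto (fun m : ℕ => (1 + A * (1 / 3 : ℝ) ^ m) ^ n - 1) Filter.atTop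
        (nhds ((1 + 0) ^ n - 1)) := (((hlim A).const_add 1).pow n).sub_const 1
    simp only [add_zero, one_pow, sub_self] at this
    exact this.eventually (gt_mem_nhds he)
  have h2 : ∀ᶠ m : ℕ in Filter.atTop, A' * (1 / 3 : ℝ) ^ m < e :=
    (hlim A').eventually (gt_mem_nhds he)
  obtain ⟨m₀, hm₀⟩ := Filter.eventually_atTop.1 (h1.and h2)
  refine ⟨m₀, fun m i m' hm hmi him hmn X₀ X₁ hX₀ hX₁ hX₀b hX₁b => ?_⟩
  obtain ⟨hb1, hb2⟩ := hm₀ m hm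
  have hp : ∀ k : ℕ, (0 : ℝ) < 3 ^ k := fun k => by positivity
  have hmi' : (3 : ℝ) * 3 ^ m ≤ 3 ^ i := by
    calc (3 : ℝ) * 3 ^ m = 3 ^ (m + 1) := by ring
      _ ≤ 3 ^ i := pow_le_pow_right₀ (by norm_num) hmi
  have hmn' : (3 : ℝ) ^ m' ≤ 3 ^ n * 3 ^ i := by
    rw [← pow_add]; exact pow_le_pow_right₀ (by norm_num) (by omega)
  have hone : (1 : ℝ) ≤ 3 ^ n := one_le_pow₀ (by norm_num)
  have htwo : (1 : ℝ) ≤ 2 ^ n := one_le_pow₀ (by norm_num)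
  have hx1 : ∀ x ∈ X₁, 0 < |x| := fun x hx => (hp i).trans_le (hX₁b x hx)
  have hthird : ((1 : ℝ) / 3) ^ m = 1 / 3 ^ m := by rw [div_pow, one_pow]
  set Z : ℝ → ℝ := fun v => (X₁.map fun x => 1 - v / x).prod with hZ
  -- near values
  have hnear : ∀ v, |v| < 3 ^ m → ∀ x ∈ X₁, |v / x| ≤ 1 / 3 := by
    intro v hv x hx
    rw [abs_div, div_le_iff₀ (hx1 x hx)]
    linarith [hX₁b x hx]
  have hZlow : ∀ v, |v| < 3 ^ m → (2 / 3 : ℝ) ^ n ≤ Z v := by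
    intro v hv
    refine le_trans (pow_le_pow_of_le_one (by norm_num) (by norm_num) hX₁)
      (pow_le_list_prod (by norm_num) X₁ fun x hx => ?_)
    have := (abs_le.1 (hnear v hv x hx)).2
    linarith
  have hfac2 : ∀ v, |v| < 3 ^ m → ∀ x ∈ X₁, |1 - v / x| ≤ 2 := by
    intro v hv x hx
    refine (abs_sub _ _).trans ?_
    rw [abs_one]
    linarith [hnear v hv x hx]
  have hZup : ∀ v, |v| < 3 ^ m → |Z v| ≤ 2 ^ n := fun v hv =>
    (abs_list_prod_le (by norm_num) X₁ (hfac2 v hv)).trans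
      (pow_le_pow_right₀ (by norm_num) hX₁)
  have hζ : ∀ x ∈ X₀, |(Z x)⁻¹| ≤ 3 ^ n := by
    intro x hx
    have h0 := hZlow x (hX₀b x hx)
    have hpos : (0 : ℝ) < (2 / 3) ^ n := by positivity
    rw [abs_inv, abs_of_pos (hpos.trans_le h0)]
    calc (Z x)⁻¹ ≤ ((2 / 3 : ℝ) ^ n)⁻¹ := inv_anti₀ hpos h0
      _ = (3 / 2) ^ n := by rw [← inv_pow]; norm_num
      _ ≤ 3 ^ n := pow_le_pow_left₀ (by norm_num) (by norm_num) n
  refine ⟨fun v => (X₀.map fun x => 1 - (Z x)⁻¹ * Z v).prod, ?_, ?_, ?_⟩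
  · refine ⟨X₀.map fun x => fun v => 1 - (Z x)⁻¹ * Z v, by simpa using hX₀, ?_, ?_⟩
    · intro g hg
      obtain ⟨x, hx, rfl⟩ := List.mem_map.1 hg
      refine ⟨(Z x)⁻¹, Z, hζ x hx, ?_, rfl⟩
      refine ⟨X₁.map fun x => fun v => 1 + (-(3 ^ m') / x) * (v / 3 ^ m'), by simpa using hX₁,
        ?_, ?_⟩
      · intro f hf
        obtain ⟨x, hx, rfl⟩ := List.mem_map.1 hf
        refine ⟨1, -(3 ^ m') / x, by simpa using hone, ?_, rfl⟩
        rw [abs_div, abs_neg, abs_of_pos (hp m'), div_le_iff₀ (hx1 x hx)]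
        exact hmn'.trans (mul_le_mul_of_nonneg_left (hX₁b x hx) (hp n).le)
      · funext v
        simp only [hZ, List.map_map]
        congr 1
        refine List.map_congr_left fun x hx => ?_
        have := abs_pos.1 (hx1 x hx)
        simp only [Function.comp]
        field_simp
        ring
    · funext v
      simp [List.map_map, Function.comp_def]
  · intro v hv hvx
    have hs : |(X₀.map fun x => 1 - (Z x)⁻¹ * Z v).prod| ≤
        (1 + 3 ^ n * 2 ^ n) ^ X₀.length * (3 ^ n * (n * 2 ^ n * (2 * (1 / 3 ^ m)))) := by
      refine abs_list_prod_le_of_small (by nlinarith) X₀ ?_ ?_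
      · intro x hx
        refine (abs_sub _ _).trans ?_
        rw [abs_one, abs_mul]
        have := mul_le_mul (hζ x hx) (hZup v hv) (abs_nonneg _) (hp n).le
        linarith
      · obtain ⟨x, hx, hvx⟩ := hvx
        refine ⟨x, hx, ?_⟩
        have hne : Z x ≠ 0 :=
          ((by positivity : (0 : ℝ) < (2 / 3) ^ n).trans_le (hZlow x (hX₀b x hx))).ne'
        have e1 : 1 - (Z x)⁻¹ * Z v = (Z x)⁻¹ * (Z x - Z v) := by field_simp
        rw [e1, abs_mul]
        refine mul_le_mul (hζ x hx) ?_ (abs_nonneg _) (hp n).le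
        have := abs_list_prod_sub_prod_le (f := fun y => 1 - x / y) (g := fun y => 1 - v / y)
          (M := 2) (x := 2 * (1 / 3 ^ m)) (by norm_num) (by positivity) X₁ (hfac2 x (hX₀b x hx))
          (hfac2 v hv) (fun y hy => by
            have e2 : 1 - x / y - (1 - v / y) = (v - x) / y := by ring
            rw [e2, abs_div, div_le_iff₀ (hx1 y hy)]
            have hy3 : (3 : ℝ) ^ m ≤ |y| := by
              have := hX₁b y hy; have := hp m; linarith
            have : 1 ≤ 1 / 3 ^ m * |y| := by
              rw [one_div, inv_mul_eq_div, le_div_iff₀ (hp m)]; linarith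
            nlinarith)
        refine this.trans ?_
        have hl : (X₁.length : ℝ) ≤ n := by exact_mod_cast hX₁
        have hl2 : (2 : ℝ) ^ X₁.length ≤ 2 ^ n := pow_le_pow_right₀ (by norm_num) hX₁
        gcongr
    refine hs.trans (le_trans ?_ hb2.le)
    rw [hthird, hA']
    have : (1 + 3 ^ n * 2 ^ n : ℝ) ^ X₀.length ≤ (1 + 3 ^ n * 2 ^ n) ^ n :=
      pow_le_pow_right₀ (by nlinarith) hX₀
    calc _ ≤ (1 + 3 ^ n * 2 ^ n) ^ n * (3 ^ n * (n * 2 ^ n * (2 * (1 / 3 ^ m))) : ℝ) := by gcongr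
      _ = _ := by ring
  · intro v hv hvx
    have hZs : |Z v| ≤ (1 + 3 ^ n) ^ n * (2 * (1 / 3 ^ m)) := by
      have := abs_list_prod_le_of_small (f := fun x => 1 - v / x) (M := 1 + 3 ^ n)
        (x := 2 * (1 / 3 ^ m)) (by linarith) X₁ ?_ ?_
      · refine this.trans ?_
        have : (1 + 3 ^ n : ℝ) ^ X₁.length ≤ (1 + 3 ^ n) ^ n :=
          pow_le_pow_right₀ (by linarith) hX₁
        gcongr
      · intro x hx
        refine (abs_sub _ _).trans ?_
        rw [abs_one, abs_div]
        gcongr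
        rw [div_le_iff₀ (hx1 x hx)]
        exact hv.le.trans (hmn'.trans (mul_le_mul_of_nonneg_left (hX₁b x hx) (hp n).le))
      · obtain ⟨x, hx, hvx⟩ := hvx
        refine ⟨x, hx, ?_⟩
        have hne := abs_pos.1 (hx1 x hx)
        have e1 : 1 - v / x = (x - v) / x := by field_simp
        rw [e1, abs_div, abs_sub_comm, div_le_iff₀ (hx1 x hx)]
        have hy3 : (3 : ℝ) ^ m ≤ |x| := by
          have := hX₁b x hx; have := hp m; linarith
        have : 1 ≤ 1 / 3 ^ m * |x| := by
          rw [one_div, inv_mul_eq_div, le_div_iff₀ (hp m)]; linarith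
        nlinarith
    have hA0 : 0 ≤ A * (1 / 3 : ℝ) ^ m := by positivity
    have hl := abs_list_prod_one_sub_sub_one hA0 (X₀.map fun x => (Z x)⁻¹ * Z v) (by
      intro y hy
      obtain ⟨x, hx, rfl⟩ := List.mem_map.1 hy
      rw [abs_mul]
      calc _ ≤ 3 ^ n * ((1 + 3 ^ n) ^ n * (2 * (1 / 3 ^ m))) :=
            mul_le_mul (hζ x hx) hZs (abs_nonneg _) (hp n).le
        _ = _ := by rw [hthird, hA]; ring)
    rw [List.map_map, List.length_map] at hl
    rw [abs_sub_comm]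
    refine hl.trans (le_trans ?_ hb1.le)
    have : (1 + A * (1 / 3 : ℝ) ^ m) ^ X₀.length ≤ (1 + A * (1 / 3 : ℝ) ^ m) ^ n :=
      pow_le_pow_right₀ (by linarith) hX₀
    linarith

lemma measurableSet_strip (s a b : ℝ) : MeasurableSet {z : ℝ × ℝ | a < lin s z ∧ lin s z ≤ b} :=
  (measurableSet_lt measurable_const (measurable_lin s)).inter (measurableSet_lin_le s b)

lemma wdist_sub (μ : Measure (ℝ × ℝ)) [IsFiniteMeasure μ] {R : ℝ} {w : ℝ → ℝ}
    (hw : Measurable w) {C : ℝ} (hC : ∀ v, |v| < R → |w v| ≤ C) (s : ℝ) {a t : ℝ} (hat : a ≤ t) :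
    wdist μ R w s t - wdist μ R w s a = ∫ z in {z | a < lin s z ∧ lin s z ≤ t},
      {z : ℝ × ℝ | |z.2| < R}.indicator (fun z => w z.2) z ∂μ := by
  have hint := wdist_integrable μ hw hC
  unfold wdist
  have hsub : {z : ℝ × ℝ | lin s z ≤ a} ⊆ {z | lin s z ≤ t} := fun z hz =>
    le_trans (show lin s z ≤ a from hz) hat
  rw [← setIntegral_sdiff (measurableSet_lin_le s a) hint.integrableOn hsub]
  have e : {z : ℝ × ℝ | lin s z ≤ t} \ {z | lin s z ≤ a} =
      {z | a < lin s z ∧ lin s z ≤ t} := by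
    ext z; simp only [mem_sdiff, mem_ofPred_eq, not_le]; tauto
  rw [e]
  unfold slab
  rw [Measure.restrict_restrict (measurableSet_strip s a t), setIntegral_indicator
    (measurableSet_abs_snd_lt R)]

lemma exists_level {v : ℝ} {m : ℕ} (hv : (3 : ℝ) ^ m ≤ |v|) :
    ∃ i, m ≤ i ∧ (3 : ℝ) ^ i ≤ |v| ∧ |v| < 3 ^ (i + 1) := by
  have h1 : (1 : ℝ) ≤ |v| := (one_le_pow₀ (by norm_num)).trans hv
  obtain ⟨i, h2, h3⟩ := exists_nat_pow_near h1 (by norm_num : (1 : ℝ) < 3)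
  refine ⟨i, ?_, h2, h3⟩
  have := (pow_lt_pow_iff_right₀ (by norm_num : (1 : ℝ) < 3)).1 (hv.trans_lt h3)
  omega

lemma Config.ae_mem {μ : Measure (ℝ × ℝ)} {E : Set (ℝ × ℝ)} {S : ℕ → Set ℝ}
    {c B ε : ℝ} {N : ℕ} (hc : Config μ E S c B ε N) : ∀ᵐ z ∂μ, z ∈ E :=
  mem_ae_iff.2 hc.supp

lemma polyApprox_of_no_far {μ : Measure (ℝ × ℝ)} [IsFiniteMeasure μ] {E : Set (ℝ × ℝ)}
    {S : ℕ → Set ℝ} {c B ε : ℝ} {N : ℕ} (hc : Config μ E S c B ε N) {s : ℝ} (hs : s ∈ S 0) {m : ℕ}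
    (hocc : ∀ i, m ≤ i → ¬ Occupied E s 7 i) : PolyApprox μ (3 ^ m) (fun _ => 1) s 1 ε := by
  obtain ⟨γ, -, -, hγ⟩ := hc.unif s hs
  refine ⟨Polynomial.C (wdist μ (3 ^ m) (fun _ => 1) s (-7) + 7 * γ) +
    Polynomial.C γ * Polynomial.X, ?_, fun t ht => ?_⟩
  · refine (Polynomial.natDegree_add_le _ _).trans
      (max_le ((Polynomial.natDegree_C _).le.trans (Nat.zero_le _)) ?_)
    exact (Polynomial.natDegree_C_mul_le _ _).trans Polynomial.natDegree_X_le
  have h1 := wdist_sub μ (R := 3 ^ m) (w := fun _ => 1) measurable_const (C := 1)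
    (fun _ _ => by simp) s ht.1
  have h2 : ∫ z in {z | -7 < lin s z ∧ lin s z ≤ t},
      {z : ℝ × ℝ | |z.2| < 3 ^ m}.indicator (fun _ => (1 : ℝ)) z ∂μ =
      μ.real {z | -7 < lin s z ∧ lin s z ≤ t} := by
    rw [← setIntegral_one_eq_measureReal]
    refine setIntegral_congr_ae (measurableSet_strip s (-7) t) ?_
    filter_upwards [hc.ae_mem] with z hz hzt
    have : |z.2| < 3 ^ m := by
      by_contra hcon
      obtain ⟨i, hi, h3, h4⟩ := exists_level (not_lt.1 hcon)
      exact hocc i hi ⟨z, hz, h3, h4, abs_le.2 ⟨hzt.1.le, hzt.2.trans ht.2⟩⟩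
    simp [indicator, this]
  have h3 := hγ (-7) t (by norm_num) ht.1 (by linarith [ht.2])
  rw [← h2, ← h1] at h3
  convert h3 using 2
  simp
  ring

lemma integral_sub_sub {α : Type*} [MeasurableSpace α] {μ : Measure α} {f g h : α → ℝ}
    (hf : Integrable f μ) (hg : Integrable g μ) (hh : Integrable h μ) :
    ∫ z, (f z - (g z - h z)) ∂μ = ∫ z, f z ∂μ - (∫ z, g z ∂μ - ∫ z, h z ∂μ) := by
  rw [← integral_sub hg hh]
  exact integral_sub hf (hg.sub hh)

lemma polyApprox_of_cluster {μ : Measure (ℝ × ℝ)} [IsFiniteMeasure μ] {E : Set (ℝ × ℝ)}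
    {S : ℕ → Set ℝ} {c B ε : ℝ} {N : ℕ} (hc : Config μ E S c B ε N) (hε : ε ≤ 1) {s : ℝ}
    (hs : s ∈ S 0) {R R' : ℝ} {W : ℝ → ℝ} {C : ℝ} (hW : Measurable W)
    (hC : ∀ v, |v| < R' → |W v| ≤ C) {d : ℕ} {tol e : ℝ} (he : 0 ≤ e)
    (h : ∀ z ∈ E, |lin s z| ≤ 7 →
      |{z : ℝ × ℝ | |z.2| < R}.indicator (fun _ => (1 : ℝ)) z -
        ({z : ℝ × ℝ | |z.2| < R'}.indicator (fun _ => (1 : ℝ)) z -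
        {z : ℝ × ℝ | |z.2| < R'}.indicator (fun z => W z.2) z)| ≤ e)
    (h1 : PolyApprox μ R' (fun _ => 1) s d tol) (h2 : PolyApprox μ R' W s d tol) :
    PolyApprox μ R (fun _ => 1) s d (2 * tol + e * (14 * B + 1)) := by
  obtain ⟨P, hP, hPt⟩ := h1
  obtain ⟨P', hP', hPt'⟩ := h2
  obtain ⟨γ, hγ0, hγB, hγ⟩ := hc.unif s hs
  set k := wdist μ R (fun _ => 1) s (-7) - (wdist μ R' (fun _ => 1) s (-7) - wdist μ R' W s (-7))
    with hk
  refine ⟨Polynomial.C k + (P - P'), ?_, fun t ht => ?_⟩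
  · refine (Polynomial.natDegree_add_le _ _).trans
      (max_le ((Polynomial.natDegree_C _).le.trans (Nat.zero_le _)) ?_)
    exact (Polynomial.natDegree_sub_le _ _).trans (max_le hP hP')
  have e1 := wdist_sub μ (R := R) (w := fun _ => 1) measurable_const (C := 1)
    (fun _ _ => by simp) s ht.1
  have e2 := wdist_sub μ (R := R') (w := fun _ => 1) measurable_const (C := 1)
    (fun _ _ => by simp) s ht.1
  have e3 := wdist_sub μ hW hC s ht.1
  have i1 : ∀ r : ℝ, IntegrableOn ({z : ℝ × ℝ | |z.2| < r}.indicator (fun _ => (1 : ℝ)))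
      {z | -7 < lin s z ∧ lin s z ≤ t} μ := fun r =>
    ((integrable_const _).indicator (measurableSet_abs_snd_lt r)).integrableOn
  have i2 : IntegrableOn ({z : ℝ × ℝ | |z.2| < R'}.indicator (fun z => W z.2))
      {z | -7 < lin s z ∧ lin s z ≤ t} μ :=
    ((integrable_indicator_iff (measurableSet_abs_snd_lt R')).2
      (wdist_integrable μ hW hC)).integrableOn
  have hdiff : |(wdist μ R (fun _ => 1) s t - (wdist μ R' (fun _ => 1) s t - wdist μ R' W s t)) - k|
      ≤ e * (14 * B + 1) := by
    have e4 : (wdist μ R (fun _ => 1) s t - (wdist μ R' (fun _ => 1) s t - wdist μ R' W s t)) - k =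
        ∫ z in {z | -7 < lin s z ∧ lin s z ≤ t},
          ({z : ℝ × ℝ | |z.2| < R}.indicator (fun _ => (1 : ℝ)) z -
          ({z : ℝ × ℝ | |z.2| < R'}.indicator (fun _ => (1 : ℝ)) z -
          {z : ℝ × ℝ | |z.2| < R'}.indicator (fun z => W z.2) z)) ∂μ := by
      rw [integral_sub_sub (i1 R) (i1 R') i2, ← e1, ← e2, ← e3, hk]
      ring
    rw [e4]
    have hb : ∀ᵐ z ∂(μ.restrict {z | -7 < lin s z ∧ lin s z ≤ t}),
        ‖{z : ℝ × ℝ | |z.2| < R}.indicator (fun _ => (1 : ℝ)) z -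
          ({z : ℝ × ℝ | |z.2| < R'}.indicator (fun _ => (1 : ℝ)) z -
          {z : ℝ × ℝ | |z.2| < R'}.indicator (fun z => W z.2) z)‖ ≤ e := by
      rw [ae_restrict_iff' (measurableSet_strip s (-7) t)]
      filter_upwards [hc.ae_mem] with z hz hzt
      exact h z hz (abs_le.2 ⟨hzt.1.le, hzt.2.trans ht.2⟩)
    refine (norm_integral_le_of_norm_le_const hb).trans ?_
    refine mul_le_mul_of_nonneg_left ?_ he
    rw [measureReal_restrict_apply MeasurableSet.univ, univ_inter]
    have h3 := (abs_le.1 (hγ (-7) t (by norm_num) ht.1 (by linarith [ht.2]))).2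
    have : γ * (t - -7) ≤ 14 * B := by nlinarith [ht.1, ht.2]
    linarith
  have a1 := hPt t ht
  have a2 := hPt' t ht
  simp only [Polynomial.eval_add, Polynomial.eval_C, Polynomial.eval_sub]
  rw [abs_le] at *
  constructor <;> linarith

/-- Polynomial approximability below an empty level, given that sufficiently many lower levels are
occupied. -/
lemma polyApprox_below_empty_level {c B : ℝ} (hc0 : 0 < c) (hB : 0 ≤ B) (N d : ℕ) :
    ∀ tol : ℝ, 0 < tol → ∃ ε₁ > 0, ∃ m₀ : ℕ, ∀ (μ : Measure (ℝ × ℝ)) [IsFiniteMeasure μ]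
      (E : Set (ℝ × ℝ)) (S : ℕ → Set ℝ) (ε : ℝ), Config μ E S c B ε N → ε ≤ ε₁ →
      ∀ s ∈ S (d * (2 * N * (2 * N * 1))), ∀ m : ℕ, m₀ ≤ m → ∀ k : ℕ, k + d = 2 * N + 1 →
        ¬ Occupied E s (9 - k / (2 * N + 1 : ℝ)) m →
        ∀ T : Finset ℕ, T.card = k → (∀ i ∈ T, i < m ∧ Occupied E s (9 + k / (2 * N + 1 : ℝ)) i) →
          PolyApprox μ (3 ^ m) (fun _ => 1) s (1 + d * (2 * N * (2 * N * 1))) tol := by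
  classical
  induction d with
  | zero =>
    refine fun tol _ => ⟨1, one_pos, 0, ?_⟩
    intro μ _ E S ε hc _ s hs m _ k hk _ T hT hTo
    exfalso
    have h1 := hc.card_occupied (hc.anti (Nat.zero_le _) hs) T fun i hi => (hTo i hi).2.mono (by
      have : (k : ℝ) = 2 * N + 1 := by exact_mod_cast hk
      rw [this, div_self (by positivity)]; norm_num)
    omega
  | succ d ih =>
    intro tol htol
    set n := 2 * N with hn
    set J := n * (n * 1) with hJ
    set δ : ℝ := 1 / (2 * N + 1 : ℝ) with hδ
    have hδ0 : 0 < δ := by positivity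
    obtain ⟨K, hK, hsep⟩ := exists_separating_weight n
    obtain ⟨m1, hm1⟩ := hsep (tol / (2 * (14 * B + 1))) (by positivity)
    obtain ⟨⟨M, hM, hMb⟩, hadm⟩ := admissible_sepMult hc0 hB n hK
    obtain ⟨tA, htA, εA, hεA, hA⟩ := hadm 1 (1 + d * J) (tol / 4) (δ / 3) (by positivity)
      (by positivity)
    obtain ⟨εP, hεP, m2, hP⟩ := ih (min tA (tol / 4)) (by positivity)
    refine ⟨min (min εA εP) (min 1 tol), by positivity, max m1 m2, ?_⟩
    intro μ _ E S ε hc hε s hs m hm k hk hemp T hT hTo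
    have hεA' : ε ≤ εA := hε.trans ((min_le_left _ _).trans (min_le_left _ _))
    have hεP' : ε ≤ εP := hε.trans ((min_le_left _ _).trans (min_le_right _ _))
    have hε1 : ε ≤ 1 := hε.trans ((min_le_right _ _).trans (min_le_left _ _))
    have hεt : ε ≤ tol := hε.trans ((min_le_right _ _).trans (min_le_right _ _))
    have hs0 : s ∈ S 0 := hc.anti (Nat.zero_le _) hs
    have hkδ : (k : ℝ) / (2 * N + 1 : ℝ) = k * δ := by rw [hδ]; ring
    have hk1 : (k : ℝ) * δ ≤ 1 := by
      rw [← hkδ, div_le_one (by positivity)]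
      have : k ≤ 2 * N + 1 := by omega
      exact_mod_cast this
    have hkδ0 : 0 ≤ (k : ℝ) * δ := by positivity
    rw [hkδ] at hemp
    simp only [hkδ] at hTo
    set b : ℝ := 9 - k * δ with hb
    by_cases hcase : ∃ i, m < i ∧ Occupied E s b i
    · obtain ⟨hi1, hi1o⟩ := Nat.find_spec hcase
      have hi1min : ∀ i, m < i → i < Nat.find hcase → ¬ Occupied E s b i := fun i h h' ho =>
        Nat.find_min hcase h' ⟨h, ho⟩
      set i1 := Nat.find hcase with hi1def
      have hcnt : ∀ l : ℕ, (∀ i, i1 ≤ i → i < i1 + l → Occupied E s b i) → l ≤ n := by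
        intro l hl
        have := hc.card_occupied hs0 (Finset.Ico i1 (i1 + l)) fun i hi =>
          (hl i (Finset.mem_Ico.1 hi).1 (Finset.mem_Ico.1 hi).2).mono (by linarith)
        simpa using this
      have hex : ∃ m', i1 ≤ m' ∧ ¬ Occupied E s b m' := by
        by_contra hcon
        push Not at hcon
        have := hcnt (n + 1) fun i hi _ => hcon i hi
        omega
      obtain ⟨hm'1, hm'o⟩ := Nat.find_spec hex
      have hm'min : ∀ i, i1 ≤ i → i < Nat.find hex → Occupied E s b i := fun i h h' => by
        by_contra ho
        exact Nat.find_min hex h' ⟨h, ho⟩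
      set m' := Nat.find hex with hm'def
      have hm'n : m' ≤ i1 + n := by
        have := hcnt (m' - i1) fun i hi hi' => hm'min i hi (by omega)
        omega
      have hi1m' : i1 < m' := lt_of_le_of_ne hm'1 fun h => hm'o (h ▸ hi1o)
      have h3m' : (0 : ℝ) < 3 ^ m' := by positivity
      -- approximability of the weight one at nearby slopes
      have hnear : ∀ s' ∈ S (d * J), |s' - s| ≤ δ / 3 / 3 ^ m' →
          PolyApprox μ (3 ^ m') (fun _ => 1) s' (1 + d * J) (min tA (tol / 4)) := by
        intro s' hs' hss
        have hlin : ∀ z : ℝ × ℝ, |z.2| < 3 ^ (m' + 1) → |lin s' z - lin s z| ≤ δ := by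
          intro z hz
          have : lin s' z - lin s z = (s' - s) * z.2 := by unfold lin; ring
          rw [this, abs_mul]
          calc _ ≤ δ / 3 / 3 ^ m' * 3 ^ (m' + 1) :=
                mul_le_mul hss hz.le (abs_nonneg _) (by positivity)
            _ = δ := by field_simp; ring
        have hk' : ((k + 1 : ℕ) : ℝ) / (2 * N + 1 : ℝ) = k * δ + δ := by
          rw [hδ]; push_cast; ring
        have hTi : i1 ∉ T := fun h => by have := (hTo i1 h).1; omega
        refine hP μ E S ε hc hεP' s' hs' m' (by have := le_of_max_le_right hm; omega) (k + 1)
          (by omega) ?_ (insert i1 T) (by rw [Finset.card_insert_of_notMem hTi, hT]) ?_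
        · rintro ⟨z, hz, h1, h2, h3⟩
          refine hm'o ⟨z, hz, h1, h2, ?_⟩
          rw [hk'] at h3
          have := abs_le.1 (hlin z h2)
          have := abs_le.1 h3
          rw [abs_le]; constructor <;> linarith
        · have hup : ∀ i b', i < m' → b' ≤ 9 + k * δ → Occupied E s b' i →
              Occupied E s' (9 + ((k + 1 : ℕ) : ℝ) / (2 * N + 1 : ℝ)) i := by
            rintro i b' hi hb' ⟨z, hz, h1, h2, h3⟩
            refine ⟨z, hz, h1, h2, ?_⟩
            rw [hk']
            have h4 := abs_le.1 (hlin z (h2.trans_le (pow_le_pow_right₀ (by norm_num) (by omega))))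
            have h5 := abs_le.1 h3
            rw [abs_le]; constructor <;> linarith
          intro i hi
          rcases Finset.mem_insert.1 hi with rfl | hi
          · exact ⟨hi1m', hup _ b hi1m' (by linarith) hi1o⟩
          · have := hTo i hi
            exact ⟨by omega, hup i _ (by omega) le_rfl this.2⟩
      -- the separating weight
      obtain ⟨X₀, hX₀V, hX₀c, hX₀n⟩ := exists_net
        (V := {v | |v| < 3 ^ m ∧ ∃ z ∈ E, |lin s z| ≤ 7 ∧ z.2 = v}) (N := N) (fun X hX hXs =>
          hc.sep s hs0 X (fun v hv => by
            obtain ⟨-, z, hz, h1, h2⟩ := hX v hv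
            exact ⟨z, hz, h1.trans (by norm_num), h2⟩) hXs)
      obtain ⟨X₁, hX₁V, hX₁c, hX₁n⟩ := exists_net
        (V := {v | (3 : ℝ) ^ i1 ≤ |v| ∧ ∃ z ∈ E, |lin s z| ≤ 7 ∧ z.2 = v}) (N := N)
        (fun X hX hXs => hc.sep s hs0 X (fun v hv => by
            obtain ⟨-, z, hz, h1, h2⟩ := hX v hv
            exact ⟨z, hz, h1.trans (by norm_num), h2⟩) hXs)
      obtain ⟨W, hWs, hW0, hW1⟩ := hm1 m i1 m' (le_of_max_le_left hm) hi1 hm'1 hm'n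
        X₀.toList X₁.toList (by rw [Finset.length_toList]; omega)
        (by rw [Finset.length_toList]; omega)
        (fun x hx => (hX₀V x (Finset.mem_toList.1 hx)).1)
        (fun x hx => (hX₁V x (Finset.mem_toList.1 hx)).1)
      have hR1 : (1 : ℝ) ≤ 3 ^ m' := one_le_pow₀ (by norm_num)
      have hWb := hMb _ W hR1 hWs
      have hsd : s ∈ S (d * J + J) := by
        rwa [show d * J + J = (d + 1) * J by ring]
      have hW2 : PolyApprox μ (3 ^ m') W s (1 + d * J + J) (tol / 4) := by
        have := hA μ E S ε N hc hεA' (3 ^ m') W (fun _ => 1) hR1 hWs measurable_const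
          (fun _ _ => by simp) (d * J) s hsd fun s' h h' =>
            (hnear s' h h').mono le_rfl (min_le_left _ _)
        rwa [show (fun v => W v * 1) = W from funext fun v => mul_one _] at this
      have hone2 : PolyApprox μ (3 ^ m') (fun _ => 1) s (1 + d * J + J) (tol / 4) :=
        (hnear s (hc.anti (Nat.le_add_right _ _) hsd)
          (by simp only [sub_self, abs_zero]; positivity)).mono (Nat.le_add_right _ _)
            (min_le_right _ _)
      have hfin := polyApprox_of_cluster (R := 3 ^ m) hc hε1 hs0 hWb.1 hWb.2
        (e := tol / (2 * (14 * B + 1))) (by positivity) ?_ hone2 hW2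
      · refine hfin.mono (by rw [show (d + 1) * J = d * J + J by ring]; omega) ?_
        have : tol / (2 * (14 * B + 1)) * (14 * B + 1) = tol / 2 := by field_simp
        rw [this]; linarith
      · intro z hz hz7
        have hmm' : (3 : ℝ) ^ m ≤ 3 ^ m' := pow_le_pow_right₀ (by norm_num) (by omega)
        have hb7 : (7 : ℝ) ≤ b := by linarith
        by_cases h1 : |z.2| < 3 ^ m
        · have h2 : |z.2| < 3 ^ m' := h1.trans_le hmm'
          obtain ⟨x, hx, hxz⟩ := hX₀n z.2 ⟨h1, z, hz, hz7, rfl⟩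
          have := hW0 z.2 h1 ⟨x, Finset.mem_toList.2 hx, hxz⟩
          simpa [indicator, h1, h2] using this
        · by_cases h2 : |z.2| < 3 ^ m'
          · obtain ⟨i, hi, h3, h4⟩ := exists_level (not_lt.1 h1)
            have hocc : Occupied E s b i := ⟨z, hz, h3, h4, hz7.trans hb7⟩
            have hii : i1 ≤ i := by
              by_contra hlt
              rcases hi.eq_or_lt with rfl | hlt'
              · exact hemp hocc
              · exact hi1min i hlt' (not_le.1 hlt) hocc
            obtain ⟨x, hx, hxz⟩ := hX₁n z.2
              ⟨(pow_le_pow_right₀ (by norm_num) hii).trans h3, z, hz, hz7, rfl⟩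
            have := hW1 z.2 h2 ⟨x, Finset.mem_toList.2 hx, hxz⟩
            have hneg : |0 - (1 - W z.2)| = |1 - W z.2| := by rw [zero_sub, abs_neg]
            simp only [indicator, mem_ofPred_eq, h1, h2, if_true, if_false]
            rw [hneg]; exact this
          · simp only [indicator, mem_ofPred_eq, h1, h2, if_false, sub_self, abs_zero]
            positivity
    · push Not at hcase
      refine (polyApprox_of_no_far hc hs0 fun i hi ho => ?_).mono (Nat.le_add_right _ _) hεt
      have ho' : Occupied E s b i := ho.mono (by linarith)
      rcases hi.eq_or_lt with rfl | h
      · exact hemp ho'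
      · exact hcase i h ho'

lemma wdist_one (μ : Measure (ℝ × ℝ)) (R s t : ℝ) :
    wdist μ R (fun _ => 1) s t = μ.real ({z | lin s z ≤ t} ∩ {z | |z.2| < R}) := by
  unfold wdist
  rw [setIntegral_one_eq_measureReal]
  unfold slab
  rw [measureReal_restrict_apply (measurableSet_lin_le s t)]

lemma wdist_one_increment (μ : Measure (ℝ × ℝ)) [IsFiniteMeasure μ] {R R' s t a : ℝ} (hR : R ≤ R')
    (hat : a ≤ t) :
    (wdist μ R' (fun _ => 1) s t - wdist μ R (fun _ => 1) s t) -
      (wdist μ R' (fun _ => 1) s a - wdist μ R (fun _ => 1) s a) =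
      μ.real {z | (a < lin s z ∧ lin s z ≤ t) ∧ R ≤ |z.2| ∧ |z.2| < R'} := by
  have h1 : ∀ t, wdist μ R' (fun _ => 1) s t - wdist μ R (fun _ => 1) s t =
      μ.real {z | lin s z ≤ t ∧ R ≤ |z.2| ∧ |z.2| < R'} := by
    intro t
    have hsub : {z : ℝ × ℝ | lin s z ≤ t} ∩ {z | |z.2| < R} ⊆
        {z | lin s z ≤ t} ∩ {z | |z.2| < R'} :=
      inter_subset_inter_right _ fun z hz => lt_of_lt_of_le (show |z.2| < R from hz) hR
    rw [wdist_one, wdist_one, ← measureReal_sdiff hsub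
      ((measurableSet_lin_le s t).inter (measurableSet_abs_snd_lt R))]
    congr 1
    ext z
    simp only [mem_sdiff, mem_inter_iff, mem_ofPred_eq, not_and, not_lt]
    tauto
  have hsub : {z : ℝ × ℝ | lin s z ≤ a ∧ R ≤ |z.2| ∧ |z.2| < R'} ⊆
      {z | lin s z ≤ t ∧ R ≤ |z.2| ∧ |z.2| < R'} := fun z hz => ⟨hz.1.trans hat, hz.2⟩
  have hmeas : MeasurableSet {z : ℝ × ℝ | lin s z ≤ a ∧ R ≤ |z.2| ∧ |z.2| < R'} :=
    have h : MeasurableSet {z : ℝ × ℝ | R ≤ |z.2|} :=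
      measurableSet_le measurable_const (by fun_prop)
    (measurableSet_lin_le s a).inter (h.inter (measurableSet_abs_snd_lt R'))
  rw [h1, h1, ← measureReal_sdiff hsub hmeas]
  congr 1
  ext z
  simp only [mem_sdiff, mem_ofPred_eq, not_and, not_lt]
  constructor
  · rintro ⟨⟨h1, h2, h3⟩, h4⟩
    refine ⟨⟨?_, h1⟩, h2, h3⟩
    by_contra h
    exact absurd (h4 (not_lt.1 h) h2) (not_le.2 h3)
  · rintro ⟨⟨h1, h2⟩, h3, h4⟩
    exact ⟨⟨h2, h3, h4⟩, fun h => absurd h (not_le.2 h1)⟩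

/-- If the point `y` of a sufficiently high level `j` projects at distance between `1` and `3`, then
some point of a comparable level projects at distance less than `1`. -/
theorem exists_closer_point {c B a : ℝ} (hc0 : 0 < c) (hB : 0 ≤ B) (ha : 0 < a) (N : ℕ) :
    ∃ ε₁ > 0, ∃ m₁ : ℕ, ∀ (μ : Measure (ℝ × ℝ)) [IsFiniteMeasure μ]
      (E : Set (ℝ × ℝ)) (S : ℕ → Set ℝ) (ε : ℝ), Config μ E S c B ε N → ε ≤ ε₁ →
      ∀ s ∈ S ((2 * N + 1) * (2 * N * (2 * N * 1))), 0 ≤ s → s ≤ 1 → ∀ j : ℕ, m₁ ≤ j →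
        ∀ y ∈ E, (3 : ℝ) ^ j ≤ |y.2| → |y.2| < 3 ^ (j + 1) → |lin s y| ≤ 3 →
          a ≤ μ.real (ball y 1) → ∃ z ∈ E, |lin s z| < 1 ∧
            ∃ i, (3 : ℝ) ^ i ≤ |z.2| ∧ |z.2| < 3 ^ (i + 1) ∧ i ≤ j + 2 * N ∧ j ≤ i + 2 * N := by
  set D := 1 + (2 * N + 1) * (2 * N * (2 * N * 1)) with hD
  obtain ⟨C, hC, hrig⟩ := polynomial_rigidity D
  set tol := a / (8 * C + 16) with htol
  have htol0 : 0 < tol := by positivity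
  obtain ⟨ε₁, hε₁, m₀, hP⟩ := polyApprox_below_empty_level hc0 hB N (2 * N + 1) tol htol0
  refine ⟨ε₁, hε₁, m₀ + 2 * N + 2, ?_⟩
  intro μ _ E S ε hc hε s hs hs0 hs1 j hj y hy hyj hyj' hy3 hball
  have hS0 : s ∈ S 0 := hc.anti (Nat.zero_le _) hs
  have hcount : ∀ p l : ℕ, (∀ i, p ≤ i → i < p + l → Occupied E s 9 i) → l ≤ 2 * N := by
    intro p l h
    have := hc.card_occupied hS0 (Finset.Ico p (p + l)) fun i hi =>
      (h i (Finset.mem_Ico.1 hi).1 (Finset.mem_Ico.1 hi).2).mono (by norm_num)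
    simpa using this
  have hjo : Occupied E s 9 j := ⟨y, hy, hyj, hyj', hy3.trans (by norm_num)⟩
  have hup : ∃ m, j < m ∧ ¬ Occupied E s 9 m := by
    by_contra hcon
    push Not at hcon
    have := hcount (j + 1) (2 * N + 1) fun i h _ => hcon i (by omega)
    omega
  have hdn : ∃ l, l < j ∧ ¬ Occupied E s 9 (j - 1 - l) := by
    by_contra hcon
    push Not at hcon
    have := hcount (j - 1 - 2 * N) (2 * N + 1) fun i h h' => by
      have := hcon (j - 1 - i) (by omega)
      rwa [show j - 1 - (j - 1 - i) = i by omega] at this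
    omega
  classical
  obtain ⟨hm1, hmo⟩ := Nat.find_spec hup
  have hmmin : ∀ i, j < i → i < Nat.find hup → Occupied E s 9 i := fun i h h' => by
    by_contra ho
    exact Nat.find_min hup h' ⟨h, ho⟩
  set m := Nat.find hup
  obtain ⟨hl1, hlo⟩ := Nat.find_spec hdn
  have hlmin : ∀ i, j - 1 - Nat.find hdn < i → i < j → Occupied E s 9 i := fun i h h' => by
    by_contra ho
    refine Nat.find_min hdn (m := j - 1 - i) (by omega) ⟨by omega, ?_⟩
    rwa [show j - 1 - (j - 1 - i) = i by omega]
  set p := j - 1 - Nat.find hdn with hp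
  have hpj : p < j := by omega
  have hocc : ∀ i, p < i → i < m → Occupied E s 9 i := fun i h h' => by
    rcases lt_trichotomy i j with h1 | rfl | h1
    · exact hlmin i h h1
    · exact hjo
    · exact hmmin i h1 h'
  have hmp : m - (p + 1) ≤ 2 * N := hcount (p + 1) (m - (p + 1)) fun i h h' =>
    hocc i (by omega) (by omega)
  by_contra hcon
  push Not at hcon
  obtain ⟨P, hPd, hPt⟩ := hP μ E S ε hc hε s hs m (by omega) 0 (by omega) (by simpa using hmo) ∅ rfl
    (by simp)
  obtain ⟨Q, hQd, hQt⟩ := hP μ E S ε hc hε s hs p (by omega) 0 (by omega) (by simpa using hlo) ∅ rfl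
    (by simp)
  set G : ℝ → ℝ := fun t => wdist μ (3 ^ m) (fun _ => 1) s t - wdist μ (3 ^ p) (fun _ => 1) s t
    with hG
  have h3 : (3 : ℝ) ^ p ≤ 3 ^ m := pow_le_pow_right₀ (by norm_num) (by omega)
  have hGi : ∀ b t, b ≤ t → G t - G b =
      μ.real {z | (b < lin s z ∧ lin s z ≤ t) ∧ (3 : ℝ) ^ p ≤ |z.2| ∧ |z.2| < 3 ^ m} := fun b t h =>
    wdist_one_increment μ h3 h
  have hR : ∀ t ∈ Icc (-7 : ℝ) 7, |G t - (P - Q).eval t| ≤ 2 * tol := by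
    intro t ht
    have h1 := hPt t ht
    have h2 := hQt t ht
    rw [Polynomial.eval_sub]
    simp only [hG]
    rw [abs_le] at *
    constructor <;> linarith
  have hGc : ∀ b t, -1 < b → b ≤ t → t < 1 → G t - G b = 0 := by
    intro b t hb hbt ht
    rw [hGi b t hbt]
    refine (measureReal_eq_zero_iff).2 (measure_mono_null ?_ hc.supp)
    rintro z ⟨⟨h1, h2⟩, h4, h5⟩ hz
    obtain ⟨i, hi, h6, h7⟩ := exists_level h4
    have hi0 : i ≠ p := fun h => hlo (h ▸ ⟨z, hz, h6, h7, abs_le.2 ⟨by linarith, by linarith⟩⟩)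
    have him : i < m := (pow_lt_pow_iff_right₀ (by norm_num : (1 : ℝ) < 3)).1 (h6.trans_lt h5)
    have := hcon z hz (abs_lt.2 ⟨by linarith, by linarith⟩) i h6 h7 (by omega)
    omega
  have hGc' : ∀ t ∈ Ioo (-1 : ℝ) 1, G t = G 0 := by
    intro t ht
    rcases le_total 0 t with h | h
    · linarith [hGc 0 t (by norm_num) h ht.2]
    · linarith [hGc t 0 ht.1 h (by norm_num)]
  have hfl := hrig (P - Q) ((Polynomial.natDegree_sub_le _ _).trans (max_le hPd hQd)) (G 0)
    (2 * tol) (by positivity) (fun x hx => by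
      have := hR x ⟨by linarith [hx.1], by linarith [hx.2]⟩
      rwa [hGc' x hx, abs_sub_comm] at this)
  have hvar : ∀ t ∈ Icc (-7 : ℝ) 7, |G t - G 0| ≤ (2 * C + 2) * tol := by
    intro t ht
    have h1 := hR t ht
    have h2 := hfl t ht
    rw [abs_le] at *
    constructor <;> linarith
  have h5 := hvar 5 (by norm_num)
  have h5' := hvar (-5) (by norm_num)
  have hbig : a ≤ G 5 - G (-5) := by
    rw [hGi (-5) 5 (by norm_num)]
    refine hball.trans ?_
    have hae : ball y 1 ≤ᵐ[μ]
        {z | (-5 < lin s z ∧ lin s z ≤ 5) ∧ (3 : ℝ) ^ p ≤ |z.2| ∧ |z.2| < 3 ^ m} := by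
      filter_upwards [hc.ae_mem] with z hz hzy
      have hd : dist z y < 1 := hzy
      rw [Prod.dist_eq, max_lt_iff, Real.dist_eq, Real.dist_eq] at hd
      have hl : |lin s z| < 5 := by
        have e : lin s z = lin s y + ((z.1 - y.1) + s * (z.2 - y.2)) := by unfold lin; ring
        have e1 := abs_add_le (lin s y) ((z.1 - y.1) + s * (z.2 - y.2))
        have e2 := abs_add_le (z.1 - y.1) (s * (z.2 - y.2))
        have e3 : |s * (z.2 - y.2)| ≤ 1 := by
          rw [abs_mul, abs_of_nonneg hs0]
          nlinarith [abs_nonneg (z.2 - y.2), hd.2]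
        rw [e]; linarith
      have hv1 : |y.2| - 1 < |z.2| := by
        have := abs_sub_abs_le_abs_sub y.2 z.2
        rw [abs_sub_comm] at this
        linarith [hd.2]
      have hv2 : |z.2| < |y.2| + 1 := by
        have := abs_sub_abs_le_abs_sub z.2 y.2
        linarith [hd.2]
      refine ⟨⟨(abs_lt.1 hl).1, (abs_lt.1 hl).2.le⟩, ?_, ?_⟩
      · have e1 : (3 : ℝ) ^ p ≤ 3 ^ (j - 1) := pow_le_pow_right₀ (by norm_num) (by omega)
        have e2 : (3 : ℝ) ^ j = 3 * 3 ^ (j - 1) := by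
          rw [← pow_succ']; congr 1; omega
        have e3 : (1 : ℝ) ≤ 3 ^ (j - 1) := one_le_pow₀ (by norm_num)
        linarith
      · by_contra hlt
        rw [not_lt] at hlt
        have e3 : (1 : ℝ) ≤ 3 ^ (j + 1) := one_le_pow₀ (by norm_num)
        have e4 : (3 : ℝ) ^ (j + 1 + 1) = 3 * 3 ^ (j + 1) := pow_succ' _ _
        obtain ⟨i, hi, h6, h7⟩ := exists_level hlt
        have hij : i < j + 1 + 1 :=
          (pow_lt_pow_iff_right₀ (by norm_num : (1 : ℝ) < 3)).1 (h6.trans_lt (by linarith))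
        have : i = m := by omega
        exact hmo (this ▸ ⟨z, hz, h6, h7, hl.le.trans (by norm_num)⟩)
    exact ENNReal.toReal_mono (measure_ne_top _ _) (measure_mono_ae hae)
  have : (8 * C + 16) * tol = a := by rw [htol]; field_simp
  rw [abs_le] at h5 h5'
  nlinarith

/-- Index of the triadic interval of generation `k`, in the grid translated by `e`, containing
`t`. -/
def idx (e : ℝ) (k : ℕ) (t : ℝ) : ℤ := ⌊3 ^ k * (t - e)⌋

/-- The triadic interval of generation `k`, in the grid translated by `e`, containing `t`. -/
def cell (e : ℝ) (k : ℕ) (t : ℝ) : Set ℝ := {t' | idx e k t' = idx e k t}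

lemma measurable_idx (e : ℝ) (k : ℕ) : Measurable (idx e k) :=
  Int.measurable_floor.comp (by fun_prop)

lemma idx_eq_idx_succ_div (e : ℝ) (k : ℕ) (t : ℝ) : idx e k t = idx e (k + 1) t / 3 := by
  unfold idx
  rw [show (3 : ℝ) ^ k * (t - e) = 3 ^ (k + 1) * (t - e) / (3 : ℕ) by push_cast; ring,
    Int.floor_div_natCast]
  rfl

lemma idx_eq_of_le {e : ℝ} {k l : ℕ} (hkl : k ≤ l) {t t' : ℝ} (h : idx e l t = idx e l t') :
    idx e k t = idx e k t' := by
  induction l, hkl using Nat.le_induction with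
  | base => exact h
  | succ l _ ih => exact ih (by rw [idx_eq_idx_succ_div, h, ← idx_eq_idx_succ_div])

lemma idx_eq_iff {e : ℝ} {k : ℕ} {t : ℝ} {m : ℤ} :
    idx e k t = m ↔ t ∈ Ico (e + m / 3 ^ k) (e + (m + 1) / 3 ^ k) := by
  have h : (0 : ℝ) < 3 ^ k := by positivity
  unfold idx
  rw [Int.floor_eq_iff, mem_Ico]
  constructor
  · rintro ⟨h1, h2⟩
    constructor
    · have := (div_le_iff₀' h).2 h1; linarith
    · have := (lt_div_iff₀' h).2 h2; linarith
  · rintro ⟨h1, h2⟩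
    constructor
    · rw [← div_le_iff₀' h]; linarith
    · rw [← lt_div_iff₀' h]; linarith

lemma measurableSet_idx_eq (e : ℝ) (k : ℕ) (m : ℤ) : MeasurableSet {t | idx e k t = m} :=
  measurable_idx e k (measurableSet_singleton m)

lemma volume_idx_eq (e : ℝ) (k : ℕ) (m : ℤ) : volume {t | idx e k t = m} = ((3 : ℝ≥0∞) ^ k)⁻¹ := by
  have : {t | idx e k t = m} = Ico (e + m / 3 ^ k) (e + (m + 1) / 3 ^ k) := by
    ext t; exact idx_eq_iff
  rw [this, Real.volume_Ico, show e + ((m : ℝ) + 1) / 3 ^ k - (e + m / 3 ^ k) = ((3 : ℝ) ^ k)⁻¹ by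
    ring, ENNReal.ofReal_inv_of_pos (by positivity), ENNReal.ofReal_pow (by norm_num),
    ENNReal.ofReal_ofNat]

lemma volume_cell (e : ℝ) (k : ℕ) (t : ℝ) : volume (cell e k t) = ((3 : ℝ≥0∞) ^ k)⁻¹ :=
  volume_idx_eq e k _

lemma measurableSet_cell (e : ℝ) (k : ℕ) (t : ℝ) : MeasurableSet (cell e k t) :=
  measurableSet_idx_eq e k _

lemma cell_congr {e : ℝ} {k l : ℕ} (hkl : k ≤ l) {t t' : ℝ} (h : idx e l t = idx e l t') :
    cell e k t = cell e k t' := by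
  unfold cell; rw [idx_eq_of_le hkl h]

lemma abs_sub_lt_of_mem_cell {e : ℝ} {k : ℕ} {t t' : ℝ} (h : t' ∈ cell e k t) :
    |t' - t| < (3 ^ k)⁻¹ := by
  have h1 := idx_eq_iff.1 (show idx e k t' = idx e k t from h)
  have h2 := idx_eq_iff.1 (rfl : idx e k t = idx e k t)
  have h3 : (e + ((idx e k t : ℝ) + 1) / 3 ^ k) = e + (idx e k t : ℝ) / 3 ^ k + (3 ^ k)⁻¹ := by ring
  rw [abs_lt]
  constructor <;> linarith [h1.1, h1.2, h2.1, h2.2]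

/-- Comparison of two measures on a union of triadic intervals. -/
lemma measure_le_of_forall_cell {σ ν : Measure ℝ} {e : ℝ} {k : ℕ} {Y : Set ℝ}
    (hY : ∀ t t', idx e k t = idx e k t' → t ∈ Y → t' ∈ Y)
    (h : ∀ t ∈ Y, σ (cell e k t) ≤ ν (cell e k t)) : σ Y ≤ ν Y := by
  have e1 : Y = ⋃ m ∈ idx e k '' Y, {t | idx e k t = m} := by
    ext t
    simp only [mem_iUnion, mem_image, exists_prop, mem_ofPred_eq]
    constructor
    · exact fun ht => ⟨_, ⟨t, ht, rfl⟩, rfl⟩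
    · rintro ⟨m, ⟨t', ht', rfl⟩, h⟩
      exact hY t' t h.symm ht'
  have hd : (idx e k '' Y).PairwiseDisjoint fun m => {t | idx e k t = m} := by
    intro m _ m' _ hne
    rw [Function.onFun, Set.disjoint_left]
    rintro t (rfl : idx e k t = m) (h : idx e k t = m')
    exact hne h
  rw [e1, measure_biUnion (to_countable _) hd fun m _ => measurableSet_idx_eq e k m,
    measure_biUnion (to_countable _) hd fun m _ => measurableSet_idx_eq e k m]
  refine ENNReal.tsum_le_tsum ?_
  rintro ⟨m, t, ht, rfl⟩
  exact h t ht

lemma measurableSet_of_idx {e : ℝ} {k : ℕ} {Y : Set ℝ}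
    (hY : ∀ t t', idx e k t = idx e k t' → t ∈ Y → t' ∈ Y) : MeasurableSet Y := by
  have : Y = idx e k ⁻¹' (idx e k '' Y) := by
    refine Subset.antisymm (subset_preimage_image _ _) ?_
    rintro t ⟨t', ht', h⟩
    exact hY t' t h ht'
  rw [this]
  exact measurable_idx e k (MeasurableSet.of_discrete)

/-- Weak type inequality for the triadic maximal function of one measure relative to another. -/
lemma measure_exists_cell_lt_le (σ ν : Measure ℝ) (e : ℝ) :
    σ {t | ∃ k, σ (cell e k t) < ν (cell e k t)} ≤ ν univ := by
  set b : ℕ → Set ℝ := fun k => {t | σ (cell e k t) < ν (cell e k t)} with hb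
  have hcong : ∀ {k l t t'}, k ≤ l → idx e l t = idx e l t' → t ∈ b k → t' ∈ b k := by
    intro k l t t' hkl h ht
    simp only [hb, mem_ofPred_eq] at ht ⊢
    rwa [cell_congr hkl h] at ht
  have e1 : {t | ∃ k, σ (cell e k t) < ν (cell e k t)} = ⋃ k, disjointed b k := by
    rw [iUnion_disjointed]
    ext t; simp [hb]
  have hY : ∀ k t t', idx e k t = idx e k t' → t ∈ disjointed b k → t' ∈ disjointed b k := by
    intro k t t' h ht
    rw [disjointed_eq_inter_compl] at ht ⊢
    refine ⟨hcong le_rfl h ht.1, mem_iInter₂.2 fun j hj hb' => ?_⟩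
    exact mem_iInter₂.1 ht.2 j hj (hcong hj.le h.symm hb')
  rw [e1]
  calc σ (⋃ k, disjointed b k) ≤ ∑' k, σ (disjointed b k) := measure_iUnion_le _
    _ ≤ ∑' k, ν (disjointed b k) := ENNReal.tsum_le_tsum fun k =>
        measure_le_of_forall_cell (hY k) fun t ht => (disjointed_subset b k ht).le
    _ = ν (⋃ k, disjointed b k) := (measure_iUnion (disjoint_disjointed b)
        fun k => measurableSet_of_idx (hY k)).symm
    _ ≤ ν univ := measure_mono (subset_univ _)

/-- Average density of `ν` on the triadic interval of generation `k` around `t`. -/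
def dens (ν : Measure ℝ) (e : ℝ) (k : ℕ) (t : ℝ) : ℝ≥0∞ := 3 ^ k * ν (cell e k t)

lemma dens_congr (ν : Measure ℝ) {e : ℝ} {k l : ℕ} (hkl : k ≤ l) {t t' : ℝ}
    (h : idx e l t = idx e l t') : dens ν e k t = dens ν e k t' := by
  unfold dens; rw [cell_congr hkl h]

lemma dens_succ_le (ν : Measure ℝ) (e : ℝ) (k : ℕ) (t : ℝ) :
    dens ν e (k + 1) t ≤ 3 * dens ν e k t := by
  unfold dens
  rw [pow_succ', mul_assoc]
  gcongr
  exact fun t' ht' => idx_eq_of_le (Nat.le_succ k) ht'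

lemma dens_add_le (ν : Measure ℝ) (e : ℝ) (k d : ℕ) (t : ℝ) :
    dens ν e (k + d) t ≤ 3 ^ d * dens ν e k t := by
  induction d with
  | zero => simp
  | succ d ih =>
    refine (dens_succ_le ν e (k + d) t).trans ?_
    rw [pow_succ', mul_assoc]
    gcongr

lemma dens_ne_top (ν : Measure ℝ) [IsFiniteMeasure ν] (e : ℝ) (k : ℕ) (t : ℝ) :
    dens ν e k t ≠ ⊤ := by
  unfold dens
  exact ENNReal.mul_ne_top (by simp) (measure_ne_top _ _)

lemma measurable_of_idx {β : Type*} [MeasurableSpace β] {e : ℝ} {k : ℕ} {g : ℝ → β}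
    (hg : ∀ t t', idx e k t = idx e k t' → g t = g t') : Measurable g := by
  have h : g = Function.extend (idx e k) g (fun _ => g 0) ∘ idx e k := by
    ext t
    exact ((show Function.FactorsThrough g (idx e k) from fun a b h => hg a b h).extend_apply
      _ t).symm
  rw [h]
  exact (measurable_from_top).comp (measurable_idx e k)

lemma lintegral_mul_dens (ν : Measure ℝ) {e : ℝ} {k : ℕ} {g : ℝ → ℝ≥0∞}
    (hg : ∀ t t', idx e k t = idx e k t' → g t = g t') :
    ∫⁻ t, g t * dens ν e k t = ∫⁻ t, g t ∂ν := by
  set φ := Function.extend (idx e k) g 0 with hφ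
  have h : ∀ t, g t = φ (idx e k t) := fun t =>
    ((show Function.FactorsThrough g (idx e k) from fun a b h => hg a b h).extend_apply _ t).symm
  have h1 : ∫⁻ t, g t ∂ν = ∑' m, φ m * ν {t | idx e k t = m} := by
    simp_rw [h]
    rw [← lintegral_map (f := φ) measurable_from_top (measurable_idx e k), lintegral_countable']
    refine tsum_congr fun m => ?_
    rw [Measure.map_apply (measurable_idx e k) (measurableSet_singleton m)]
    rfl
  have h2 : ∫⁻ t, g t * dens ν e k t =
      ∑' m, (φ m * (3 ^ k * ν {t | idx e k t = m})) * volume {t | idx e k t = m} := by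
    have : ∀ t, g t * dens ν e k t =
        (fun m => φ m * (3 ^ k * ν {t | idx e k t = m})) (idx e k t) := fun t => by
      rw [h]; rfl
    simp_rw [this]
    rw [← lintegral_map (f := fun m => φ m * (3 ^ k * ν {t | idx e k t = m})) measurable_from_top
      (measurable_idx e k), lintegral_countable']
    refine tsum_congr fun m => ?_
    rw [Measure.map_apply (measurable_idx e k) (measurableSet_singleton m)]
    rfl
  rw [h1, h2]
  refine tsum_congr fun m => ?_
  rw [volume_idx_eq]
  have h3 : (3 : ℝ≥0∞) ^ k * (3 ^ k)⁻¹ = 1 :=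
    ENNReal.mul_inv_cancel (by positivity) (by simp)
  calc _ = φ m * ν {t | idx e k t = m} * (3 ^ k * (3 ^ k)⁻¹) := by ring
    _ = _ := by rw [h3, mul_one]

/-- Difference of the average densities of two consecutive generations. -/
def jump (ν : Measure ℝ) (e : ℝ) (l : ℕ) (t : ℝ) : ℝ :=
  (dens ν e (l + 1) t).toReal - (dens ν e l t).toReal

/-- The points around which all triadic densities up to generation `l` are at most `M`. -/
def lowDens (ν : Measure ℝ) (e : ℝ) (M : ℝ≥0∞) (l : ℕ) : Set ℝ := {t | ∀ i ≤ l, dens ν e i t ≤ M}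

lemma lowDens_congr {ν : Measure ℝ} {e : ℝ} {M : ℝ≥0∞} {l : ℕ} {t t' : ℝ}
    (h : idx e l t = idx e l t') (ht : t ∈ lowDens ν e M l) : t' ∈ lowDens ν e M l :=
  fun i hi => (dens_congr ν hi h).symm.le.trans (ht i hi)

lemma jump_congr (ν : Measure ℝ) {e : ℝ} {l : ℕ} {t t' : ℝ} (h : idx e (l + 1) t = idx e (l + 1) t') :
    jump ν e l t = jump ν e l t' := by
  unfold jump
  rw [dens_congr ν le_rfl h, dens_congr ν (Nat.le_succ l) h]

lemma measurableSet_lowDens (ν : Measure ℝ) (e : ℝ) (M : ℝ≥0∞) (l : ℕ) :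
    MeasurableSet (lowDens ν e M l) :=
  measurableSet_of_idx (e := e) (k := l) fun _ _ => lowDens_congr

lemma measurable_dens (ν : Measure ℝ) (e : ℝ) (l : ℕ) : Measurable (dens ν e l) :=
  measurable_of_idx (e := e) (k := l) fun _ _ => dens_congr ν le_rfl

lemma measurable_jump (ν : Measure ℝ) (e : ℝ) (l : ℕ) : Measurable (jump ν e l) :=
  measurable_of_idx (e := e) (k := l + 1) fun _ _ => jump_congr ν

lemma ofReal_sq_sub_add {a b : ℝ≥0∞} (ha : a ≠ ⊤) (hb : b ≠ ⊤) :
    ENNReal.ofReal ((a.toReal - b.toReal) ^ 2) + (b * a + b * a) = a * a + b * b := by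
  lift a to ℝ≥0 using ha
  lift b to ℝ≥0 using hb
  rw [← ENNReal.toReal_eq_toReal_iff' (by finiteness) (by finiteness), ENNReal.toReal_add (by finiteness) (by finiteness),
    ENNReal.toReal_ofReal (sq_nonneg _)]
  rw [← ENNReal.coe_mul, ← ENNReal.coe_mul, ← ENNReal.coe_mul, ← ENNReal.coe_add,
    ← ENNReal.coe_add]
  simp only [ENNReal.coe_toReal]
  push_cast
  ring

lemma setLIntegral_le_const_mul {ν : Measure ℝ} {f : ℝ → ℝ≥0∞} {G : Set ℝ} {M : ℝ≥0∞}
    (hG : MeasurableSet G) (h : ∀ t ∈ G, f t ≤ M) : ∫⁻ t in G, f t ∂ν ≤ M * ν G := by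
  rw [← setLIntegral_const]
  exact setLIntegral_mono' hG h

lemma lintegral_jump_add (ν : Measure ℝ) [IsFiniteMeasure ν] (e : ℝ) {M : ℝ≥0∞} (hM : M ≠ ⊤)
    (l : ℕ) : (∫⁻ t in lowDens ν e M l, ENNReal.ofReal (jump ν e l t ^ 2)) +
      ∫⁻ t in lowDens ν e M l, dens ν e l t ∂ν = ∫⁻ t in lowDens ν e M l, dens ν e (l + 1) t ∂ν := by
  set G := lowDens ν e M l with hG
  have hGm : MeasurableSet G := measurableSet_lowDens ν e M l
  have key : ∀ k j, l ≤ k → k ≤ j → j ≤ l + 1 →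
      ∫⁻ t in G, dens ν e k t * dens ν e j t = ∫⁻ t in G, dens ν e k t ∂ν := by
    intro k j hl hkj hj
    rw [← lintegral_indicator hGm, ← lintegral_indicator hGm,
      ← lintegral_mul_dens (e := e) (k := j) ν (g := G.indicator (dens ν e k))]
    · refine lintegral_congr fun t => ?_
      by_cases ht : t ∈ G <;> simp [ht]
    · intro t t' h
      have hd := dens_congr ν hkj h
      have hi : idx e l t = idx e l t' := idx_eq_of_le (hl.trans hkj) h
      by_cases ht : t ∈ G
      · have ht' : t' ∈ G := lowDens_congr hi ht
        simp [ht, ht', hd]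
      · have ht' : t' ∉ G := fun h' => ht (lowDens_congr hi.symm h')
        simp [ht, ht']
  have hm1 := measurable_dens ν e (l + 1)
  have hm0 := measurable_dens ν e l
  have hmj := measurable_jump ν e l
  have e1 : (∫⁻ t in G, ENNReal.ofReal (jump ν e l t ^ 2)) +
      (∫⁻ t in G, dens ν e l t ∂ν + ∫⁻ t in G, dens ν e l t ∂ν) =
      ∫⁻ t in G, dens ν e (l + 1) t ∂ν + ∫⁻ t in G, dens ν e l t ∂ν := by
    rw [← key l (l + 1) le_rfl (Nat.le_succ l) le_rfl,
      ← key (l + 1) (l + 1) (Nat.le_succ l) le_rfl le_rfl]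
    conv_rhs => rw [key l (l + 1) le_rfl (Nat.le_succ l) le_rfl,
      ← key l l le_rfl le_rfl (Nat.le_succ l)]
    rw [← lintegral_add_left (f := fun t => dens ν e l t * dens ν e (l + 1) t) (hm0.mul hm1), ← lintegral_add_left (by fun_prop),
      ← lintegral_add_left
        (f := fun t => dens ν e (l + 1) t * dens ν e (l + 1) t) (hm1.mul hm1)]
    refine lintegral_congr fun t => ?_
    exact ofReal_sq_sub_add (dens_ne_top ν e _ t) (dens_ne_top ν e _ t)
  have hfin : ∫⁻ t in G, dens ν e l t ∂ν ≠ ⊤ := by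
    refine ne_top_of_le_ne_top (ENNReal.mul_ne_top hM (measure_ne_top ν G)) ?_
    exact setLIntegral_le_const_mul hGm fun t ht => ht l le_rfl
  rw [← add_assoc] at e1
  exact (ENNReal.add_left_inj hfin).1 e1

lemma sum_lintegral_jump_le (ν : Measure ℝ) [IsFiniteMeasure ν] (e : ℝ) {M : ℝ≥0∞} (hM : M ≠ ⊤) :
    ∑' l, ∫⁻ t in lowDens ν e M l, ENNReal.ofReal (jump ν e l t ^ 2) ≤ 4 * M * ν univ := by
  have hG : ∀ l, MeasurableSet (lowDens ν e M l) := measurableSet_lowDens ν e M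
  have hanti : ∀ l, lowDens ν e M (l + 1) ⊆ lowDens ν e M l := fun l t ht i hi =>
    ht i (hi.trans (Nat.le_succ l))
  have hind : ∀ L, ∑ l ∈ Finset.range L, ∫⁻ t in lowDens ν e M l, ENNReal.ofReal (jump ν e l t ^ 2)
      ≤ ∫⁻ t in lowDens ν e M L, dens ν e L t ∂ν + 3 * M * ν (lowDens ν e M L)ᶜ := by
    intro L
    induction L with
    | zero => simp
    | succ L ih =>
      rw [Finset.sum_range_succ]
      have e1 : ∫⁻ t in lowDens ν e M L, dens ν e (L + 1) t ∂ν ≤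
          ∫⁻ t in lowDens ν e M (L + 1), dens ν e (L + 1) t ∂ν +
          3 * M * ν (lowDens ν e M L \ lowDens ν e M (L + 1)) := by
        rw [← lintegral_inter_add_sdiff _ (lowDens ν e M L) (hG (L + 1)),
          inter_eq_self_of_subset_right (hanti L)]
        gcongr
        exact setLIntegral_le_const_mul ((hG L).diff (hG (L + 1))) fun t ht =>
          (dens_succ_le ν e L t).trans (by gcongr; exact ht.1 L le_rfl)
      have e2 : ν (lowDens ν e M L \ lowDens ν e M (L + 1)) + ν (lowDens ν e M L)ᶜ =
          ν (lowDens ν e M (L + 1))ᶜ := by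
        rw [← measure_union _ (hG L).compl]
        · congr 1
          ext t
          have := @hanti L t
          simp only [mem_union, mem_sdiff, mem_compl_iff]
          tauto
        · rw [Set.disjoint_left]
          exact fun t ht h => h ht.1
      calc _ ≤ (∫⁻ t in lowDens ν e M L, dens ν e L t ∂ν + 3 * M * ν (lowDens ν e M L)ᶜ) +
            ∫⁻ t in lowDens ν e M L, ENNReal.ofReal (jump ν e L t ^ 2) := by gcongr
        _ = ∫⁻ t in lowDens ν e M L, dens ν e (L + 1) t ∂ν + 3 * M * ν (lowDens ν e M L)ᶜ := by
          rw [← lintegral_jump_add ν e hM L]; ring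
        _ ≤ _ := by
          rw [← e2, mul_add, ← add_assoc]
          gcongr
  rw [ENNReal.tsum_eq_iSup_nat]
  refine iSup_le fun L => (hind L).trans ?_
  have e3 : ∫⁻ t in lowDens ν e M L, dens ν e L t ∂ν ≤ M * ν (lowDens ν e M L) :=
    setLIntegral_le_const_mul (hG L) fun t ht => ht L le_rfl
  calc _ ≤ M * ν univ + 3 * M * ν univ := by
        gcongr
        · exact e3.trans (by gcongr; exact subset_univ _)
        · exact subset_univ _
    _ = _ := by ring

/-- The points near which the density of `ν` varies by more than `ε` at some of the `q`
generations following `k`. -/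
def varies (ν : Measure ℝ) (e : ℝ) (q : ℕ) (ε : ℝ) (k : ℕ) : Set ℝ :=
  {t | ∃ d < q, ε < |jump ν e (k + d) t|}

lemma varies_congr {ν : Measure ℝ} {e : ℝ} {q : ℕ} {ε : ℝ} {k : ℕ} {t t' : ℝ}
    (h : idx e (k + q) t = idx e (k + q) t') (ht : t ∈ varies ν e q ε k) :
    t' ∈ varies ν e q ε k := by
  obtain ⟨d, hd, h1⟩ := ht
  exact ⟨d, hd, by rwa [← jump_congr ν (idx_eq_of_le (by omega) h)]⟩

lemma le_volume_cell_inter_varies {ν : Measure ℝ} {e : ℝ} {q : ℕ} {ε : ℝ} {k : ℕ} {t t' : ℝ}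
    (h : t' ∈ cell e k t) (ht : t' ∈ varies ν e q ε k) :
    ((3 : ℝ≥0∞) ^ (k + q))⁻¹ ≤ volume (cell e k t ∩ varies ν e q ε k) := by
  rw [← volume_cell e (k + q) t']
  refine measure_mono fun y hy => ⟨?_, ?_⟩
  · exact (idx_eq_of_le (Nat.le_add_right k q) hy).trans h
  · exact varies_congr (show idx e (k + q) y = idx e (k + q) t' from hy).symm ht

/-- The scales at which the density of `ν` varies are summable. -/
lemma tsum_measure_varies_le (ν : Measure ℝ) [IsFiniteMeasure ν] (e : ℝ) {M : ℝ≥0∞} (hM : M ≠ ⊤)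
    (q : ℕ) {ε : ℝ} (hε : 0 < ε) :
    ∑' k, ν {t | t ∈ lowDens ν e M k ∧ volume (cell e k t ∩ varies ν e q ε k) ≠ 0} ≤
      M * 3 ^ q * (q * ((ENNReal.ofReal (ε ^ 2))⁻¹ * (4 * (3 ^ q * M) * ν univ))) := by
  set M' := 3 ^ q * M with hM'
  have hM'top : M' ≠ ⊤ := ENNReal.mul_ne_top (by simp) hM
  set X : ℕ → ℝ≥0∞ := fun l => ∫⁻ t in lowDens ν e M' l, ENNReal.ofReal (jump ν e l t ^ 2) with hX
  have hεt : ENNReal.ofReal (ε ^ 2) ≠ ⊤ := ENNReal.ofReal_ne_top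
  have hε0 : ENNReal.ofReal (ε ^ 2) ≠ 0 := by
    simpa using hε.ne'
  have hcheb : ∀ l, volume {t | t ∈ lowDens ν e M' l ∧ ε < |jump ν e l t|} ≤
      (ENNReal.ofReal (ε ^ 2))⁻¹ * X l := by
    intro l
    rw [← ENNReal.mul_le_iff_le_inv hε0 hεt]
    have h1 := mul_meas_ge_le_lintegral₀ (μ := volume.restrict (lowDens ν e M' l))
      (f := fun t => ENNReal.ofReal (jump ν e l t ^ 2))
      ((measurable_jump ν e l).pow_const 2).ennreal_ofReal.aemeasurable (ENNReal.ofReal (ε ^ 2))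
    refine le_trans (mul_le_mul_right ?_ _) h1
    rw [Measure.restrict_apply' (measurableSet_lowDens ν e M' l)]
    refine measure_mono fun t ht => ⟨?_, ht.1⟩
    refine ENNReal.ofReal_le_ofReal ?_
    rw [← sq_abs (jump ν e l t)]
    exact pow_le_pow_left₀ hε.le ht.2.le 2
  have hlevel : ∀ k, ν {t | t ∈ lowDens ν e M k ∧ volume (cell e k t ∩ varies ν e q ε k) ≠ 0} ≤
      M * 3 ^ q * ∑ d ∈ Finset.range q, (ENNReal.ofReal (ε ^ 2))⁻¹ * X (k + d) := by
    intro k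
    set Y := {t | t ∈ lowDens ν e M k ∧ volume (cell e k t ∩ varies ν e q ε k) ≠ 0} with hY
    have hYc : ∀ t t', idx e k t = idx e k t' → t ∈ Y → t' ∈ Y := fun t t' h ht =>
      ⟨lowDens_congr h ht.1, by rw [← cell_congr le_rfl h]; exact ht.2⟩
    have hYm : MeasurableSet Y := measurableSet_of_idx hYc
    have hV : MeasurableSet (varies ν e q ε k) := measurableSet_of_idx fun _ _ => varies_congr
    have h1 : ν Y ≤ (M * 3 ^ q) • (volume.restrict (varies ν e q ε k)) Y := by
      have := measure_le_of_forall_cell (σ := ν)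
        (ν := (M * 3 ^ q) • (volume.restrict (varies ν e q ε k))) hYc fun t ht => by
        rw [Measure.smul_apply, smul_eq_mul, Measure.restrict_apply (measurableSet_cell e k t)]
        obtain ⟨t', ht', ht''⟩ := nonempty_of_measure_ne_zero ht.2
        have h2 := le_volume_cell_inter_varies ht' ht''
        have h3 : ν (cell e k t) ≤ M * (3 ^ k)⁻¹ := by
          have := ht.1 k le_rfl
          unfold dens at this
          rw [← div_eq_mul_inv, ENNReal.le_div_iff_mul_le (by simp) (by simp), mul_comm]
          exact this
        refine h3.trans ?_
        rw [mul_assoc]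
        gcongr
        refine le_trans ?_ (mul_le_mul_right h2 (3 ^ q))
        rw [pow_add, ENNReal.mul_inv (by simp) (by simp), mul_left_comm,
          ENNReal.mul_inv_cancel (by simp) (by simp), mul_one]
      simpa using this
    refine h1.trans ?_
    rw [smul_eq_mul, Measure.restrict_apply hYm]
    gcongr
    have h2 : Y ∩ varies ν e q ε k ⊆
        ⋃ d ∈ Finset.range q, {t | t ∈ lowDens ν e M' (k + d) ∧ ε < |jump ν e (k + d) t|} := by
      rintro t ⟨ht, d, hd, hj⟩
      refine mem_iUnion₂.2 ⟨d, Finset.mem_range.2 hd, ?_, hj⟩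
      intro i hi
      by_cases hik : i ≤ k
      · refine (ht.1 i hik).trans ?_
        rw [hM']
        exact le_mul_of_one_le_left zero_le (one_le_pow₀ (by norm_num))
      · obtain ⟨j, rfl⟩ := Nat.exists_eq_add_of_le (not_le.1 hik).le
        refine (dens_add_le ν e k j t).trans ?_
        rw [hM']
        gcongr
        · norm_num
        · omega
        · exact ht.1 k le_rfl
    refine (measure_mono h2).trans ((measure_biUnion_finset_le _ _).trans ?_)
    exact Finset.sum_le_sum fun d _ => hcheb (k + d)
  have hsum := sum_lintegral_jump_le ν e hM'top
  calc _ ≤ ∑' k, M * 3 ^ q * ∑ d ∈ Finset.range q, (ENNReal.ofReal (ε ^ 2))⁻¹ * X (k + d) :=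
        ENNReal.tsum_le_tsum hlevel
    _ = M * 3 ^ q * ∑ d ∈ Finset.range q, (ENNReal.ofReal (ε ^ 2))⁻¹ * ∑' k, X (k + d) := by
        rw [ENNReal.tsum_mul_left, Summable.tsum_finsetSum fun _ _ => ENNReal.summable]
        simp_rw [ENNReal.tsum_mul_left]
    _ ≤ M * 3 ^ q * ∑ d ∈ Finset.range q, (ENNReal.ofReal (ε ^ 2))⁻¹ * (4 * M' * ν univ) := by
        gcongr with d _
        refine le_trans ?_ hsum
        exact ENNReal.tsum_comp_le_tsum_of_injective (add_left_injective d) X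
    _ = _ := by
        rw [Finset.sum_const, Finset.card_range, nsmul_eq_mul]

lemma dens_map_lin (μ : Measure (ℝ × ℝ)) (s e : ℝ) (k : ℕ) (t : ℝ) :
    dens (μ.map (lin s)) e k t = 3 ^ k * μ {z | idx e k (lin s z) = idx e k t} := by
  unfold dens
  rw [Measure.map_apply (measurable_lin s) (measurableSet_cell e k t)]
  rfl

lemma measurable_dens_map_lin (μ : Measure (ℝ × ℝ)) [SFinite μ] (e : ℝ) (k : ℕ) :
    Measurable fun p : ℝ × ℝ => dens (μ.map (lin p.1)) e k p.2 := by
  simp_rw [dens_map_lin]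
  refine Measurable.const_mul ?_ _
  have hW : MeasurableSet {w : (ℝ × ℝ) × (ℝ × ℝ) | idx e k (lin w.1.1 w.2) = idx e k w.1.2} := by
    refine measurableSet_eq_fun ?_ ?_
    · have h : Measurable fun w : (ℝ × ℝ) × (ℝ × ℝ) => lin w.1.1 w.2 := by unfold lin; fun_prop
      exact (measurable_idx e k).comp h
    · exact (measurable_idx e k).comp (by fun_prop)
  exact measurable_measure_prodMk_left hW

/-- Pairs of a point and a slope for which all projected densities around the projection of the
point are at most `M`. -/
def densBounded (μ : Measure (ℝ × ℝ)) (e : ℝ) (M : ℝ≥0∞) : Set ((ℝ × ℝ) × ℝ) :=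
  {p | ∀ k, dens (μ.map (lin p.2)) e k (lin p.2 p.1) ≤ M}

lemma measurable_swap_lin : Measurable fun p : (ℝ × ℝ) × ℝ => (p.2, lin p.2 p.1) := by
  refine Measurable.prodMk measurable_snd ?_
  unfold lin; fun_prop

lemma measurableSet_densBounded (μ : Measure (ℝ × ℝ)) [SFinite μ] (e : ℝ) (M : ℝ≥0∞) :
    MeasurableSet (densBounded μ e M) := by
  unfold densBounded
  rw [ofPred_forall]
  refine MeasurableSet.iInter fun k => measurableSet_le ?_ measurable_const
  exact (measurable_dens_map_lin μ e k).comp measurable_swap_lin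

/-- Pairs of a point and a slope for which the projected density varies at one of the `q`
generations following `k`. -/
def nonUniform (μ : Measure (ℝ × ℝ)) (e : ℝ) (q : ℕ) (ε : ℝ) (k : ℕ) : Set ((ℝ × ℝ) × ℝ) :=
  {p | volume (cell e k (lin p.2 p.1) ∩ varies (μ.map (lin p.2)) e q ε k) ≠ 0}

lemma measurableSet_nonUniform (μ : Measure (ℝ × ℝ)) [SFinite μ] (e : ℝ) (q : ℕ) (ε : ℝ) (k : ℕ) :
    MeasurableSet (nonUniform μ e q ε k) := by
  have hV : MeasurableSet {p : ℝ × ℝ | p.2 ∈ varies (μ.map (lin p.1)) e q ε k} := by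
    have : {p : ℝ × ℝ | p.2 ∈ varies (μ.map (lin p.1)) e q ε k} =
        ⋃ d, ⋃ (_ : d < q), {p : ℝ × ℝ | ε < |jump (μ.map (lin p.1)) e (k + d) p.2|} := by
      ext p; simp [varies]
    rw [this]
    refine MeasurableSet.iUnion fun d => MeasurableSet.iUnion fun _ => ?_
    refine measurableSet_lt measurable_const (Measurable.abs ?_)
    unfold jump
    exact (measurable_dens_map_lin μ e _).ennreal_toReal.sub
      (measurable_dens_map_lin μ e _).ennreal_toReal
  have hW : MeasurableSet {w : (ℝ × ℝ) × ℝ | idx e k w.2 = idx e k w.1.2 ∧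
      (w.1.1, w.2) ∈ {p : ℝ × ℝ | p.2 ∈ varies (μ.map (lin p.1)) e q ε k}} := by
    refine MeasurableSet.inter (measurableSet_eq_fun ?_ ?_) ?_
    · exact (measurable_idx e k).comp measurable_snd
    · exact (measurable_idx e k).comp (by fun_prop)
    · exact hV.preimage (by fun_prop)
  have h1 : Measurable fun p : (ℝ × ℝ) × ℝ =>
      volume (cell e k (lin p.2 p.1) ∩ varies (μ.map (lin p.2)) e q ε k) :=
    (measurable_measure_prodMk_left (ν := volume) hW).comp measurable_swap_lin
  exact h1 (measurableSet_singleton 0).compl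

/-- The points of `A` around which the slope sections of `A` have density at least `c` at all
scales. -/
def thickPart (c : ℝ≥0∞) (A : Set ((ℝ × ℝ) × ℝ)) : Set ((ℝ × ℝ) × ℝ) :=
  {p ∈ A | ∀ k, c * (3 ^ k)⁻¹ ≤ volume (Prod.mk p.1 ⁻¹' A ∩ cell 0 k p.2)}

/-- The pairs which belong to `A`, or around which a slope section of `A` has density larger than
`c` at some scale. -/
def spread (c : ℝ≥0∞) (A : Set ((ℝ × ℝ) × ℝ)) : Set ((ℝ × ℝ) × ℝ) :=
  A ∪ {p | p.2 ∈ Ico 0 1 ∧ ∃ k, c * (3 ^ k)⁻¹ < volume (Prod.mk p.1 ⁻¹' A ∩ cell 0 k p.2)}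

lemma measurable_volume_section {A : Set ((ℝ × ℝ) × ℝ)} (hA : MeasurableSet A) (k : ℕ) :
    Measurable fun p : (ℝ × ℝ) × ℝ => volume (Prod.mk p.1 ⁻¹' A ∩ cell 0 k p.2) := by
  have hW : MeasurableSet {w : ((ℝ × ℝ) × ℝ) × ℝ | (w.1.1, w.2) ∈ A ∧
      idx 0 k w.2 = idx 0 k w.1.2} := by
    refine MeasurableSet.inter (hA.preimage (by fun_prop)) (measurableSet_eq_fun ?_ ?_)
    · exact (measurable_idx 0 k).comp measurable_snd
    · exact (measurable_idx 0 k).comp (by fun_prop)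
  exact measurable_measure_prodMk_left (ν := volume) hW

lemma measurableSet_thickPart {c : ℝ≥0∞} {A : Set ((ℝ × ℝ) × ℝ)} (hA : MeasurableSet A) :
    MeasurableSet (thickPart c A) := by
  have h : MeasurableSet {p : (ℝ × ℝ) × ℝ |
      ∀ k, c * (3 ^ k)⁻¹ ≤ volume (Prod.mk p.1 ⁻¹' A ∩ cell 0 k p.2)} := by
    rw [ofPred_forall]
    exact MeasurableSet.iInter fun k =>
      measurableSet_le measurable_const (measurable_volume_section hA k)
  exact hA.inter h

lemma measurableSet_spread {c : ℝ≥0∞} {A : Set ((ℝ × ℝ) × ℝ)} (hA : MeasurableSet A) :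
    MeasurableSet (spread c A) := by
  have h : MeasurableSet {p : (ℝ × ℝ) × ℝ |
      ∃ k, c * (3 ^ k)⁻¹ < volume (Prod.mk p.1 ⁻¹' A ∩ cell 0 k p.2)} := by
    rw [ofPred_exists]
    exact MeasurableSet.iUnion fun k =>
      measurableSet_lt measurable_const (measurable_volume_section hA k)
  have h' : MeasurableSet {p : (ℝ × ℝ) × ℝ | p.2 ∈ Ico (0 : ℝ) 1} :=
    measurableSet_Ico.preimage measurable_snd
  exact hA.union (h'.inter h)

lemma cell_subset_Ico {k : ℕ} {s : ℝ} (hs : s ∈ Ico (0 : ℝ) 1) : cell 0 k s ⊆ Ico 0 1 := by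
  intro s' hs'
  have h : idx 0 0 s' = idx 0 0 s := idx_eq_of_le (Nat.zero_le k) hs'
  have h0 : idx 0 0 s = 0 := by
    rw [idx_eq_iff]; simpa using hs
  have := idx_eq_iff.1 (h.trans h0)
  simpa using this

/-- The uniform measure on the slopes. -/
def slopeMeasure : Measure ℝ := volume.restrict (Ico 0 1)

instance : IsProbabilityMeasure slopeMeasure := ⟨by simp [slopeMeasure]⟩

lemma slopeMeasure_le_volume : slopeMeasure ≤ volume := Measure.restrict_le_self

lemma slopeMeasure_cell {k : ℕ} {s : ℝ} (hs : s ∈ Ico (0 : ℝ) 1) :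
    slopeMeasure (cell 0 k s) = (3 ^ k)⁻¹ := by
  unfold slopeMeasure
  rw [Measure.restrict_apply (measurableSet_cell 0 k s),
    inter_eq_self_of_subset_left (cell_subset_Ico hs), volume_cell]

lemma measure_sdiff_thickPart_le (μ : Measure (ℝ × ℝ)) [IsFiniteMeasure μ] (c : ℝ≥0∞)
    {A : Set ((ℝ × ℝ) × ℝ)} (hA : MeasurableSet A) (hA1 : ∀ p ∈ A, p.2 ∈ Ico (0 : ℝ) 1) :
    μ.prod slopeMeasure (A \ thickPart c A) ≤ c * μ univ := by
  rw [Measure.prod_apply (hA.diff (measurableSet_thickPart hA)), ← lintegral_const]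
  refine lintegral_mono fun x => ?_
  set B := Prod.mk x ⁻¹' (A \ thickPart c A) with hB
  have h1 : B ⊆ {s | ∃ k, volume.restrict (Prod.mk x ⁻¹' A) (cell 0 k s) <
      (c • slopeMeasure) (cell 0 k s)} := by
    rintro s ⟨hs, hs'⟩
    have hs1 := hA1 _ hs
    have : ¬ ∀ k, c * (3 ^ k)⁻¹ ≤ volume (Prod.mk x ⁻¹' A ∩ cell 0 k s) := fun h => hs' ⟨hs, h⟩
    push Not at this
    obtain ⟨k, hk⟩ := this
    refine ⟨k, ?_⟩
    rw [Measure.restrict_apply (measurableSet_cell 0 k s), Measure.smul_apply, smul_eq_mul,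
      slopeMeasure_cell hs1, inter_comm]
    exact hk
  have hBm : MeasurableSet B :=
    (hA.diff (measurableSet_thickPart hA)).preimage measurable_prodMk_left
  calc slopeMeasure B ≤ volume B := slopeMeasure_le_volume B
    _ = volume.restrict (Prod.mk x ⁻¹' A) B := by
        rw [Measure.restrict_apply hBm, inter_eq_self_of_subset_left fun s hs => hs.1]
    _ ≤ _ := measure_mono h1
    _ ≤ (c • slopeMeasure) univ := measure_exists_cell_lt_le _ _ 0
    _ = c := by simp

lemma measure_spread_le (μ : Measure (ℝ × ℝ)) [IsFiniteMeasure μ] {c : ℝ≥0∞} (hc : c ≠ 0)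
    (hc' : c ≠ ⊤) {A : Set ((ℝ × ℝ) × ℝ)} (hA : MeasurableSet A)
    (hA1 : ∀ p ∈ A, p.2 ∈ Ico (0 : ℝ) 1) :
    μ.prod slopeMeasure (spread c A) ≤ (1 + c⁻¹) * μ.prod slopeMeasure A := by
  rw [Measure.prod_apply (measurableSet_spread hA), Measure.prod_apply hA,
    ← lintegral_const_mul' _ _ (by finiteness)]
  refine lintegral_mono fun x => ?_
  set B := Prod.mk x ⁻¹' A with hB
  have hBm : MeasurableSet B := hA.preimage measurable_prodMk_left
  have hBI : B ⊆ Ico 0 1 := fun s hs => hA1 _ hs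
  set T := {s | s ∈ Ico (0 : ℝ) 1 ∧ ∃ k, c * (3 ^ k)⁻¹ < volume (B ∩ cell 0 k s)} with hT
  have e : Prod.mk x ⁻¹' spread c A = B ∪ T := rfl
  have h1 : c * slopeMeasure T ≤ slopeMeasure B := by
    have h2 : T ⊆ {s | ∃ k, (c • slopeMeasure) (cell 0 k s) < volume.restrict B (cell 0 k s)} := by
      rintro s ⟨hs, k, hk⟩
      refine ⟨k, ?_⟩
      rw [Measure.restrict_apply (measurableSet_cell 0 k s), Measure.smul_apply, smul_eq_mul,
        slopeMeasure_cell hs, inter_comm]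
      exact hk
    calc c * slopeMeasure T = (c • slopeMeasure) T := rfl
      _ ≤ _ := measure_mono h2
      _ ≤ volume.restrict B univ := measure_exists_cell_lt_le _ _ 0
      _ = slopeMeasure B := by
          rw [Measure.restrict_apply_univ, slopeMeasure, Measure.restrict_apply hBm,
            inter_eq_self_of_subset_left hBI]
  rw [e, add_mul, one_mul]
  refine (measure_union_le _ _).trans ?_
  gcongr
  rwa [← ENNReal.mul_le_iff_le_inv hc hc']

/-- The pairs of a point of `K` and a slope for which the projections of `μ` have bounded
density around the projected point, in both grids. -/
def goodPairs (μ : Measure (ℝ × ℝ)) (K : Set (ℝ × ℝ)) (M : ℝ≥0∞) : Set ((ℝ × ℝ) × ℝ) :=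
  (K ×ˢ Ico 0 1) ∩ (densBounded μ 0 M ∩ densBounded μ (1 / 2) M)

/-- The pairs in `A` at which the projection of `μ` is not uniform at generation `k` in one of
the two grids. -/
def dropPairs (μ : Measure (ℝ × ℝ)) (A : Set ((ℝ × ℝ) × ℝ)) (q : ℕ) (ε : ℝ) (k : ℕ) :
    Set ((ℝ × ℝ) × ℝ) :=
  A ∩ (nonUniform μ 0 q ε k ∪ nonUniform μ (1 / 2) q ε k)

lemma measurableSet_goodPairs (μ : Measure (ℝ × ℝ)) [SFinite μ] {K : Set (ℝ × ℝ)}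
    (hK : MeasurableSet K) (M : ℝ≥0∞) : MeasurableSet (goodPairs μ K M) :=
  (hK.prod measurableSet_Ico).inter
    ((measurableSet_densBounded μ 0 M).inter (measurableSet_densBounded μ (1 / 2) M))

lemma measurableSet_dropPairs (μ : Measure (ℝ × ℝ)) [SFinite μ] {A : Set ((ℝ × ℝ) × ℝ)}
    (hA : MeasurableSet A) (q : ℕ) (ε : ℝ) (k : ℕ) : MeasurableSet (dropPairs μ A q ε k) :=
  hA.inter ((measurableSet_nonUniform μ 0 q ε k).union (measurableSet_nonUniform μ (1 / 2) q ε k))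

lemma volume_exists_dens_gt_le (ν : Measure ℝ) [IsFiniteMeasure ν] (e : ℝ) {M : ℝ≥0∞}
    (hM : M ≠ 0) (hM' : M ≠ ⊤) : volume {t | ∃ k, M < dens ν e k t} ≤ ν univ / M := by
  have h := measure_exists_cell_lt_le (M • volume) ν e
  have e1 : {t | ∃ k, M < dens ν e k t} =
      {t | ∃ k, (M • volume) (cell e k t) < ν (cell e k t)} := by
    ext t
    refine exists_congr fun k => ?_
    rw [Measure.smul_apply, smul_eq_mul, volume_cell, dens, ← div_eq_mul_inv,
      ENNReal.div_lt_iff (Or.inl (by positivity)) (Or.inl (by finiteness)), mul_comm]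
  rw [e1, ENNReal.le_div_iff_mul_le (Or.inl hM) (Or.inl hM'), mul_comm]
  exact h

lemma measure_goodPairs_ge {κ A₀ M : ℝ≥0∞} (hM : M ≠ 0) (hM' : M ≠ ⊤) (hκ : κ ≠ ⊤)
    (hA : 4 * A₀ ≤ M * κ) {μ μ₂ : Measure (ℝ × ℝ)} [IsFiniteMeasure μ] [IsFiniteMeasure μ₂]
    (hμ₂ : μ₂ univ ≤ A₀) {K : Set (ℝ × ℝ)} (hK : MeasurableSet K)
    (hlip : ∀ s ∈ Ico (0 : ℝ) 1, ∀ S ⊆ K, MeasurableSet S → volume (lin s '' S) ≤ 2 * μ S)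
    (hfav : κ ≤ ∫⁻ s in Ico 0 1, volume (lin s '' K)) :
    κ / 4 ≤ μ.prod slopeMeasure (goodPairs μ₂ K M) := by
  set G := goodPairs μ₂ K M with hG
  have hGm : MeasurableSet G := measurableSet_goodPairs μ₂ hK M
  have hAM : A₀ / M ≤ κ / 4 := by
    rw [ENNReal.div_le_iff hM hM', ENNReal.div_eq_inv_mul, mul_assoc, mul_comm κ,
      ← ENNReal.div_eq_inv_mul, ENNReal.le_div_iff_mul_le (by simp) (by simp), mul_comm]
    exact hA
  have h1 : ∀ s ∈ Ico (0 : ℝ) 1,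
      volume (lin s '' K) ≤ 2 * μ ((fun x => (x, s)) ⁻¹' G) + κ / 2 := by
    intro s hs
    set Gs := (fun x : ℝ × ℝ => (x, s)) ⁻¹' G with hGs
    have hsub : lin s '' K ⊆ lin s '' Gs ∪ ({t | ∃ k, M < dens (μ₂.map (lin s)) 0 k t} ∪
        {t | ∃ k, M < dens (μ₂.map (lin s)) (1 / 2) k t}) := by
      rintro _ ⟨x, hx, rfl⟩
      by_cases h0 : ∃ k, M < dens (μ₂.map (lin s)) 0 k (lin s x)
      · exact Or.inr (Or.inl h0)
      by_cases h0' : ∃ k, M < dens (μ₂.map (lin s)) (1 / 2) k (lin s x)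
      · exact Or.inr (Or.inr h0')
      push Not at h0 h0'
      exact Or.inl ⟨x, ⟨⟨hx, hs⟩, h0, h0'⟩, rfl⟩
    have hb : ∀ e : ℝ, volume {t | ∃ k, M < dens (μ₂.map (lin s)) e k t} ≤ κ / 4 := by
      intro e
      have hu : (μ₂.map (lin s)) univ = μ₂ univ := by
        rw [Measure.map_apply (measurable_lin s) MeasurableSet.univ, preimage_univ]
      have : IsFiniteMeasure (μ₂.map (lin s)) := ⟨by rw [hu]; exact measure_lt_top _ _⟩
      refine (volume_exists_dens_gt_le _ e hM hM').trans (le_trans ?_ hAM)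
      rw [hu]; gcongr
    have hGK : Gs ⊆ K := fun x hx => hx.1.1
    calc volume (lin s '' K) ≤ volume (lin s '' Gs) + (κ / 4 + κ / 4) := by
          refine (measure_mono hsub).trans ((measure_union_le _ _).trans ?_)
          gcongr
          exact (measure_union_le _ _).trans (add_le_add (hb _) (hb _))
      _ ≤ 2 * μ Gs + κ / 2 := by
          refine add_le_add (hlip s hs Gs hGK (hGm.preimage measurable_prodMk_right)) (le_of_eq ?_)
          rw [← ENNReal.add_div, ← two_mul,
            show (4 : ℝ≥0∞) = 2 * 2 by norm_num, ENNReal.mul_div_mul_left _ _ (by simp) (by simp)]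
  have h2 : κ ≤ 2 * μ.prod slopeMeasure G + κ / 2 := by
    rw [Measure.prod_apply_symm hGm]
    calc κ ≤ ∫⁻ s in Ico 0 1, volume (lin s '' K) := hfav
      _ ≤ ∫⁻ s in Ico 0 1, (2 * μ ((fun x => (x, s)) ⁻¹' G) + κ / 2) :=
          setLIntegral_mono' measurableSet_Ico h1
      _ = _ := by
          rw [lintegral_add_right _ measurable_const, lintegral_const_mul' _ _ (by simp)]
          simp [slopeMeasure]
  have h3 : κ / 2 ≤ 2 * μ.prod slopeMeasure G := by
    have : κ / 2 + κ / 2 ≤ 2 * μ.prod slopeMeasure G + κ / 2 := by rwa [ENNReal.add_halves]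
    exact (ENNReal.add_le_add_iff_right (by finiteness)).1 this
  rw [show (4 : ℝ≥0∞) = 2 * 2 by norm_num, ENNReal.div_eq_inv_mul, ENNReal.mul_inv (by simp)
    (by simp), mul_assoc, ← ENNReal.div_eq_inv_mul, ← ENNReal.div_eq_inv_mul]
  rw [ENNReal.div_le_iff_le_mul (by simp) (by simp), mul_comm]
  exact h3

lemma iterate_thickPart_subset (c : ℝ≥0∞) (A : Set ((ℝ × ℝ) × ℝ)) (i : ℕ) :
    (thickPart c)^[i + 1] A ⊆ (thickPart c)^[i] A := by
  rw [Function.iterate_succ_apply']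
  exact fun p hp => hp.1

lemma iterate_thickPart_subset_self (c : ℝ≥0∞) (A : Set ((ℝ × ℝ) × ℝ)) (i : ℕ) :
    (thickPart c)^[i] A ⊆ A := by
  induction i with
  | zero => exact subset_rfl
  | succ i ih => exact (iterate_thickPart_subset c A i).trans ih

lemma measurableSet_iterate_thickPart {c : ℝ≥0∞} {A : Set ((ℝ × ℝ) × ℝ)} (hA : MeasurableSet A)
    (i : ℕ) : MeasurableSet ((thickPart c)^[i] A) := by
  induction i with
  | zero => exact hA
  | succ i ih =>
    rw [Function.iterate_succ_apply']
    exact measurableSet_thickPart ih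

lemma iterate_subset_spread (c : ℝ≥0∞) (A : Set ((ℝ × ℝ) × ℝ)) (i : ℕ) :
    (spread c)^[i] A ⊆ (spread c)^[i + 1] A := by
  rw [Function.iterate_succ_apply']
  exact fun p hp => Or.inl hp

lemma measurableSet_iterate_spread {c : ℝ≥0∞} {A : Set ((ℝ × ℝ) × ℝ)} (hA : MeasurableSet A)
    (i : ℕ) : MeasurableSet ((spread c)^[i] A) := by
  induction i with
  | zero => exact hA
  | succ i ih =>
    rw [Function.iterate_succ_apply']
    exact measurableSet_spread ih

lemma iterate_spread_slope {c : ℝ≥0∞} {A : Set ((ℝ × ℝ) × ℝ)}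
    (hA1 : ∀ p ∈ A, p.2 ∈ Ico (0 : ℝ) 1) (i : ℕ) : ∀ p ∈ (spread c)^[i] A, p.2 ∈ Ico (0 : ℝ) 1 := by
  induction i with
  | zero => exact hA1
  | succ i ih =>
    rw [Function.iterate_succ_apply']
    rintro p (hp | hp)
    · exact ih p hp
    · exact hp.1

lemma measure_le_iterate_thickPart_add (μ : Measure (ℝ × ℝ)) [IsFiniteMeasure μ] (c : ℝ≥0∞)
    {A : Set ((ℝ × ℝ) × ℝ)} (hA : MeasurableSet A) (hA1 : ∀ p ∈ A, p.2 ∈ Ico (0 : ℝ) 1) (i : ℕ) :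
    μ.prod slopeMeasure A ≤ μ.prod slopeMeasure ((thickPart c)^[i] A) + i * (c * μ univ) := by
  induction i with
  | zero => simp
  | succ i ih =>
    refine ih.trans ?_
    set B := (thickPart c)^[i] A with hB
    have hB1 : ∀ p ∈ B, p.2 ∈ Ico (0 : ℝ) 1 :=
      fun p hp => hA1 p (iterate_thickPart_subset_self c A i hp)
    have h := measure_sdiff_thickPart_le μ c (measurableSet_iterate_thickPart hA i) hB1
    rw [Function.iterate_succ_apply']
    have h2 : μ.prod slopeMeasure B ≤ μ.prod slopeMeasure (thickPart c B) + c * μ univ := by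
      refine le_trans (measure_mono ?_) ((measure_union_le _ _).trans (add_le_add le_rfl h))
      intro p hp
      by_cases hp' : p ∈ thickPart c B
      · exact Or.inl hp'
      · exact Or.inr ⟨hp, hp'⟩
    calc _ ≤ (μ.prod slopeMeasure (thickPart c B) + c * μ univ) + i * (c * μ univ) := by gcongr
      _ = _ := by push_cast; ring

lemma measure_iterate_spread_le (μ : Measure (ℝ × ℝ)) [IsFiniteMeasure μ] {c : ℝ≥0∞} (hc : c ≠ 0)
    (hc' : c ≠ ⊤) {A : Set ((ℝ × ℝ) × ℝ)} (hA : MeasurableSet A)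
    (hA1 : ∀ p ∈ A, p.2 ∈ Ico (0 : ℝ) 1) (i : ℕ) :
    μ.prod slopeMeasure ((spread c)^[i] A) ≤ (1 + c⁻¹) ^ i * μ.prod slopeMeasure A := by
  induction i with
  | zero => simp
  | succ i ih =>
    rw [Function.iterate_succ_apply', pow_succ']
    refine (measure_spread_le μ hc hc' (measurableSet_iterate_spread hA i)
      (iterate_spread_slope hA1 i)).trans ?_
    rw [mul_assoc]
    gcongr

/-- The bound on the total measure of the pairs at which projections are not uniform. -/
def dropBound (M A₀ : ℝ≥0∞) (q : ℕ) (ε : ℝ) : ℝ≥0∞ :=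
  M * 3 ^ q * (q * ((ENNReal.ofReal (ε ^ 2))⁻¹ * (4 * (3 ^ q * M) * A₀)))

lemma dropBound_ne_top {M A₀ : ℝ≥0∞} (hM : M ≠ ⊤) (hA₀ : A₀ ≠ ⊤) (q : ℕ) {ε : ℝ} (hε : 0 < ε) :
    dropBound M A₀ q ε ≠ ⊤ := by
  unfold dropBound
  have : (ENNReal.ofReal (ε ^ 2)) ≠ 0 := by simp only [ne_eq, ENNReal.ofReal_eq_zero, not_le]; positivity
  have := ENNReal.inv_ne_top.2 this
  finiteness

lemma tsum_measure_dropPairs_le {M A₀ : ℝ≥0∞} (hM : M ≠ ⊤) (q : ℕ) {ε : ℝ} (hε : 0 < ε)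
    {μ μ₂ : Measure (ℝ × ℝ)} [IsFiniteMeasure μ] [IsFiniteMeasure μ₂] (hle : μ ≤ μ₂)
    (hμ₂ : μ₂ univ ≤ A₀) {K : Set (ℝ × ℝ)} (hK : MeasurableSet K) :
    ∑' k, μ.prod slopeMeasure (dropPairs μ (goodPairs μ₂ K M) q ε k) ≤
      2 * dropBound M A₀ q ε := by
  have hD := fun k => measurableSet_dropPairs μ (measurableSet_goodPairs μ₂ hK M) q ε k
  simp_rw [fun k => Measure.prod_apply_symm (μ := μ) (ν := slopeMeasure) (hD k)]
  rw [← lintegral_tsum fun k => (measurable_measure_prodMk_right (hD k)).aemeasurable]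
  have hone : 2 * dropBound M A₀ q ε = ∫⁻ _, 2 * dropBound M A₀ q ε ∂slopeMeasure := by simp
  rw [hone]
  refine lintegral_mono fun s => ?_
  set ν := μ.map (lin s) with hν
  have hu : ν univ = μ univ := by
    rw [hν, Measure.map_apply (measurable_lin s) MeasurableSet.univ, preimage_univ]
  have : IsFiniteMeasure ν := ⟨by rw [hu]; exact measure_lt_top _ _⟩
  have hb : ∀ e : ℝ, ∑' k, ν {t | t ∈ lowDens ν e M k ∧ volume (cell e k t ∩ varies ν e q ε k) ≠ 0}
      ≤ dropBound M A₀ q ε := by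
    intro e
    refine (tsum_measure_varies_le ν e hM q hε).trans ?_
    unfold dropBound
    have : ν univ ≤ A₀ := by rw [hu]; exact (hle univ).trans hμ₂
    gcongr
  have hd : ∀ (e : ℝ) k t, dens ν e k t ≤ dens (μ₂.map (lin s)) e k t := by
    intro e k t
    rw [hν, dens_map_lin, dens_map_lin]
    gcongr
  calc ∑' k, μ ((fun x => (x, s)) ⁻¹' dropPairs μ (goodPairs μ₂ K M) q ε k)
      ≤ ∑' k, (ν {t | t ∈ lowDens ν 0 M k ∧ volume (cell 0 k t ∩ varies ν 0 q ε k) ≠ 0} +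
          ν {t | t ∈ lowDens ν (1 / 2) M k ∧
            volume (cell (1 / 2) k t ∩ varies ν (1 / 2) q ε k) ≠ 0}) := by
        refine ENNReal.tsum_le_tsum fun k => ?_
        refine le_trans (measure_mono ?_) ((measure_union_le _ _).trans (add_le_add
          (Measure.le_map_apply (measurable_lin s).aemeasurable _)
          (Measure.le_map_apply (measurable_lin s).aemeasurable _)))
        rintro x ⟨⟨-, hx0, hx1⟩, hx | hx⟩
        · exact Or.inl ⟨fun i _ => (hd _ _ _).trans (hx0 i), hx⟩
        · exact Or.inr ⟨fun i _ => (hd _ _ _).trans (hx1 i), hx⟩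
    _ ≤ 2 * dropBound M A₀ q ε := by
        rw [ENNReal.tsum_add, two_mul]
        exact add_le_add (hb _) (hb _)

lemma exists_level_le {h : ℝ} (hh : 0 < h) (h1 : h ≤ 1) :
    ∃ k : ℕ, ((3 : ℝ) ^ k)⁻¹ ≤ h ∧ h ≤ 3 * ((3 : ℝ) ^ k)⁻¹ := by
  obtain ⟨k, hk⟩ := exists_nat_pow_near (x := h⁻¹) (y := 3) (by rwa [one_le_inv₀ hh]) (by norm_num)
  refine ⟨k + 1, ?_, ?_⟩
  · exact (inv_le_comm₀ hh (by positivity)).1 hk.2.le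
  · rw [pow_succ, mul_inv]
    have := (le_inv_comm₀ hh (by positivity)).2 hk.1
    linarith

lemma exists_mem_far {A D : Set ℝ} {c s h : ℝ} (hc : 0 < c)
    (hA : ∀ k, ENNReal.ofReal c * (3 ^ k)⁻¹ ≤ volume (A ∩ cell 0 k s))
    (hD : ∀ k, volume (D ∩ cell 0 k s) ≤ ENNReal.ofReal (c / 2) * (3 ^ k)⁻¹)
    (hh : 0 < h) (h1 : h ≤ 1) : ∃ s' ∈ A \ D, c / 24 * h ≤ |s' - s| ∧ |s' - s| ≤ h := by
  obtain ⟨k, hk1, hk2⟩ := exists_level_le hh h1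
  set ρ : ℝ := ((3 : ℝ) ^ k)⁻¹ with hρ
  have hρ0 : 0 < ρ := by positivity
  have eρ : (3 ^ k : ℝ≥0∞)⁻¹ = ENNReal.ofReal ρ := by
    rw [hρ, ENNReal.ofReal_inv_of_pos (by positivity), ENNReal.ofReal_pow (by norm_num)]
    simp
  by_contra hcon
  push Not at hcon
  have hsub : A ∩ cell 0 k s ⊆ (D ∩ cell 0 k s) ∪ Ioo (s - c / 8 * ρ) (s + c / 8 * ρ) := by
    rintro t ⟨ht, htc⟩
    by_cases htD : t ∈ D
    · exact Or.inl ⟨htD, htc⟩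
    right
    have ht1 : |t - s| < ρ := abs_sub_lt_of_mem_cell htc
    by_contra htn
    have h2 : c / 8 * ρ ≤ |t - s| := by
      by_contra h3
      push Not at h3
      rw [abs_lt] at h3
      exact htn ⟨by linarith, by linarith⟩
    have h4 : c / 24 * h ≤ |t - s| := by nlinarith
    have := hcon t ⟨ht, htD⟩ h4
    linarith
  have h5 : ENNReal.ofReal (c * ρ) ≤ ENNReal.ofReal (c / 2 * ρ + c / 4 * ρ) := by
    rw [ENNReal.ofReal_mul hc.le, ENNReal.ofReal_add (by positivity) (by positivity),
      ENNReal.ofReal_mul (by positivity), ← eρ]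
    refine (hA k).trans ((measure_mono hsub).trans ((measure_union_le _ _).trans
      (add_le_add (hD k) ?_)))
    rw [Real.volume_Ioo]
    exact ENNReal.ofReal_le_ofReal (by linarith)
  rw [ENNReal.ofReal_le_ofReal_iff (by positivity)] at h5
  nlinarith [mul_pos hc hρ0]

/-- The nested sets of slopes attached to a point `x` and a generation `k`. -/
def slopes (c : ℝ) (A D : Set ((ℝ × ℝ) × ℝ)) (x : ℝ × ℝ) (i : ℕ) : Set ℝ :=
  {s | (x, s) ∈ (thickPart (ENNReal.ofReal c))^[i] A ∧
    (x, s) ∉ (spread (ENNReal.ofReal (c / 2)))^[i] D}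

lemma antitone_slopes (c : ℝ) (A D : Set ((ℝ × ℝ) × ℝ)) (x : ℝ × ℝ) : Antitone (slopes c A D x) :=
  antitone_nat_of_succ_le fun i _ hs =>
    ⟨iterate_thickPart_subset _ A i hs.1, fun h => hs.2 (iterate_subset_spread _ D i h)⟩

lemma slopes_thick {c : ℝ} (hc : 0 < c) {A D : Set ((ℝ × ℝ) × ℝ)}
    (hA1 : ∀ p ∈ A, p.2 ∈ Ico (0 : ℝ) 1) (x : ℝ × ℝ) (i : ℕ) :
    ∀ s ∈ slopes c A D x (i + 1), ∀ h : ℝ, 0 < h → h ≤ 1 →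
      ∃ s' ∈ slopes c A D x i, c / 24 * h ≤ |s' - s| ∧ |s' - s| ≤ h := by
  rintro s ⟨hs1, hs2⟩ h hh h1
  have hs : s ∈ Ico (0 : ℝ) 1 := hA1 _ (iterate_thickPart_subset_self _ A _ hs1)
  rw [Function.iterate_succ_apply'] at hs1 hs2
  refine exists_mem_far hc (A := Prod.mk x ⁻¹' (thickPart (ENNReal.ofReal c))^[i] A)
    (D := Prod.mk x ⁻¹' (spread (ENNReal.ofReal (c / 2)))^[i] D) hs1.2 ?_ hh h1
  intro k
  by_contra hk
  push Not at hk
  exact hs2 (Or.inr ⟨hs, k, hk⟩)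

lemma goodPairs_slope {μ : Measure (ℝ × ℝ)} {K : Set (ℝ × ℝ)} {M : ℝ≥0∞} :
    ∀ p ∈ goodPairs μ K M, p.2 ∈ Ico (0 : ℝ) 1 := fun _ hp => hp.1.2

/-- Selection of a slope for which the thick good pairs carry a large part of the measure and
drop out at a bounded number of generations only. -/
theorem exists_good_slope {κ A₀ M : ℝ} (hκ : 0 < κ) (hA₀ : 0 < A₀) (hM : 0 < M)
    (hA : 4 * A₀ ≤ M * κ) (J : ℕ) : ∃ c : ℝ, 0 < c ∧ c ≤ 1 ∧ ∀ (q : ℕ) (ε : ℝ), 0 < ε →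
    ∃ Nd : ℕ, ∀ (μ μ₂ : Measure (ℝ × ℝ)) [IsFiniteMeasure μ] [IsFiniteMeasure μ₂]
      (K : Set (ℝ × ℝ)), μ ≤ μ₂ → μ₂ univ ≤ ENNReal.ofReal A₀ → MeasurableSet K →
      (∀ s ∈ Ico (0 : ℝ) 1, ∀ S ⊆ K, MeasurableSet S → volume (lin s '' S) ≤ 2 * μ S) →
      ENNReal.ofReal κ ≤ ∫⁻ s in Ico 0 1, volume (lin s '' K) →
      ∃ s ∈ Ico (0 : ℝ) 1, ∃ F ⊆ K, MeasurableSet F ∧ ENNReal.ofReal (κ / 16) ≤ μ F ∧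
        ∀ x ∈ F, ∃ X : Finset ℕ, X.card ≤ Nd ∧ ∀ k ∉ X,
          s ∈ slopes c (goodPairs μ₂ K (ENNReal.ofReal M))
            (dropPairs μ (goodPairs μ₂ K (ENNReal.ofReal M)) q ε k) x J := by
  set c : ℝ := min 1 (κ / (8 * A₀ * (J + 1))) with hc
  have hc0 : 0 < c := lt_min one_pos (by positivity)
  have hcJ : J * (c * A₀) ≤ κ / 8 := by
    have h1 : c ≤ κ / (8 * A₀ * (J + 1)) := min_le_right _ _
    rw [le_div_iff₀ (by positivity)] at h1
    have : 0 ≤ c * A₀ := by positivity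
    nlinarith
  refine ⟨c, hc0, min_le_left _ _, fun q ε hε => ?_⟩
  set M' := ENNReal.ofReal M with hM'
  set A' := ENNReal.ofReal A₀ with hA'
  set H : ℝ≥0∞ := (1 + (ENNReal.ofReal (c / 2))⁻¹) ^ J * (2 * dropBound M' A' q ε) with hH
  have hc2 : ENNReal.ofReal (c / 2) ≠ 0 := by
    simp only [ne_eq, ENNReal.ofReal_eq_zero, not_le]; positivity
  have hHtop : H ≠ ⊤ := by
    have h1 := dropBound_ne_top (M := M') (A₀ := A') (by finiteness) (by finiteness) q hε
    have h2 := ENNReal.inv_ne_top.2 hc2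
    finiteness
  obtain ⟨Nd, hNd⟩ := exists_nat_gt (H.toReal / (κ / 16))
  have hNd' : H ≤ Nd * ENNReal.ofReal (κ / 16) := by
    rw [div_lt_iff₀ (by positivity)] at hNd
    rw [← ENNReal.ofReal_toReal hHtop, ← ENNReal.ofReal_natCast,
      ← ENNReal.ofReal_mul (by positivity)]
    exact ENNReal.ofReal_le_ofReal hNd.le
  refine ⟨Nd, fun μ μ₂ _ _ K hle hμ₂ hK hlip hfav => ?_⟩
  set A := goodPairs μ₂ K M' with hAdef
  have hAm : MeasurableSet A := measurableSet_goodPairs μ₂ hK M'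
  set P := μ.prod slopeMeasure with hP
  set GJ := (thickPart (ENNReal.ofReal c))^[J] A with hGJ
  set DJ := fun k => (spread (ENNReal.ofReal (c / 2)))^[J] (dropPairs μ A q ε k) with hDJ
  have hGJm : MeasurableSet GJ := measurableSet_iterate_thickPart hAm J
  have hDm : ∀ k, MeasurableSet (dropPairs μ A q ε k) :=
    fun k => measurableSet_dropPairs μ hAm q ε k
  have hDJm : ∀ k, MeasurableSet (DJ k) := fun k => measurableSet_iterate_spread (hDm k) J
  have hPA : ENNReal.ofReal (κ / 4) ≤ P A := by
    have := measure_goodPairs_ge (κ := ENNReal.ofReal κ) (A₀ := A') (M := M')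
      (by simpa [hM'] using hM) (by finiteness) (by finiteness) (by
        rw [hA', hM', ← ENNReal.ofReal_mul hM.le,
          show (4 : ℝ≥0∞) = ENNReal.ofReal 4 by simp, ← ENNReal.ofReal_mul (by norm_num)]
        exact ENNReal.ofReal_le_ofReal hA) hμ₂ hK hlip hfav
    rwa [ENNReal.ofReal_div_of_pos (by norm_num), ENNReal.ofReal_ofNat]
  have hPG : ENNReal.ofReal (κ / 8) ≤ P GJ := by
    have h1 := measure_le_iterate_thickPart_add μ (ENNReal.ofReal c) hAm goodPairs_slope J
    have h2 : (J : ℝ≥0∞) * (ENNReal.ofReal c * μ univ) ≤ ENNReal.ofReal (κ / 8) := by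
      calc (J : ℝ≥0∞) * (ENNReal.ofReal c * μ univ)
          ≤ J * (ENNReal.ofReal c * ENNReal.ofReal A₀) := by
            gcongr; exact (hle univ).trans hμ₂
        _ = ENNReal.ofReal (J * (c * A₀)) := by
            rw [ENNReal.ofReal_mul (by positivity), ENNReal.ofReal_mul hc0.le,
              ENNReal.ofReal_natCast]
        _ ≤ _ := ENNReal.ofReal_le_ofReal hcJ
    have h3 : ENNReal.ofReal (κ / 8) + ENNReal.ofReal (κ / 8) ≤ P GJ + ENNReal.ofReal (κ / 8) := by
      rw [← ENNReal.ofReal_add (by positivity) (by positivity),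
        show κ / 8 + κ / 8 = κ / 4 by ring]
      exact hPA.trans (h1.trans (by gcongr))
    exact (ENNReal.add_le_add_iff_right (by finiteness)).1 h3
  set f : (ℝ × ℝ) × ℝ → ℝ≥0∞ := fun p => ∑' k, (DJ k).indicator 1 p with hf
  have hfm : Measurable f := by
    refine Measurable.tsum fun k => ?_
    exact measurable_one.indicator (hDJm k)
  have hfint : ∫⁻ p, f p ∂P ≤ H := by
    rw [hf, lintegral_tsum fun k => (measurable_one.indicator (hDJm k)).aemeasurable]
    simp_rw [lintegral_indicator_one (hDJm _)]
    calc ∑' k, P (DJ k) ≤ ∑' k, (1 + (ENNReal.ofReal (c / 2))⁻¹) ^ J * P (dropPairs μ A q ε k) :=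
          ENNReal.tsum_le_tsum fun k => measure_iterate_spread_le μ hc2 (by finiteness) (hDm k)
            (fun p hp => goodPairs_slope p hp.1) J
      _ ≤ H := by
          rw [ENNReal.tsum_mul_left, hH]
          gcongr
          exact tsum_measure_dropPairs_le (by finiteness) q hε hle hμ₂ hK
  set B := {p | (Nd + 1 : ℝ≥0∞) ≤ f p} with hB
  have hBm : MeasurableSet B := measurableSet_le measurable_const hfm
  have hPB : P B ≤ ENNReal.ofReal (κ / 16) := by
    have h1 : (Nd + 1 : ℝ≥0∞) * P B ≤ (Nd + 1 : ℝ≥0∞) * ENNReal.ofReal (κ / 16) :=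
      (mul_meas_ge_le_lintegral hfm _).trans (hfint.trans (hNd'.trans (by gcongr; simp)))
    exact (ENNReal.mul_le_mul_iff_right (by simp) (by finiteness)).1 h1
  have hPGB : ENNReal.ofReal (κ / 16) ≤ P (GJ \ B) := by
    have h1 : P GJ ≤ P (GJ \ B) + P B := by
      refine (measure_mono ?_).trans (measure_union_le _ _)
      intro p hp
      by_cases hpB : p ∈ B
      · exact Or.inr hpB
      · exact Or.inl ⟨hp, hpB⟩
    have h3 : ENNReal.ofReal (κ / 16) + ENNReal.ofReal (κ / 16) ≤
        P (GJ \ B) + ENNReal.ofReal (κ / 16) := by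
      rw [← ENNReal.ofReal_add (by positivity) (by positivity),
        show κ / 16 + κ / 16 = κ / 8 by ring]
      exact hPG.trans (h1.trans (by gcongr))
    exact (ENNReal.add_le_add_iff_right (by finiteness)).1 h3
  rw [hP, Measure.prod_apply_symm (hGJm.diff hBm)] at hPGB
  obtain ⟨s, hs⟩ := exists_lintegral_le (μ := slopeMeasure)
    (f := fun s => μ ((fun x => (x, s)) ⁻¹' (GJ \ B)))
    (ne_top_of_le_ne_top (b := μ univ) (by finiteness) (by
      calc _ ≤ ∫⁻ _, μ univ ∂slopeMeasure := lintegral_mono fun s => measure_mono (subset_univ _)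
        _ = μ univ := by simp))
  have hs' := hPGB.trans hs
  have hGA : GJ ⊆ A := iterate_thickPart_subset_self _ A J
  have hpos : μ ((fun x => (x, s)) ⁻¹' (GJ \ B)) ≠ 0 := by
    intro h0
    rw [h0] at hs'
    simp at hs'
    linarith
  obtain ⟨x₀, hx₀⟩ := nonempty_of_measure_ne_zero hpos
  refine ⟨s, goodPairs_slope _ (hGA hx₀.1), _, fun x hx => (hGA hx.1).1.1,
    (hGJm.diff hBm).preimage measurable_prodMk_right, hs', fun x hx => ?_⟩
  have hfx : f (x, s) < Nd + 1 := not_le.1 hx.2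
  have hcard : ∀ T : Finset ℕ, (∀ k ∈ T, (x, s) ∈ DJ k) → T.card ≤ Nd := by
    intro T hT
    have h1 : (T.card : ℝ≥0∞) ≤ f (x, s) := by
      calc (T.card : ℝ≥0∞) = ∑ k ∈ T, (DJ k).indicator 1 (x, s) := by
            rw [Finset.sum_congr rfl fun k hk => indicator_of_mem (hT k hk) _]
            simp
        _ ≤ f (x, s) := ENNReal.sum_le_tsum T
    have h2 := h1.trans_lt hfx
    have h3 : T.card < Nd + 1 := by exact_mod_cast h2
    omega
  have hfin : {k | (x, s) ∈ DJ k}.Finite := by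
    by_contra hinf
    obtain ⟨T, hT, hTc⟩ := Set.Infinite.exists_subset_card_eq hinf (Nd + 1)
    have := hcard T fun k hk => hT hk
    omega
  refine ⟨hfin.toFinset, hcard _ (by simp), fun k hk => ⟨hx.1, ?_⟩⟩
  simpa using hk

lemma idx_mono (e : ℝ) (k : ℕ) : Monotone (idx e k) := fun a b hab => by
  unfold idx; gcongr

lemma exists_grid (k : ℕ) (t₀ : ℝ) : ∃ e : ℝ, (e = 0 ∨ e = 1 / 2) ∧
    ∀ t, |t - t₀| ≤ ((3 : ℝ) ^ k)⁻¹ / 4 → t ∈ cell e k t₀ := by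
  have hk : (0 : ℝ) < 3 ^ k := by positivity
  have key : ∀ t, |t - t₀| ≤ ((3 : ℝ) ^ k)⁻¹ / 4 →
      3 ^ k * t ≤ 3 ^ k * t₀ + 1 / 4 ∧ 3 ^ k * t₀ - 1 / 4 ≤ 3 ^ k * t := by
    intro t ht
    have h1 : 3 ^ k * |t - t₀| ≤ 1 / 4 := by
      calc 3 ^ k * |t - t₀| ≤ 3 ^ k * (((3 : ℝ) ^ k)⁻¹ / 4) := by gcongr
        _ = 1 / 4 := by field_simp
    have h2 : |3 ^ k * t - 3 ^ k * t₀| ≤ 1 / 4 := by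
      rwa [← mul_sub, abs_mul, abs_of_pos hk]
    rw [abs_le] at h2
    exact ⟨by linarith, by linarith⟩
  obtain ⟨j, hj⟩ : ∃ j : ℤ, (3 : ℝ) ^ k = 2 * j + 1 := by
    obtain ⟨j, hj⟩ := (Odd.pow (n := k) (by decide : Odd (3 : ℤ)))
    exact ⟨j, by exact_mod_cast hj⟩
  have hf0 := Int.floor_le (3 ^ k * t₀)
  have hf1 := Int.lt_floor_add_one (3 ^ k * t₀)
  set m := ⌊3 ^ k * t₀⌋ with hm
  have hidx : ∀ (e : ℝ) (n : ℤ) t, (n : ℝ) ≤ 3 ^ k * t - 3 ^ k * e → 3 ^ k * t - 3 ^ k * e < n + 1 →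
      idx e k t = n := by
    intro e n t h1 h2
    unfold idx
    rw [mul_sub, Int.floor_eq_iff]
    exact ⟨h1, h2⟩
  have hz : |t₀ - t₀| ≤ ((3 : ℝ) ^ k)⁻¹ / 4 := by simp; positivity
  by_cases h1 : 3 ^ k * t₀ < m + 1 / 4
  · refine ⟨1 / 2, Or.inr rfl, ?_⟩
    have : ∀ t, |t - t₀| ≤ ((3 : ℝ) ^ k)⁻¹ / 4 → idx (1 / 2) k t = m - j - 1 := by
      intro t ht
      obtain ⟨h3, h4⟩ := key t ht
      apply hidx <;> rw [show (3 : ℝ) ^ k * (1 / 2) = j + 1 / 2 by rw [hj]; ring] <;> push_cast <;>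
        linarith
    intro t ht
    exact (this t ht).trans (this t₀ hz).symm
  by_cases h2 : (m : ℝ) + 3 / 4 ≤ 3 ^ k * t₀
  · refine ⟨1 / 2, Or.inr rfl, ?_⟩
    have : ∀ t, |t - t₀| ≤ ((3 : ℝ) ^ k)⁻¹ / 4 → idx (1 / 2) k t = m - j := by
      intro t ht
      obtain ⟨h3, h4⟩ := key t ht
      apply hidx <;> rw [show (3 : ℝ) ^ k * (1 / 2) = j + 1 / 2 by rw [hj]; ring] <;> push_cast <;>
        linarith
    intro t ht
    exact (this t ht).trans (this t₀ hz).symm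
  · refine ⟨0, Or.inl rfl, ?_⟩
    push Not at h1 h2
    have : ∀ t, |t - t₀| ≤ ((3 : ℝ) ^ k)⁻¹ / 4 → idx 0 k t = m := by
      intro t ht
      obtain ⟨h3, h4⟩ := key t ht
      apply hidx <;> linarith
    intro t ht
    exact (this t ht).trans (this t₀ hz).symm

lemma abs_dens_sub_le {ν : Measure ℝ} {e ε t₀ : ℝ} {k q : ℕ}
    (h : ∀ t ∈ cell e k t₀, ∀ d < q, |jump ν e (k + d) t| ≤ ε) {t : ℝ} (ht : t ∈ cell e k t₀)
    {d : ℕ} (hd : d ≤ q) :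
    |(dens ν e (k + d) t).toReal - (dens ν e k t₀).toReal| ≤ d * ε := by
  induction d with
  | zero =>
    rw [add_zero, dens_congr ν le_rfl ht]; simp
  | succ d ih =>
    have h1 := ih (by omega)
    have h2 := h t ht d (by omega)
    unfold jump at h2
    rw [abs_le] at *
    push_cast
    rw [add_assoc] at h2
    constructor <;> linarith [h1.1, h1.2, h2.1, h2.2]

lemma toReal_dens (ν : Measure ℝ) (e : ℝ) (k : ℕ) (t : ℝ) :
    (dens ν e k t).toReal = 3 ^ k * ν.real (cell e k t) := by
  unfold dens
  rw [ENNReal.toReal_mul]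
  simp [Measure.real]

/-- If the density does not vary between two generations, then the measure is nearly uniform. -/
lemma abs_measureReal_Ioc_sub_le {ν : Measure ℝ} [IsFiniteMeasure ν] {e ε t₀ : ℝ} {k q : ℕ}
    (h : ∀ t ∈ cell e k t₀, ∀ d < q, |jump ν e (k + d) t| ≤ ε) (hε : 0 ≤ ε) {a b : ℝ} (hab : a ≤ b)
    (ha : a ∈ cell e k t₀) (hb : b ∈ cell e k t₀) :
    |ν.real (Ioc a b) - (dens ν e k t₀).toReal * (b - a)| ≤
      q * ε * (b - a) + 2 * ((3 : ℝ) ^ (k + q))⁻¹ * ((dens ν e k t₀).toReal + q * ε) := by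
  set γ := (dens ν e k t₀).toReal with hγ
  have hγ0 : 0 ≤ γ := ENNReal.toReal_nonneg
  set g := k + q with hg
  set ℓ : ℝ := ((3 : ℝ) ^ g)⁻¹ with hℓ
  have hℓ0 : 0 < ℓ := by positivity
  set η : ℝ := q * ε with hη
  have hη0 : 0 ≤ η := by positivity
  set n₁ := idx e g a with hn₁
  set n₂ := idx e g b with hn₂
  have hn : n₁ ≤ n₂ := idx_mono e g hab
  have e3 : ∀ y : ℝ, y / 3 ^ g = y * ℓ := fun y => by rw [hℓ, div_eq_mul_inv]
  have ha' := idx_eq_iff.1 hn₁.symm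
  have hb' := idx_eq_iff.1 hn₂.symm
  rw [mem_Ico, e3, e3] at ha' hb'
  have hcellm : ∀ m ∈ Finset.Icc n₁ n₂, |ν.real {t | idx e g t = m} - ℓ * γ| ≤ ℓ * η := by
    intro m hm
    rw [Finset.mem_Icc] at hm
    obtain ⟨t, hat, htb, htm⟩ : ∃ t, a ≤ t ∧ t ≤ b ∧ idx e g t = m := by
      rcases hm.1.eq_or_lt with h1 | h1
      · exact ⟨a, le_rfl, hab, by rw [← h1]⟩
      refine ⟨e + m / 3 ^ g, ?_, ?_, ?_⟩
      · have : (n₁ : ℝ) + 1 ≤ m := by exact_mod_cast h1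
        rw [e3]
        nlinarith
      · have : (m : ℝ) ≤ n₂ := by exact_mod_cast hm.2
        rw [e3]
        nlinarith
      · rw [idx_eq_iff, mem_Ico, e3, e3]
        constructor <;> nlinarith
    have htc : t ∈ cell e k t₀ := by
      have h1 := idx_mono e k hat
      have h2 := idx_mono e k htb
      rw [show idx e k a = idx e k t₀ from ha] at h1
      rw [show idx e k b = idx e k t₀ from hb] at h2
      exact le_antisymm h2 h1
    have h3 := abs_dens_sub_le h htc (le_refl q)
    have h4 : {t' | idx e g t' = m} = cell e g t := by rw [← htm]; rfl
    rw [toReal_dens, ← hg, ← hγ] at h3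
    have h5 : ν.real (cell e g t) - ℓ * γ = ℓ * (3 ^ g * ν.real (cell e g t) - γ) := by
      rw [hℓ]; field_simp
    rw [h4, h5, abs_mul, abs_of_pos hℓ0]
    gcongr
  have hsum : ∀ s : Finset ℤ, ν.real {t | idx e g t ∈ s} = ∑ m ∈ s, ν.real {t | idx e g t = m} := by
    intro s
    have : {t | idx e g t ∈ s} = ⋃ m ∈ s, {t | idx e g t = m} := by ext t; simp
    rw [this, measureReal_biUnion_finset]
    · intro m _ m' _ hmm
      refine disjoint_left.2 fun t ht ht' => hmm ?_
      exact (show idx e g t = m from ht).symm.trans ht'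
    · intro m _
      exact measurable_idx e g (measurableSet_singleton m)
  have hup : ν.real (Ioc a b) ≤ (b - a + 2 * ℓ) * (γ + η) := by
    have h1 : Ioc a b ⊆ {t | idx e g t ∈ Finset.Icc n₁ n₂} := fun t ht =>
      Finset.mem_Icc.2 ⟨idx_mono e g ht.1.le, idx_mono e g ht.2⟩
    have h2 : ∑ m ∈ Finset.Icc n₁ n₂, ν.real {t | idx e g t = m} ≤
        ∑ m ∈ Finset.Icc n₁ n₂, ℓ * (γ + η) := by
      refine Finset.sum_le_sum fun m hm => ?_
      have := (abs_le.1 (hcellm m hm)).2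
      linarith
    rw [Finset.sum_const, nsmul_eq_mul, Int.card_Icc] at h2
    have h3 : (((n₂ + 1 - n₁).toNat : ℕ) : ℝ) = n₂ + 1 - n₁ := by
      have : ((n₂ + 1 - n₁).toNat : ℤ) = n₂ + 1 - n₁ := Int.toNat_of_nonneg (by omega)
      exact_mod_cast this
    rw [h3] at h2
    have h4 : ((n₂ : ℝ) + 1 - n₁) * ℓ ≤ b - a + 2 * ℓ := by nlinarith
    calc ν.real (Ioc a b) ≤ _ := measureReal_mono h1
      _ = _ := hsum _
      _ ≤ _ := h2
      _ = ((n₂ : ℝ) + 1 - n₁) * ℓ * (γ + η) := by ring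
      _ ≤ _ := by gcongr
  have hlow : (b - a - 2 * ℓ) * γ - (b - a) * η ≤ ν.real (Ioc a b) := by
    have h1 : {t | idx e g t ∈ Finset.Ioo n₁ n₂} ⊆ Ioc a b := by
      intro t ht
      have ht' := Finset.mem_Ioo.1 (show idx e g t ∈ Finset.Ioo n₁ n₂ from ht)
      constructor
      · by_contra hc
        exact absurd (idx_mono e g (not_lt.1 hc)) (not_le.2 ht'.1)
      · by_contra hc
        exact absurd (idx_mono e g (not_le.1 hc).le) (not_le.2 ht'.2)
    have h2 : ∑ m ∈ Finset.Ioo n₁ n₂, ℓ * (γ - η) ≤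
        ∑ m ∈ Finset.Ioo n₁ n₂, ν.real {t | idx e g t = m} := by
      refine Finset.sum_le_sum fun m hm => ?_
      have := (abs_le.1 (hcellm m (Finset.Ioo_subset_Icc_self hm))).1
      linarith
    rw [Finset.sum_const, nsmul_eq_mul, Int.card_Ioo] at h2
    have h5 := (h2.trans_eq (hsum _).symm).trans (measureReal_mono h1)
    rcases hn.eq_or_lt with h6 | h6
    · have h7 : b - a ≤ ℓ := by rw [← h6] at hb'; linarith [hb'.2, ha'.1]
      have : (b - a - 2 * ℓ) * γ ≤ 0 := mul_nonpos_of_nonpos_of_nonneg (by linarith) hγ0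
      have : 0 ≤ (b - a) * η := mul_nonneg (by linarith) hη0
      have : 0 ≤ ν.real (Ioc a b) := measureReal_nonneg
      linarith
    · have h3 : (((n₂ - n₁ - 1).toNat : ℕ) : ℝ) = n₂ - n₁ - 1 := by
        have : ((n₂ - n₁ - 1).toNat : ℤ) = n₂ - n₁ - 1 := Int.toNat_of_nonneg (by omega)
        exact_mod_cast this
      rw [h3] at h5
      have h7 : b - a - 2 * ℓ ≤ ((n₂ : ℝ) - n₁ - 1) * ℓ := by nlinarith
      have h8 : ((n₂ : ℝ) - n₁ - 1) * ℓ ≤ b - a := by nlinarith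
      nlinarith [mul_le_mul_of_nonneg_right h7 hγ0, mul_le_mul_of_nonneg_right h8 hη0]
  rw [abs_le]
  constructor <;> nlinarith [mul_nonneg hℓ0.le hγ0, mul_nonneg hℓ0.le hη0]

/-- The rescaling of the measure `μ` centred at `x` at scale `ρ`. -/
def rescale (μ : Measure (ℝ × ℝ)) (x : ℝ × ℝ) (ρ : ℝ) : Measure (ℝ × ℝ) :=
  ENNReal.ofReal ρ⁻¹ • μ.map fun z => ρ⁻¹ • (z - x)

instance (μ : Measure (ℝ × ℝ)) [IsFiniteMeasure μ] (x : ℝ × ℝ) (ρ : ℝ) :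
    IsFiniteMeasure (rescale μ x ρ) := by
  unfold rescale
  exact Measure.smul_finite _ ENNReal.ofReal_ne_top

lemma measurable_rescale_map (x : ℝ × ℝ) (ρ : ℝ) : Measurable fun z : ℝ × ℝ => ρ⁻¹ • (z - x) := by
  fun_prop

lemma rescale_real (μ : Measure (ℝ × ℝ)) (x : ℝ × ℝ) {ρ : ℝ} (hρ : 0 < ρ) {S : Set (ℝ × ℝ)}
    (hS : MeasurableSet S) : (rescale μ x ρ).real S = ρ⁻¹ * μ.real {z | ρ⁻¹ • (z - x) ∈ S} := by
  unfold rescale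
  rw [measureReal_ennreal_smul_apply, map_measureReal_apply (measurable_rescale_map x ρ) hS,
    ENNReal.toReal_ofReal (by positivity)]
  rfl

lemma lin_smul_sub (s ρ : ℝ) (z x : ℝ × ℝ) : lin s (ρ • (z - x)) = ρ * (lin s z - lin s x) := by
  simp [lin]; ring

lemma lin_add_smul (s ρ : ℝ) (z x : ℝ × ℝ) : lin s (x + ρ • z) = lin s x + ρ * lin s z := by
  simp [lin]; ring

lemma abs_lin_sub_le {s : ℝ} (hs : s ∈ Ico (0 : ℝ) 1) (z w : ℝ × ℝ) :
    |lin s z - lin s w| ≤ 2 * dist z w := by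
  have h1 : |z.1 - w.1| ≤ dist z w := by
    rw [Prod.dist_eq, ← Real.dist_eq]; exact le_max_left _ _
  have h2 : |z.2 - w.2| ≤ dist z w := by
    rw [Prod.dist_eq, ← Real.dist_eq]; exact le_max_right _ _
  have e : lin s z - lin s w = (z.1 - w.1) + s * (z.2 - w.2) := by unfold lin; ring
  rw [e]
  refine (abs_add_le _ _).trans ?_
  rw [abs_mul, abs_of_nonneg hs.1]
  nlinarith [hs.1, hs.2, abs_nonneg (z.2 - w.2)]

lemma uniform_rescale {μ : Measure (ℝ × ℝ)} [IsFiniteMeasure μ] {x : ℝ × ℝ} {s M ε : ℝ} {q k : ℕ}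
    (hM : 0 ≤ M) (hε : 0 ≤ ε)
    (hd : ∀ e : ℝ, e = 0 ∨ e = 1 / 2 → dens (μ.map (lin s)) e k (lin s x) ≤ ENNReal.ofReal M)
    (hu : ∀ e : ℝ, e = 0 ∨ e = 1 / 2 → (x, s) ∉ nonUniform μ e q ε k) :
    ∃ γ, 0 ≤ γ ∧ γ ≤ M ∧ ∀ a b : ℝ, -8 ≤ a → a ≤ b → b ≤ 8 →
      |(rescale μ x ((3 : ℝ) ^ (k + 4))⁻¹).real {z | a < lin s z ∧ lin s z ≤ b} - γ * (b - a)| ≤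
        16 * (q * ε) + 162 * ((3 : ℝ) ^ q)⁻¹ * (M + q * ε) := by
  obtain ⟨e, he, hcell⟩ := exists_grid k (lin s x)
  set ν := μ.map (lin s) with hν
  set t₀ := lin s x with ht₀
  set ρ : ℝ := ((3 : ℝ) ^ (k + 4))⁻¹ with hρ
  have hρ0 : 0 < ρ := by positivity
  have hρk : ((3 : ℝ) ^ k)⁻¹ = 81 * ρ := by rw [hρ, pow_add]; norm_num; ring
  rw [hρk] at hcell
  have hfin : IsFiniteMeasure ν := by rw [hν]; infer_instance
  have hγM : (dens ν e k t₀).toReal ≤ M :=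
    ENNReal.toReal_le_of_le_ofReal hM (hd e he)
  have hvar : ∀ t ∈ cell e k t₀, ∀ d < q, |jump ν e (k + d) t| ≤ ε := by
    intro t ht d hdq
    by_contra hlt
    refine hu e he ?_
    have h1 := le_volume_cell_inter_varies (ν := ν) ht ⟨d, hdq, not_le.1 hlt⟩
    intro h0
    rw [h0] at h1
    simp at h1
  refine ⟨_, ENNReal.toReal_nonneg, hγM, fun a b ha hab hb => ?_⟩
  have hmem : ∀ y : ℝ, -8 ≤ y → y ≤ 8 → t₀ + ρ * y ∈ cell e k t₀ := by
    intro y h1 h2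
    refine hcell _ ?_
    rw [add_sub_cancel_left, abs_le]
    constructor <;> nlinarith
  have h1 := abs_measureReal_Ioc_sub_le hvar hε (a := t₀ + ρ * a) (b := t₀ + ρ * b) (by gcongr)
    (hmem a ha (hab.trans hb)) (hmem b (ha.trans hab) hb)
  have h2 : (rescale μ x ρ).real {z | a < lin s z ∧ lin s z ≤ b} =
      ρ⁻¹ * ν.real (Ioc (t₀ + ρ * a) (t₀ + ρ * b)) := by
    have hm : MeasurableSet {z | a < lin s z ∧ lin s z ≤ b} :=
      (measurableSet_lt measurable_const (measurable_lin s)).inter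
        (measurableSet_le (measurable_lin s) measurable_const)
    rw [rescale_real μ x hρ0 hm, hν,
      map_measureReal_apply (measurable_lin s) measurableSet_Ioc]
    congr 2
    ext z
    simp only [mem_ofPred_eq, lin_smul_sub, mem_preimage, mem_Ioc]
    rw [lt_inv_mul_iff₀ hρ0, inv_mul_le_iff₀ hρ0, ← ht₀]
    constructor <;> rintro ⟨h3, h4⟩ <;> constructor <;> linarith
  rw [h2]
  set γ := (dens ν e k t₀).toReal with hγ
  have h3 : ρ⁻¹ * ν.real (Ioc (t₀ + ρ * a) (t₀ + ρ * b)) - γ * (b - a) =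
      ρ⁻¹ * (ν.real (Ioc (t₀ + ρ * a) (t₀ + ρ * b)) - γ * (t₀ + ρ * b - (t₀ + ρ * a))) := by
    field_simp; ring
  rw [h3, abs_mul, abs_of_pos (inv_pos.2 hρ0), inv_mul_le_iff₀ hρ0]
  refine h1.trans ?_
  have h4 : ((3 : ℝ) ^ (k + q))⁻¹ = 81 * ρ * ((3 : ℝ) ^ q)⁻¹ := by rw [← hρk, pow_add, mul_inv]
  rw [h4]
  have h5 : q * ε * (t₀ + ρ * b - (t₀ + ρ * a)) ≤ ρ * (16 * (q * ε)) := by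
    have : 0 ≤ q * ε := by positivity
    nlinarith [mul_nonneg this hρ0.le]
  have h6 : 2 * (81 * ρ * ((3 : ℝ) ^ q)⁻¹) * (γ + q * ε) ≤
      ρ * (162 * ((3 : ℝ) ^ q)⁻¹ * (M + q * ε)) := by
    calc 2 * (81 * ρ * ((3 : ℝ) ^ q)⁻¹) * (γ + q * ε) ≤
        2 * (81 * ρ * ((3 : ℝ) ^ q)⁻¹) * (M + q * ε) := by gcongr
      _ = _ := by ring
  linarith

lemma card_separated_le {μ : Measure (ℝ × ℝ)} [IsFiniteMeasure μ] {E : Set (ℝ × ℝ)} {x : ℝ × ℝ}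
    {s M a : ℝ} {k N : ℕ} (hs : s ∈ Ico (0 : ℝ) 1) (hM : 0 ≤ M) (ha : 0 < a) (hN : 81 * M ≤ a * N)
    (hlow : ∀ z ∈ E, ENNReal.ofReal (a * ((3 : ℝ) ^ (k + 4))⁻¹) ≤
      μ (ball z ((3 : ℝ) ^ (k + 4))⁻¹))
    (hd : ∀ e : ℝ, e = 0 ∨ e = 1 / 2 → dens (μ.map (lin s)) e k (lin s x) ≤ ENNReal.ofReal M)
    (X : Finset ℝ)
    (hX : ∀ v ∈ X, ∃ z, x + ((3 : ℝ) ^ (k + 4))⁻¹ • z ∈ E ∧ |lin s z| ≤ 10 ∧ z.2 = v)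
    (hsep : ∀ v ∈ X, ∀ v' ∈ X, v ≠ v' → 2 ≤ |v - v'|) : X.card ≤ N := by
  obtain ⟨e, he, hcell⟩ := exists_grid k (lin s x)
  set ρ : ℝ := ((3 : ℝ) ^ (k + 4))⁻¹ with hρ
  have hρ0 : 0 < ρ := by positivity
  have hρk : ((3 : ℝ) ^ k)⁻¹ = 81 * ρ := by rw [hρ, pow_add]; norm_num; ring
  rw [hρk] at hcell
  choose! f hfE hf10 hfv using hX
  have hmass : μ.real (lin s ⁻¹' cell e k (lin s x)) ≤ 81 * ρ * M := by
    have h1 := ENNReal.toReal_le_of_le_ofReal hM (hd e he)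
    rw [toReal_dens, map_measureReal_apply (measurable_lin s) (measurableSet_cell _ _ _)] at h1
    rw [← hρk]
    rwa [le_inv_mul_iff₀ (by positivity)]
  have hdisj : (X : Set ℝ).PairwiseDisjoint fun v => ball (x + ρ • f v) ρ := by
    intro v hv v' hv' hne
    refine ball_disjoint_ball ?_
    have h1 := hsep v hv v' hv' hne
    have h2 : |(x + ρ • f v).2 - (x + ρ • f v').2| ≤ dist (x + ρ • f v) (x + ρ • f v') := by
      rw [Prod.dist_eq, ← Real.dist_eq]; exact le_max_right _ _
    refine le_trans ?_ h2
    have e1 : (x + ρ • f v).2 - (x + ρ • f v').2 = ρ * (v - v') := by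
      simp [hfv v hv, hfv v' hv']; ring
    rw [e1, abs_mul, abs_of_pos hρ0]
    nlinarith
  have hsub : ⋃ v ∈ X, ball (x + ρ • f v) ρ ⊆ lin s ⁻¹' cell e k (lin s x) := by
    refine iUnion₂_subset fun v hv w hw => hcell _ ?_
    have h1 := abs_lin_sub_le hs w (x + ρ • f v)
    rw [mem_ball] at hw
    have h2 := hf10 v hv
    rw [lin_add_smul, abs_le] at h1
    rw [abs_le] at h2 ⊢
    constructor <;> nlinarith [h1.1, h1.2, h2.1, h2.2]
  have h1 : ∑ v ∈ X, a * ρ ≤ ∑ v ∈ X, μ.real (ball (x + ρ • f v) ρ) := by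
    refine Finset.sum_le_sum fun v hv => ?_
    have := hlow _ (hfE v hv)
    rwa [ENNReal.ofReal_le_iff_le_toReal (by finiteness)] at this
  rw [← measureReal_biUnion_finset hdisj fun _ _ => measurableSet_ball, Finset.sum_const,
    nsmul_eq_mul] at h1
  have h2 := h1.trans ((measureReal_mono hsub).trans hmass)
  have h3 : (X.card : ℝ) * (a * ρ) ≤ N * (a * ρ) := by nlinarith
  exact_mod_cast le_of_mul_le_mul_right h3 (by positivity)

theorem config_of_slopes {μ μ₂ : Measure (ℝ × ℝ)} [IsFiniteMeasure μ] [IsFiniteMeasure μ₂]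
    {E K : Set (ℝ × ℝ)} {x : ℝ × ℝ} {M a ε c : ℝ} {q k N : ℕ} (hE : MeasurableSet E)
    (hμE : μ Eᶜ = 0) (hle : μ ≤ μ₂) (hM : 0 ≤ M) (ha : 0 < a) (hN : 81 * M ≤ a * N) (hε : 0 ≤ ε)
    (hc : 0 < c) (hlow : ∀ z ∈ E, ENNReal.ofReal (a * ((3 : ℝ) ^ (k + 4))⁻¹) ≤
      μ₂ (ball z ((3 : ℝ) ^ (k + 4))⁻¹)) :
    Config (rescale μ x ((3 : ℝ) ^ (k + 4))⁻¹) {z | x + ((3 : ℝ) ^ (k + 4))⁻¹ • z ∈ E}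
      (slopes c (goodPairs μ₂ K (ENNReal.ofReal M))
        (dropPairs μ (goodPairs μ₂ K (ENNReal.ofReal M)) q ε k) x) (c / 24) M
      (16 * (q * ε) + 162 * ((3 : ℝ) ^ q)⁻¹ * (M + q * ε)) N := by
  set ρ : ℝ := ((3 : ℝ) ^ (k + 4))⁻¹ with hρ
  have hρ0 : 0 < ρ := by positivity
  have hgood : ∀ s, (x, s) ∈ goodPairs μ₂ K (ENNReal.ofReal M) → ∀ e : ℝ, e = 0 ∨ e = 1 / 2 →
      dens (μ₂.map (lin s)) e k (lin s x) ≤ ENNReal.ofReal M := by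
    rintro s hs e (rfl | rfl)
    · exact hs.2.1 k
    · exact hs.2.2 k
  refine ⟨?_, antitone_slopes _ _ _ _, slopes_thick hc goodPairs_slope x, ?_, ?_⟩
  · have hEm : MeasurableSet {z | x + ρ • z ∈ E} := by
      have h : Measurable fun z : ℝ × ℝ => x + ρ • z := by fun_prop
      exact h hE
    unfold rescale
    rw [Measure.smul_apply, Measure.map_apply (measurable_rescale_map x ρ) hEm.compl]
    have : (fun z : ℝ × ℝ => ρ⁻¹ • (z - x)) ⁻¹' {z | x + ρ • z ∈ E}ᶜ = Eᶜ := by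
      ext z
      simp [smul_inv_smul₀ hρ0.ne']
    rw [this, hμE, smul_zero]
  · rintro s ⟨hs, hs'⟩
    refine uniform_rescale hM hε (fun e he => ?_) fun e he hn => hs' ⟨hs, ?_⟩
    · refine le_trans ?_ (hgood s hs e he)
      rw [dens_map_lin, dens_map_lin]
      gcongr
    · rcases he with rfl | rfl
      · exact Or.inl hn
      · exact Or.inr hn
  · rintro s ⟨hs, -⟩ X hX hsep
    exact card_separated_le (μ := μ₂) (goodPairs_slope _ hs) hM ha hN hlow (hgood s hs) X hX hsep

/-- An index at which a walk through a decreasing family of sets may end. -/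
def Terminal (T : ℕ → Set ℕ) (X : Finset ℕ) (k₀ w : ℕ) : Prop :=
  (∀ k, w ∈ T k) ∨ ∃ k ∈ X, k₀ ≤ k ∧ w ∈ T k ∧ w ∉ T (k + 1) ∧ w ≤ k + 4

lemma exists_last {T : ℕ → Set ℕ} (hT : Antitone T) {k w : ℕ} (hw : w ∈ T k)
    (hn : ¬ ∀ k, w ∈ T k) : ∃ k' ≥ k, w ∈ T k' ∧ w ∉ T (k' + 1) := by
  classical
  push Not at hn
  have hne : ∃ d, w ∉ T (k + d) := by
    obtain ⟨m, hm⟩ := hn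
    exact ⟨m, fun h => hm (hT (Nat.le_add_left m k) h)⟩
  have h1 := Nat.find_spec hne
  have h0 : Nat.find hne ≠ 0 := by
    intro h0
    rw [h0] at h1
    exact h1 hw
  obtain ⟨d, hd⟩ := Nat.exists_eq_succ_of_ne_zero h0
  refine ⟨k + d, Nat.le_add_right _ _, ?_, ?_⟩
  · have := Nat.find_min hne (m := d) (by omega)
    exact not_not.1 this
  · rw [hd] at h1
    exact h1

lemma exists_terminal_near {T : ℕ → Set ℕ} (hT : Antitone T) {X : Finset ℕ} {k₀ l₀ m₁ n : ℕ}
    (hcard : ∀ k ≥ k₀, ∀ W : Finset ℕ, (∀ w ∈ W, w ∈ T k ∧ w ≤ k + 4) → W.card ≤ n)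
    (hlevel : ∀ k ≥ k₀, k ∉ X → ∀ l ∈ T k, l₀ ≤ l → l + m₁ ≤ k + 4 →
      ∃ i ∈ T (k + 1), i ≤ l + n ∧ l ≤ i + n)
    {k l : ℕ} (hk : k₀ ≤ k) (hl : l ∈ T k) (hl₀ : l₀ + n * n ≤ l) (hlk : l + n * n + m₁ ≤ k + 4) :
    ∃ w, Terminal T X k₀ w ∧ w ≤ l + n * n ∧ l ≤ w + n * n := by
  by_contra hcon
  push Not at hcon
  have claim : ∀ j ≤ n, ∃ W : Finset ℕ, W.card = j + 1 ∧
      (∀ w ∈ W, w ∈ T k ∧ w ≤ l + n * j ∧ l ≤ w + n * j) ∧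
      ∃ k' ≥ k, ∃ w ∈ W, w ∈ T k' ∧ ∀ w' ∈ W, w' ≠ w → w' ∉ T k' := by
    intro j
    induction j with
    | zero =>
      intro _
      exact ⟨{l}, by simp, by simpa using hl, k, le_rfl, l, by simp, hl, by simp⟩
    | succ j ih =>
      intro hj
      obtain ⟨W, hWc, hW, k', hk', w, hw, hwk, hother⟩ := ih (by omega)
      have hnj : n * j + n ≤ n * n := by
        calc n * j + n = n * (j + 1) := by ring
          _ ≤ n * n := Nat.mul_le_mul_left _ hj
      obtain ⟨-, hw1, hw2⟩ := hW w hw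
      have hterm : ¬ Terminal T X k₀ w := by
        intro ht
        have := hcon w ht (by omega)
        omega
      unfold Terminal at hterm
      push Not at hterm
      obtain ⟨k'', hk'', hwk1, hwk2⟩ := exists_last hT hwk (by push Not; exact hterm.1)
      have hX : k'' ∉ X := by
        intro hX
        have := hterm.2 k'' hX (by omega) hwk1 hwk2
        omega
      obtain ⟨i, hi, hi1, hi2⟩ := hlevel k'' (by omega) hX w hwk1 (by omega) (by omega)
      have hik' : i ∈ T k' := hT (by omega) hi
      have hiW : i ∉ W := by
        intro hiW
        by_cases hiw : i = w
        · exact hwk2 (hiw ▸ hi)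
        · exact hother i hiW hiw hik'
      refine ⟨insert i W, by rw [Finset.card_insert_of_notMem hiW, hWc], ?_, k'' + 1, by omega, i,
        Finset.mem_insert_self _ _, hi, ?_⟩
      · intro w' hw'
        rw [Finset.mem_insert] at hw'
        rw [mul_add, mul_one]
        rcases hw' with rfl | hw'
        · exact ⟨hT (by omega) hi, by omega, by omega⟩
        · obtain ⟨h1, h2, h3⟩ := hW w' hw'
          exact ⟨h1, by omega, by omega⟩
      · intro w' hw' hne h1
        rw [Finset.mem_insert] at hw'
        rcases hw' with rfl | hw'
        · exact hne rfl
        by_cases hww : w' = w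
        · exact hwk2 (hww ▸ h1)
        · exact hother w' hw' hww (hT (by omega) h1)
  obtain ⟨W, hWc, hW, -⟩ := claim n le_rfl
  have := hcard k hk W fun w hw => ⟨(hW w hw).1, by have := (hW w hw).2.1; omega⟩
  omega

lemma card_terminal_le {T : ℕ → Set ℕ} {X : Finset ℕ} {k₀ n : ℕ}
    (hcard : ∀ k ≥ k₀, ∀ W : Finset ℕ, (∀ w ∈ W, w ∈ T k ∧ w ≤ k + 4) → W.card ≤ n)
    (W : Finset ℕ) (hW : ∀ w ∈ W, Terminal T X k₀ w) : W.card ≤ n + X.card * n := by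
  classical
  set W₁ := W.filter fun w => ∀ k, w ∈ T k with hW₁
  set W₂ := W.filter fun w => ¬ ∀ k, w ∈ T k with hW₂
  have h0 : W.card = W₁.card + W₂.card := (Finset.card_filter_add_card_filter_not _).symm
  have h1 : W₁.card ≤ n := by
    refine hcard (k₀ + W.sup id) (by omega) W₁ fun w hw => ?_
    rw [hW₁, Finset.mem_filter] at hw
    refine ⟨hw.2 _, ?_⟩
    have : w ≤ W.sup id := Finset.le_sup (f := id) hw.1
    omega
  have h2 : W₂ ⊆ X.biUnion fun k =>
      W.filter fun w => k₀ ≤ k ∧ w ∈ T k ∧ w ≤ k + 4 := by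
    intro w hw
    rw [hW₂, Finset.mem_filter] at hw
    rcases hW w hw.1 with h | ⟨k, hk, h3, h4, -, h5⟩
    · exact absurd h hw.2
    · exact Finset.mem_biUnion.2 ⟨k, hk, Finset.mem_filter.2 ⟨hw.1, h3, h4, h5⟩⟩
  have h3 : W₂.card ≤ X.card * n := by
    refine (Finset.card_le_card h2).trans (Finset.card_biUnion_le_card_mul _ _ _ fun k _ => ?_)
    by_cases hk : k₀ ≤ k
    · exact hcard k hk _ fun w hw => (Finset.mem_filter.1 hw).2.2
    · simp [hk]
  omega

/-- A combinatorial bound for the number of indices `l` lying in the sets `T k` with `k` close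
to `l`. -/
lemma card_mem_diagonal_le {T : ℕ → Set ℕ} (hT : Antitone T) {X : Finset ℕ} {k₀ l₀ m₁ n : ℕ}
    (hcard : ∀ k ≥ k₀, ∀ W : Finset ℕ, (∀ w ∈ W, w ∈ T k ∧ w ≤ k + 4) → W.card ≤ n)
    (hlevel : ∀ k ≥ k₀, k ∉ X → ∀ l ∈ T k, l₀ ≤ l → l + m₁ ≤ k + 4 →
      ∃ i ∈ T (k + 1), i ≤ l + n ∧ l ≤ i + n)
    (W : Finset ℕ) (hW : ∀ l ∈ W, l ∈ T (l + n * n + m₁)) :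
    W.card ≤ (k₀ + l₀ + n * n) + (2 * (n * n) + 1) * (n + X.card * n) := by
  classical
  set W₁ := W.filter fun l => l < k₀ + l₀ + n * n with hW₁
  set W₂ := W.filter fun l => ¬ l < k₀ + l₀ + n * n with hW₂
  have h0 : W.card = W₁.card + W₂.card := (Finset.card_filter_add_card_filter_not _).symm
  have h1 : W₁.card ≤ k₀ + l₀ + n * n := by
    rw [← Finset.card_range (k₀ + l₀ + n * n)]
    exact Finset.card_le_card fun l hl => Finset.mem_range.2 (Finset.mem_filter.1 hl).2
  have h2 : ∀ l ∈ W₂, ∃ w, Terminal T X k₀ w ∧ w ≤ l + n * n ∧ l ≤ w + n * n := by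
    intro l hl
    obtain ⟨hlW, hl⟩ := Finset.mem_filter.1 hl
    exact exists_terminal_near hT hcard hlevel (k := l + n * n + m₁) (by omega) (hW l hlW)
      (by omega) (by omega)
  choose! f hf using h2
  have h3 : (W₂.image f).card ≤ n + X.card * n := by
    refine card_terminal_le hcard _ fun w hw => ?_
    obtain ⟨l, hl, rfl⟩ := Finset.mem_image.1 hw
    exact (hf l hl).1
  have h4 : W₂.card ≤ (2 * (n * n) + 1) * (W₂.image f).card := by
    refine Finset.card_le_mul_card_image _ _ fun w _ => ?_
    calc _ ≤ (Finset.Icc (w - n * n) (w + n * n)).card := by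
          refine Finset.card_le_card fun l hl => ?_
          obtain ⟨hl₂, rfl⟩ := Finset.mem_filter.1 hl
          have := hf l hl₂
          rw [Finset.mem_Icc]; omega
      _ ≤ 2 * (n * n) + 1 := by rw [Nat.card_Icc]; omega
  have h5 := h4.trans (Nat.mul_le_mul_left _ h3)
  omega

/-- The triadic levels, relative to `x`, of the points of `E` whose projection is close to the
projection of `x`. -/
def nearLevels (E : Set (ℝ × ℝ)) (x : ℝ × ℝ) (s : ℝ) (k : ℕ) : Set ℕ :=
  {l | ∃ z ∈ E, ((3 : ℝ) ^ l)⁻¹ ≤ |z.2 - x.2| ∧ |z.2 - x.2| < 3 * ((3 : ℝ) ^ l)⁻¹ ∧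
    |lin s z - lin s x| ≤ 3 * ((3 : ℝ) ^ (k + 4))⁻¹}

lemma antitone_nearLevels (E : Set (ℝ × ℝ)) (x : ℝ × ℝ) (s : ℝ) : Antitone (nearLevels E x s) := by
  rintro k k' hk l ⟨z, hz, h1, h2, h3⟩
  refine ⟨z, hz, h1, h2, h3.trans ?_⟩
  gcongr
  norm_num

lemma pow_le_abs_mul_iff {w i m : ℕ} (h : w + i = m) (v : ℝ) :
    (3 : ℝ) ^ i ≤ |3 ^ m * v| ↔ ((3 : ℝ) ^ w)⁻¹ ≤ |v| := by
  rw [← h, pow_add, abs_mul, abs_of_pos (by positivity), inv_le_iff_one_le_mul₀ (by positivity)]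
  rw [mul_comm ((3 : ℝ) ^ w), mul_assoc, le_mul_iff_one_le_right (by positivity), mul_comm]

lemma abs_mul_lt_pow_iff {w i m : ℕ} (h : w + i = m) (v : ℝ) :
    |3 ^ m * v| < (3 : ℝ) ^ (i + 1) ↔ |v| < 3 * ((3 : ℝ) ^ w)⁻¹ := by
  rw [← h, pow_add, abs_mul, abs_of_pos (by positivity), ← div_eq_mul_inv, lt_div_iff₀ (by positivity),
    pow_succ, mul_comm ((3 : ℝ) ^ w), mul_assoc, mul_lt_mul_iff_right₀ (by positivity), mul_comm]

section

variable {E : Set (ℝ × ℝ)} {x : ℝ × ℝ} {s : ℝ} {k : ℕ}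

lemma occupied_of_mem_nearLevels {w i : ℕ} (hw : w ∈ nearLevels E x s k) (h : w + i = k + 4) :
    ∃ z, x + ((3 : ℝ) ^ (k + 4))⁻¹ • z ∈ E ∧ (3 : ℝ) ^ i ≤ |z.2| ∧ |z.2| < 3 ^ (i + 1) ∧
      |lin s z| ≤ 3 := by
  obtain ⟨z, hz, h1, h2, h3⟩ := hw
  refine ⟨(3 : ℝ) ^ (k + 4) • (z - x), ?_, ?_, ?_, ?_⟩
  · rw [inv_smul_smul₀ (by positivity)]
    simpa using hz
  · exact (pow_le_abs_mul_iff h _).2 h1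
  · exact (abs_mul_lt_pow_iff h _).2 h2
  · rw [lin_smul_sub, abs_mul, abs_of_pos (by positivity)]
    rwa [← div_eq_mul_inv, le_div_iff₀ (by positivity), mul_comm] at h3

lemma mem_nearLevels_succ {w i : ℕ} {z : ℝ × ℝ} (h : w + i = k + 4)
    (hz : x + ((3 : ℝ) ^ (k + 4))⁻¹ • z ∈ E) (h1 : (3 : ℝ) ^ i ≤ |z.2|) (h2 : |z.2| < 3 ^ (i + 1))
    (h3 : |lin s z| < 1) : w ∈ nearLevels E x s (k + 1) := by
  have e : z.2 = 3 ^ (k + 4) * ((x + ((3 : ℝ) ^ (k + 4))⁻¹ • z).2 - x.2) := by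
    simp
  rw [e] at h1 h2
  refine ⟨_, hz, (pow_le_abs_mul_iff h _).1 h1, (abs_mul_lt_pow_iff h _).1 h2, ?_⟩
  have e5 : ((3 : ℝ) ^ (k + 1 + 4))⁻¹ = ((3 : ℝ) ^ (k + 4))⁻¹ * 3⁻¹ := by
    rw [show k + 1 + 4 = (k + 4) + 1 by ring, pow_succ (3 : ℝ) (k + 4), mul_inv]
  rw [lin_add_smul, add_sub_cancel_left, abs_mul, abs_of_pos (by positivity), e5]
  have : (0 : ℝ) < ((3 : ℝ) ^ (k + 4))⁻¹ := by positivity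
  nlinarith

lemma card_nearLevels_le {N : ℕ}
    (hsep : ∀ X : Finset ℝ,
      (∀ v ∈ X, ∃ z, x + ((3 : ℝ) ^ (k + 4))⁻¹ • z ∈ E ∧ |lin s z| ≤ 10 ∧ z.2 = v) →
      (∀ v ∈ X, ∀ v' ∈ X, v ≠ v' → 2 ≤ |v - v'|) → X.card ≤ N)
    (W : Finset ℕ) (hW : ∀ w ∈ W, w ∈ nearLevels E x s k ∧ w ≤ k + 4) : W.card ≤ 2 * N := by
  classical
  have hinj : Set.InjOn (fun w => k + 4 - w) (W : Set ℕ) := by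
    intro w hw w' hw' h
    have h1 := (hW w hw).2
    have h2 := (hW w' hw').2
    simp only at h
    omega
  rw [← Finset.card_image_of_injOn hinj]
  refine card_occupied_le (E := {z | x + ((3 : ℝ) ^ (k + 4))⁻¹ • z ∈ E}) hsep _ fun i hi => ?_
  obtain ⟨w, hw, rfl⟩ := Finset.mem_image.1 hi
  obtain ⟨z, hz, h1, h2, h3⟩ := occupied_of_mem_nearLevels (i := k + 4 - w) (hW w hw).1
    (by have := (hW w hw).2; omega)
  exact ⟨z, hz, h1, h2, h3.trans (by norm_num)⟩

end

lemma exists_scale_parameters {ε₁ M : ℝ} (hε₁ : 0 < ε₁) (hM : 0 ≤ M) : ∃ q : ℕ, ∃ ε > 0,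
    16 * (q * ε) + 162 * ((3 : ℝ) ^ q)⁻¹ * (M + q * ε) ≤ ε₁ := by
  obtain ⟨q, hq⟩ := exists_pow_lt_of_lt_one (x := ε₁ / (2 * (162 * (M + 1)))) (y := (3 : ℝ)⁻¹)
    (by positivity) (by norm_num)
  rw [lt_div_iff₀ (by positivity), inv_pow] at hq
  set t := min 1 (ε₁ / 32) with ht
  have ht0 : 0 < t := lt_min one_pos (by positivity)
  refine ⟨q, t / (q + 1), by positivity, ?_⟩
  have h1 : q * (t / (q + 1)) ≤ t := by
    rw [mul_div_assoc', div_le_iff₀ (by positivity)]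
    nlinarith
  have h2 : t ≤ 1 := min_le_left _ _
  have h3 : t ≤ ε₁ / 32 := min_le_right _ _
  have h4 : 162 * ((3 : ℝ) ^ q)⁻¹ * (M + q * (t / (q + 1))) ≤
      162 * ((3 : ℝ) ^ q)⁻¹ * (M + 1) := by gcongr; linarith
  nlinarith

lemma dist_le_of_nearLevel {s : ℝ} (hs : s ∈ Ico (0 : ℝ) 1) {x z : ℝ × ℝ} {l k : ℕ} (hl : 6 ≤ l)
    (hk : 6 ≤ k) (h2 : |z.2 - x.2| < 3 * ((3 : ℝ) ^ l)⁻¹)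
    (h3 : |lin s z - lin s x| ≤ 3 * ((3 : ℝ) ^ (k + 4))⁻¹) : dist z x ≤ 1 / 16 := by
  have e1 : ((3 : ℝ) ^ l)⁻¹ ≤ ((3 : ℝ) ^ 6)⁻¹ := by gcongr; norm_num
  have e2 : ((3 : ℝ) ^ (k + 4))⁻¹ ≤ ((3 : ℝ) ^ 6)⁻¹ := by gcongr; norm_num; omega
  norm_num at e1 e2
  have e3 : z.1 - x.1 = (lin s z - lin s x) - s * (z.2 - x.2) := by unfold lin; ring
  have e4 : |z.1 - x.1| ≤ |lin s z - lin s x| + |z.2 - x.2| := by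
    rw [e3]
    refine (abs_sub _ _).trans ?_
    rw [abs_mul, abs_of_nonneg hs.1]
    nlinarith [hs.2, abs_nonneg (z.2 - x.2)]
  rw [Prod.dist_eq, Real.dist_eq, Real.dist_eq]
  refine max_le ?_ ?_ <;> linarith

/-- There is a slope `s` and a large set of points around which, at all but boundedly many scales,
the set avoids the double cone of directions almost orthogonal to the projection `lin s`. -/
theorem exists_sparse_bad_levels {κ A₀ a : ℝ} (hκ : 0 < κ) (hA₀ : 0 < A₀) (ha : 0 < a) :
    ∃ δ > 0, ∃ c₀ > 0, ∃ n : ℕ, ∀ (μ μ₂ : Measure (ℝ × ℝ)) [IsFiniteMeasure μ]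
      [IsFiniteMeasure μ₂] (E K : Set (ℝ × ℝ)), μ ≤ μ₂ → μ₂ univ ≤ ENNReal.ofReal A₀ →
      MeasurableSet E → MeasurableSet K → μ Eᶜ = 0 →
      (∀ z ∈ E, ∀ ρ, 0 < ρ → ρ ≤ 1 / 16 → ENNReal.ofReal (a * ρ) ≤ μ₂ (ball z ρ)) →
      (∀ x ∈ K, ∀ z ∈ E, dist z x ≤ 1 / 16 → ∀ ρ, 0 < ρ → ρ ≤ 1 / 16 →
        ENNReal.ofReal (a * ρ) ≤ μ (ball z ρ)) →
      (∀ s ∈ Ico (0 : ℝ) 1, ∀ S ⊆ K, MeasurableSet S → volume (lin s '' S) ≤ 2 * μ S) →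
      ENNReal.ofReal κ ≤ ∫⁻ s in Ico 0 1, volume (lin s '' K) →
      ∃ s ∈ Ico (0 : ℝ) 1, ∃ F ⊆ K, MeasurableSet F ∧ ENNReal.ofReal δ ≤ μ F ∧
        ∀ x ∈ F, ∀ W : Finset ℕ, (∀ l ∈ W, ∃ z ∈ E, ((3 : ℝ) ^ l)⁻¹ ≤ |z.2 - x.2| ∧
          |z.2 - x.2| < 3 * ((3 : ℝ) ^ l)⁻¹ ∧ |lin s z - lin s x| ≤ c₀ * |z.2 - x.2|) →
          W.card ≤ n := by
  set M : ℝ := 4 * A₀ / κ with hM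
  have hM0 : 0 < M := by positivity
  obtain ⟨N, hN⟩ := exists_nat_ge (81 * M / a)
  have hN' : 81 * M ≤ a * N := by rwa [div_le_iff₀' ha] at hN
  obtain ⟨c, hc0, -, hgood⟩ := exists_good_slope hκ hA₀ hM0
    (by rw [hM, div_mul_cancel₀ _ hκ.ne']) ((2 * N + 1) * (2 * N * (2 * N * 1)))
  obtain ⟨ε₁, hε₁, m₁, hclose⟩ := exists_closer_point (c := c / 24) (B := M) (a := a) (by positivity)
    hM0.le ha N
  obtain ⟨q, ε, hε, hqε⟩ := exists_scale_parameters hε₁ hM0.le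
  obtain ⟨Nd, hNd⟩ := hgood q ε hε
  set n := 2 * N with hn
  refine ⟨κ / 16, by positivity, ((3 : ℝ) ^ (n * n + m₁ + 4))⁻¹, by positivity,
    (6 + (6 + n) + n * n) + (2 * (n * n) + 1) * (n + Nd * n), ?_⟩
  intro μ μ₂ _ _ E K hle hμ₂ hE hK hμE hlow2 hlow1 hlip hfav
  obtain ⟨s, hs, F, hFK, hFm, hFμ, hF⟩ := hNd μ μ₂ K hle hμ₂ hK hlip hfav
  refine ⟨s, hs, F, hFK, hFm, hFμ, fun x hx W hW => ?_⟩
  obtain ⟨X, hXc, hX⟩ := hF x hx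
  have hxs : (x, s) ∈ goodPairs μ₂ K (ENNReal.ofReal M) := by
    obtain ⟨k, hk⟩ := Infinite.exists_notMem_finset X
    exact iterate_thickPart_subset_self _ _ _ (hX k hk).1
  have hρ : ∀ k : ℕ, ((3 : ℝ) ^ (k + 4))⁻¹ ≤ 1 / 16 := by
    intro k
    have : ((3 : ℝ) ^ (k + 4))⁻¹ ≤ ((3 : ℝ) ^ 4)⁻¹ := by gcongr; norm_num; omega
    norm_num at this ⊢
    linarith
  have hcard : ∀ k ≥ 6, ∀ W : Finset ℕ, (∀ w ∈ W, w ∈ nearLevels E x s k ∧ w ≤ k + 4) →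
      W.card ≤ n := by
    intro k _
    refine card_nearLevels_le fun X => card_separated_le (μ := μ₂) hs hM0.le ha hN'
      (fun z hz => hlow2 z hz _ (by positivity) (hρ k)) ?_ X
    rintro e (rfl | rfl)
    · exact hxs.2.1 k
    · exact hxs.2.2 k
  have hlevel : ∀ k ≥ 6, k ∉ X → ∀ l ∈ nearLevels E x s k, 6 + n ≤ l → l + m₁ ≤ k + 4 →
      ∃ i ∈ nearLevels E x s (k + 1), i ≤ l + n ∧ l ≤ i + n := by
    intro k hk6 hk l hl hnl hlk
    have hconf := config_of_slopes (q := q) (ε := ε) (k := k) (N := N) (x := x) (K := K) hE hμE hle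
      hM0.le ha hN' hε.le hc0 (fun z hz => hlow2 z hz _ (by positivity) (hρ k))
    obtain ⟨y, hyE, hy1, hy2, hy3⟩ := occupied_of_mem_nearLevels (i := k + 4 - l) hl (by omega)
    set ρ : ℝ := ((3 : ℝ) ^ (k + 4))⁻¹ with hρdef
    have hρ0 : 0 < ρ := by positivity
    have hball : a ≤ (rescale μ x ρ).real (ball y 1) := by
      rw [rescale_real μ x hρ0 measurableSet_ball]
      have e1 : {z | ρ⁻¹ • (z - x) ∈ ball y 1} = ball (x + ρ • y) ρ := by
        ext z
        have e2 : ρ⁻¹ • (z - x) - y = ρ⁻¹ • (z - (x + ρ • y)) := by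
          rw [← sub_sub, smul_sub _ (z - x), inv_smul_smul₀ hρ0.ne']
        rw [mem_ofPred_eq, mem_ball, mem_ball, dist_eq_norm, dist_eq_norm, e2, norm_smul,
          Real.norm_of_nonneg (by positivity), inv_mul_lt_iff₀ hρ0, mul_one]
      rw [e1, le_inv_mul_iff₀ hρ0, mul_comm]
      have hdist : dist (x + ρ • y) x ≤ 1 / 16 := by
        refine dist_le_of_nearLevel hs (l := l) (k := k) (by omega) hk6 ?_ ?_
        · rw [← abs_mul_lt_pow_iff (i := k + 4 - l) (m := k + 4) (by omega)]
          simpa [hρdef] using hy2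
        · rw [lin_add_smul, add_sub_cancel_left, abs_mul, abs_of_pos hρ0, mul_comm 3]
          gcongr
      have := hlow1 x (hFK hx) _ hyE hdist ρ hρ0 (hρ k)
      rwa [ENNReal.ofReal_le_iff_le_toReal (by finiteness)] at this
    obtain ⟨z, hz, hz1, i, hi1, hi2, hij, hji⟩ := hclose _ _ _ _ hconf hqε s (hX k hk) hs.1 hs.2.le
      (k + 4 - l) (by omega) y hyE hy1 hy2 hy3 hball
    exact ⟨k + 4 - i, mem_nearLevels_succ (i := i) (by omega) hz hi1 hi2 hz1, by omega, by omega⟩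
  refine (card_mem_diagonal_le (antitone_nearLevels E x s) hcard hlevel W fun l hl => ?_).trans
    (by gcongr)
  obtain ⟨z, hz, h1, h2, h3⟩ := hW l hl
  refine ⟨z, hz, h1, h2, h3.trans ?_⟩
  calc ((3 : ℝ) ^ (n * n + m₁ + 4))⁻¹ * |z.2 - x.2|
      ≤ ((3 : ℝ) ^ (n * n + m₁ + 4))⁻¹ * (3 * ((3 : ℝ) ^ l)⁻¹) := by gcongr
    _ = 3 * ((3 : ℝ) ^ (l + n * n + m₁ + 4))⁻¹ := by
        rw [show l + n * n + m₁ + 4 = (n * n + m₁ + 4) + l by ring, pow_add _ _ l, mul_inv]; ring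

lemma exists_triadic_level {d : ℝ} (h0 : 0 < d) (h3 : d < 3) :
    ∃ l : ℕ, ((3 : ℝ) ^ l)⁻¹ ≤ d ∧ d < 3 * ((3 : ℝ) ^ l)⁻¹ := by
  obtain ⟨m, h1, h2⟩ := exists_mem_Ico_zpow h0 (by norm_num : (1 : ℝ) < 3)
  have hm : m < 1 := by
    by_contra! h
    have := zpow_le_zpow_right₀ (by norm_num : (1 : ℝ) ≤ 3) h
    rw [zpow_one] at this
    linarith
  obtain ⟨l, rfl⟩ : ∃ l : ℕ, m = -l := ⟨m.natAbs, by omega⟩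
  refine ⟨l, by simpa using h1, ?_⟩
  rw [zpow_add₀ (by norm_num)] at h2
  simpa [mul_comm] using h2

/-- A finite set of reals in which every point sees the others at no more than `N` triadic
distances has at most `7 ^ N` elements. -/
lemma card_le_of_few_levels (N : ℕ) (X : Finset ℝ)
    (hX : ∀ x ∈ X, ∀ y ∈ X, |y - x| < 3)
    (h : ∀ x ∈ X, ∀ W : Finset ℕ,
      (∀ l ∈ W, ∃ y ∈ X, ((3 : ℝ) ^ l)⁻¹ ≤ |y - x| ∧ |y - x| < 3 * ((3 : ℝ) ^ l)⁻¹) → W.card ≤ N) :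
    X.card ≤ 7 ^ N := by
  classical
  induction N generalizing X with
  | zero =>
    rw [pow_zero, Finset.card_le_one]
    intro x hx y hy
    by_contra hxy
    obtain ⟨l, hl⟩ := exists_triadic_level (abs_pos.2 (sub_ne_zero.2 (Ne.symm hxy))) (hX x hx y hy)
    have := h x hx {l} (by simpa using ⟨y, hy, hl⟩)
    simp at this
  | succ N ih =>
    rcases X.eq_empty_or_nonempty with rfl | hne
    · simp
    set p := X.min' hne with hp
    set q := X.max' hne with hq
    have hpq : p ≤ q := X.min'_le _ (X.max'_mem hne)
    rcases hpq.eq_or_lt with heq | hlt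
    · have : X.card ≤ 1 := by
        rw [Finset.card_le_one]
        intro x hx y hy
        have h1 := X.min'_le x hx
        have h2 := X.le_max' x hx
        have h3 := X.min'_le y hy
        have h4 := X.le_max' y hy
        linarith
      exact this.trans (Nat.one_le_pow _ _ (by norm_num))
    have hD : 0 < q - p := sub_pos.2 hlt
    let g : ℝ → ℕ := fun x => ⌊6 * (x - p) / (q - p)⌋₊
    have hg : ∀ x ∈ X, g x ∈ Finset.range 7 := by
      intro x hx
      have h1 := X.min'_le x hx
      have h2 := X.le_max' x hx
      rw [Finset.mem_range, Nat.floor_lt (div_nonneg (by linarith) hD.le), div_lt_iff₀ hD]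
      push_cast
      linarith
    have hfib : ∀ i ∈ Finset.range 7, (X.filter fun x => g x = i).card ≤ 7 ^ N := by
      intro i _
      have hclose : ∀ x ∈ X.filter (fun x => g x = i), ∀ y ∈ X.filter (fun x => g x = i),
          |y - x| < (q - p) / 6 := by
        intro x hx y hy
        obtain ⟨hx, hxi⟩ := Finset.mem_filter.1 hx
        obtain ⟨hy, hyi⟩ := Finset.mem_filter.1 hy
        have hx0 := X.min'_le x hx
        have hy0 := X.min'_le y hy
        rw [Nat.floor_eq_iff (div_nonneg (by linarith) hD.le), le_div_iff₀ hD, div_lt_iff₀ hD]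
          at hxi hyi
        rw [abs_lt]
        constructor <;> nlinarith
      refine ih _ (fun x hx y hy => hX x (Finset.mem_filter.1 hx).1 y (Finset.mem_filter.1 hy).1) ?_
      intro x hx W hW
      have hxX := (Finset.mem_filter.1 hx).1
      obtain ⟨y, hy, hyx⟩ : ∃ y ∈ X, (q - p) / 2 ≤ |y - x| := by
        rcases le_total x ((p + q) / 2) with hh | hh
        · exact ⟨q, X.max'_mem hne, le_trans (by linarith) (le_abs_self _)⟩
        · exact ⟨p, X.min'_mem hne, le_trans (by linarith) (neg_le_abs _)⟩
      obtain ⟨l, hl1, hl2⟩ := exists_triadic_level (by linarith) (hX x hxX y hy)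
      have hlW : l ∉ W := by
        intro hl
        obtain ⟨z, hz, hz1, hz2⟩ := hW l hl
        have := hclose x hx z hz
        linarith
      have := h x hxX (insert l W) (by
        intro l' hl'
        rcases Finset.mem_insert.1 hl' with rfl | hl'
        · exact ⟨y, hy, hl1, hl2⟩
        · obtain ⟨z, hz, hz'⟩ := hW l' hl'
          exact ⟨z, (Finset.mem_filter.1 hz).1, hz'⟩)
      rw [Finset.card_insert_of_notMem hlW] at this
      omega
    calc X.card = ∑ i ∈ Finset.range 7, (X.filter fun x => g x = i).card :=
          Finset.card_eq_sum_card_fiberwise hg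
      _ ≤ ∑ i ∈ Finset.range 7, 7 ^ N := Finset.sum_le_sum hfib
      _ = 7 ^ (N + 1) := by simp [pow_succ, mul_comm]

/-- A set whose chains have at most `H` elements is a union of `H` antichains. -/
lemma exists_antichain_coloring {α : Type*} (r : α → α → Prop) (v : α → ℝ)
    (hv : ∀ x y, r x y → v x < v y) (htrans : ∀ x y z, r x y → r y z → r x z) (H : ℕ) (F : Set α)
    (hF : ∀ c : Finset α, (c : Set α) ⊆ F → (∀ x ∈ c, ∀ y ∈ c, x ≠ y → r x y ∨ r y x) → c.card ≤ H) :
    ∃ f : α → ℕ, (∀ x ∈ F, f x < H) ∧ ∀ x ∈ F, ∀ y ∈ F, f x = f y → ¬ r x y := by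
  classical
  induction H generalizing F with
  | zero =>
    have hF0 : ∀ x, x ∉ F := by
      intro x hx
      have := hF {x} (by simpa using hx) (by simp)
      simp at this
    exact ⟨fun _ => 0, fun x hx => absurd hx (hF0 x), fun x hx => absurd hx (hF0 x)⟩
  | succ H ih =>
    set F' : Set α := {x | x ∈ F ∧ ∃ y ∈ F, r y x} with hF'
    have hF'F : F' ⊆ F := fun x hx => hx.1
    obtain ⟨f, hf1, hf2⟩ := ih F' (by
      intro c hc hchain
      rcases c.eq_empty_or_nonempty with rfl | hne
      · simp
      obtain ⟨m, hm, hmin⟩ := c.exists_min_image v hne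
      obtain ⟨hmF, y, hy, hym⟩ := hc hm
      have hall : ∀ x ∈ c, r y x := by
        intro x hx
        by_cases hxm : m = x
        · exact hxm ▸ hym
        · rcases hchain m hm x hx hxm with h | h
          · exact htrans _ _ _ hym h
          · exact absurd (hv _ _ h) (hmin x hx).not_gt
      have hyc : y ∉ c := fun h => lt_irrefl _ (hv _ _ (hall y h))
      have := hF (insert y c) (by
        intro x hx
        rcases Finset.mem_insert.1 (Finset.mem_coe.1 hx) with rfl | hx
        · exact hy
        · exact hF'F (hc hx)) (by
        intro x hx z hz hxz
        rcases Finset.mem_insert.1 hx with rfl | hx' <;>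
          rcases Finset.mem_insert.1 hz with rfl | hz'
        · exact absurd rfl hxz
        · exact Or.inl (hall z hz')
        · exact Or.inr (hall x hx')
        · exact hchain x hx' z hz' hxz)
      rw [Finset.card_insert_of_notMem hyc] at this
      omega)
    refine ⟨fun x => if x ∈ F' then f x else H, ?_, ?_⟩
    · intro x hx
      dsimp only
      split_ifs with h
      · exact (hf1 x h).trans (Nat.lt_succ_self H)
      · exact Nat.lt_succ_self H
    · intro x hx y hy hxy hr
      have hyF' : y ∈ F' := ⟨hy, x, hx, hr⟩
      dsimp only at hxy
      rw [if_pos hyF'] at hxy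
      split_ifs at hxy with hxF'
      · exact hf2 x hxF' y hyF' hxy hr
      · have := hf1 y hyF'
        omega

/-- A set each of whose points sees the set in the cone around a fixed direction at no more than
`n` triadic distances contains a piece avoiding all such cones, with a proportion of its mass. -/
theorem exists_cone_free_subset {μ : Measure (ℝ × ℝ)} {F : Set (ℝ × ℝ)} {s c₀ : ℝ} {n : ℕ}
    (hF : ∀ x ∈ F, ∀ y ∈ F, |y.2 - x.2| < 3)
    (hW : ∀ x ∈ F, ∀ W : Finset ℕ, (∀ l ∈ W, ∃ z ∈ F, ((3 : ℝ) ^ l)⁻¹ ≤ |z.2 - x.2| ∧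
      |z.2 - x.2| < 3 * ((3 : ℝ) ^ l)⁻¹ ∧ |lin s z - lin s x| ≤ c₀ * |z.2 - x.2|) → W.card ≤ n) :
    ∃ G ⊆ F, μ F ≤ 7 ^ n * μ G ∧
      ∀ x ∈ G, ∀ y ∈ G, c₀ * |y.2 - x.2| ≤ |lin s y - lin s x| := by
  classical
  let r : ℝ × ℝ → ℝ × ℝ → Prop := fun x y =>
    x.2 < y.2 ∧ |lin s y - lin s x| ≤ c₀ * (y.2 - x.2)
  have hr : ∀ x y, r x y ∨ r y x → x.2 ≠ y.2 ∧ |lin s y - lin s x| ≤ c₀ * |y.2 - x.2| := by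
    rintro x y (h | h)
    · exact ⟨h.1.ne, h.2.trans_eq (by rw [abs_of_pos (sub_pos.2 h.1)])⟩
    · exact ⟨h.1.ne', by rw [abs_sub_comm, abs_sub_comm y.2, abs_of_pos (sub_pos.2 h.1)]; exact h.2⟩
  obtain ⟨f, hf1, hf2⟩ := exists_antichain_coloring r Prod.snd (fun x y h => h.1)
    (fun x y z h1 h2 => ⟨h1.1.trans h2.1, by
      have := abs_sub_le (lin s z) (lin s y) (lin s x)
      linarith [h1.2, h2.2]⟩) (7 ^ n) F (by
    intro c hc hchain
    have hinj : Set.InjOn Prod.snd (c : Set (ℝ × ℝ)) := by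
      intro x hx y hy hxy
      by_contra hne
      exact (hr x y (hchain x hx y hy hne)).1 hxy
    rw [← Finset.card_image_of_injOn hinj]
    refine card_le_of_few_levels n _ ?_ ?_
    · intro x hx y hy
      obtain ⟨x, hxc, rfl⟩ := Finset.mem_image.1 hx
      obtain ⟨y, hyc, rfl⟩ := Finset.mem_image.1 hy
      exact hF x (hc hxc) y (hc hyc)
    · intro x hx W hWx
      obtain ⟨x, hxc, rfl⟩ := Finset.mem_image.1 hx
      refine hW x (hc hxc) W fun l hl => ?_
      obtain ⟨y, hy, h1, h2⟩ := hWx l hl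
      obtain ⟨y, hyc, rfl⟩ := Finset.mem_image.1 hy
      have hne : x ≠ y := by
        rintro rfl
        rw [sub_self, abs_zero] at h1
        exact absurd h1 (not_le.2 (by positivity))
      exact ⟨y, hc hyc, h1, h2, (hr x y (hchain x hxc y hyc hne)).2⟩)
  have hcov : F ⊆ ⋃ i ∈ Finset.range (7 ^ n), F ∩ f ⁻¹' {i} := by
    intro x hx
    simp only [mem_iUnion]
    exact ⟨f x, Finset.mem_range.2 (hf1 x hx), hx, rfl⟩
  obtain ⟨i, _, hi⟩ := (Finset.range (7 ^ n)).exists_max_image (fun i => μ (F ∩ f ⁻¹' {i}))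
    ⟨0, Finset.mem_range.2 (by positivity)⟩
  refine ⟨F ∩ f ⁻¹' {i}, inter_subset_left, ?_, ?_⟩
  · calc μ F ≤ ∑ j ∈ Finset.range (7 ^ n), μ (F ∩ f ⁻¹' {j}) :=
          (measure_mono hcov).trans (measure_biUnion_finset_le _ _)
      _ ≤ ∑ j ∈ Finset.range (7 ^ n), μ (F ∩ f ⁻¹' {i}) := Finset.sum_le_sum hi
      _ = 7 ^ n * μ (F ∩ f ⁻¹' {i}) := by simp
  · rintro x ⟨hx, hxi⟩ y ⟨hy, hyi⟩
    have hxy : f x = f y := hxi.trans hyi.symm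
    rcases lt_trichotomy x.2 y.2 with h | h | h
    · rw [abs_of_pos (sub_pos.2 h)]
      by_contra! h'
      exact hf2 x hx y hy hxy ⟨h, h'.le⟩
    · simp [h]
    · rw [abs_sub_comm, abs_of_pos (sub_pos.2 h), abs_sub_comm (lin s y)]
      by_contra! h'
      exact hf2 y hy x hx hxy.symm ⟨h, h'.le⟩

/-- A set of positive measure with lower regularity and large projections in many directions
contains a large piece avoiding the cones around some direction. -/
theorem exists_big_cone_free_subset {κ A₀ a : ℝ} (hκ : 0 < κ) (hA₀ : 0 < A₀) (ha : 0 < a) :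
    ∃ η > 0, ∃ c₀ > 0, ∀ (μ μ₂ : Measure (ℝ × ℝ)) [IsFiniteMeasure μ]
      [IsFiniteMeasure μ₂] (E K : Set (ℝ × ℝ)), μ ≤ μ₂ → μ₂ univ ≤ ENNReal.ofReal A₀ →
      MeasurableSet E → MeasurableSet K → K ⊆ E → (∀ z ∈ E, ∀ w ∈ E, |w.2 - z.2| < 3) →
      μ Eᶜ = 0 →
      (∀ z ∈ E, ∀ ρ, 0 < ρ → ρ ≤ 1 / 16 → ENNReal.ofReal (a * ρ) ≤ μ₂ (ball z ρ)) →
      (∀ x ∈ K, ∀ z ∈ E, dist z x ≤ 1 / 16 → ∀ ρ, 0 < ρ → ρ ≤ 1 / 16 →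
        ENNReal.ofReal (a * ρ) ≤ μ (ball z ρ)) →
      (∀ s ∈ Ico (0 : ℝ) 1, ∀ S ⊆ K, MeasurableSet S → volume (lin s '' S) ≤ 2 * μ S) →
      ENNReal.ofReal κ ≤ ∫⁻ s in Ico 0 1, volume (lin s '' K) →
      ∃ s ∈ Ico (0 : ℝ) 1, ∃ G ⊆ K, ENNReal.ofReal η ≤ μ G ∧
        ∀ x ∈ G, ∀ y ∈ G, c₀ * |y.2 - x.2| ≤ |lin s y - lin s x| := by
  obtain ⟨δ, hδ, c₀, hc₀, n, H⟩ := exists_sparse_bad_levels hκ hA₀ ha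
  refine ⟨δ / 7 ^ n, by positivity, c₀, hc₀, ?_⟩
  intro μ μ₂ _ _ E K h1 h2 hE hK hKE hbdd h3 h4 h5 h6 h7
  obtain ⟨s, hs, F, hFK, -, hF, hFW⟩ := H μ μ₂ E K h1 h2 hE hK h3 h4 h5 h6 h7
  have hFE : F ⊆ E := hFK.trans hKE
  obtain ⟨G, hGF, hG, hcone⟩ := exists_cone_free_subset (μ := μ) (F := F) (s := s) (c₀ := c₀) (n := n)
    (fun x hx y hy => hbdd x (hFE hx) y (hFE hy))
    (fun x hx W hW => hFW x hx W fun l hl => by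
      obtain ⟨z, hz, hz'⟩ := hW l hl
      exact ⟨z, hFE hz, hz'⟩)
  refine ⟨s, hs, G, hGF.trans hFK, ?_, hcone⟩
  rw [ENNReal.ofReal_div_of_pos (by positivity)]
  refine ENNReal.div_le_of_le_mul' ((hF.trans hG).trans_eq ?_)
  rw [ENNReal.ofReal_pow (by norm_num)]
  norm_num

lemma proj_add_angle (θ α : ℝ) (z : R2) : proj (θ + α) z =
    Real.cos (2 * Real.pi * α) * proj θ z + Real.sin (2 * Real.pi * α) * projPerp θ z := by
  unfold projPerp proj
  rw [show 2 * Real.pi * (θ + α) = 2 * Real.pi * θ + 2 * Real.pi * α by ring,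
    show 2 * Real.pi * (θ + 1 / 4) = 2 * Real.pi * θ + Real.pi / 2 by ring,
    Real.cos_add_pi_div_two, Real.sin_add_pi_div_two, Real.cos_add, Real.sin_add]
  ring

lemma projPerp_eq (θ : ℝ) (z : R2) : projPerp θ z =
    -Real.sin (2 * Real.pi * θ) * z 0 + Real.cos (2 * Real.pi * θ) * z 1 := by
  unfold projPerp proj
  rw [show 2 * Real.pi * (θ + 1 / 4) = 2 * Real.pi * θ + Real.pi / 2 by ring,
    Real.cos_add_pi_div_two, Real.sin_add_pi_div_two]
  ring

lemma projPerp_add_angle (θ α : ℝ) (z : R2) : projPerp (θ + α) z =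
    -Real.sin (2 * Real.pi * α) * proj θ z + Real.cos (2 * Real.pi * α) * projPerp θ z := by
  rw [projPerp_eq, projPerp_eq]
  unfold proj
  rw [show 2 * Real.pi * (θ + α) = 2 * Real.pi * θ + 2 * Real.pi * α by ring,
    Real.cos_add, Real.sin_add]
  ring

lemma proj_sub (θ : ℝ) (z w : R2) : proj θ (z - w) = proj θ z - proj θ w := by
  simp only [proj, PiLp.sub_apply]
  ring

lemma continuous_proj (θ : ℝ) : Continuous (proj θ) := by
  unfold proj
  fun_prop

lemma norm_sq_eq (θ : ℝ) (z : R2) : ‖z‖ ^ 2 = proj θ z ^ 2 + projPerp θ z ^ 2 := by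
  rw [EuclideanSpace.norm_sq_eq, projPerp_eq]
  simp only [Fin.sum_univ_two, Real.norm_eq_abs, sq_abs, proj]
  linear_combination (-(z 0) ^ 2 - (z 1) ^ 2) * Real.sin_sq_add_cos_sq (2 * Real.pi * θ)

/-- Passing to the orthonormal coordinates given by `proj θ` and `projPerp θ`. -/
def rotation (θ : ℝ) : R2 ≃ₗᵢ[ℝ] R2 :=
  LinearIsometry.toLinearIsometryEquiv
    { toFun := fun z => !₂[proj θ z, projPerp θ z]
      map_add' := fun z w => by
        ext i
        fin_cases i <;> simp [proj, projPerp] <;> ring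
      map_smul' := fun t z => by
        ext i
        fin_cases i <;> simp [proj, projPerp] <;> ring
      norm_map' := fun z => by
        rw [← sq_eq_sq₀ (norm_nonneg _) (norm_nonneg _), norm_sq_eq θ z, EuclideanSpace.norm_sq_eq]
        simp } rfl

@[simp] lemma rotation_apply_zero (θ : ℝ) (z : R2) : rotation θ z 0 = proj θ z := rfl

@[simp] lemma rotation_apply_one (θ : ℝ) (z : R2) : rotation θ z 1 = projPerp θ z := rfl

/-- The orthonormal coordinates in direction `θ` centred at `x₀`, rescaled by `r`. -/
def frame (θ : ℝ) (x₀ : R2) {r : ℝ} (hr : 0 < r) : R2 ≃ₜ ℝ × ℝ where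
  toFun z := (r⁻¹ * proj θ (z - x₀), r⁻¹ * projPerp θ (z - x₀))
  invFun p := x₀ + r • (rotation θ).symm !₂[p.1, p.2]
  left_inv z := by
    have : r • !₂[r⁻¹ * proj θ (z - x₀), r⁻¹ * projPerp θ (z - x₀)] = rotation θ (z - x₀) := by
      ext i
      fin_cases i <;> simp [hr.ne', proj_sub, projPerp]
    simp only
    rw [← map_smul, this, LinearIsometryEquiv.symm_apply_apply, add_sub_cancel]
  right_inv p := by
    simp only [add_sub_cancel_left]
    rw [← rotation_apply_zero, ← rotation_apply_one, map_smul, LinearIsometryEquiv.apply_symm_apply]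
    ext <;> simp [hr.ne']
  continuous_toFun := by
    unfold projPerp
    have h0 := continuous_proj θ
    have h1 := continuous_proj (θ + 1 / 4)
    fun_prop
  continuous_invFun := by
    fun_prop

section frame

variable {θ : ℝ} {x₀ : R2} {r : ℝ} (hr : 0 < r)

lemma frame_fst (z : R2) : (frame θ x₀ hr z).1 = r⁻¹ * proj θ (z - x₀) := rfl

lemma frame_snd (z : R2) : (frame θ x₀ hr z).2 = r⁻¹ * projPerp θ (z - x₀) := rfl

lemma frame_fst_sub (z w : R2) :
    (frame θ x₀ hr z).1 - (frame θ x₀ hr w).1 = r⁻¹ * proj θ (z - w) := by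
  rw [frame_fst, frame_fst, ← mul_sub, ← proj_sub, sub_sub_sub_cancel_right]

lemma frame_snd_sub (z w : R2) :
    (frame θ x₀ hr z).2 - (frame θ x₀ hr w).2 = r⁻¹ * projPerp θ (z - w) := by
  rw [frame_snd, frame_snd, ← mul_sub, projPerp, projPerp, ← proj_sub, sub_sub_sub_cancel_right]
  rfl

lemma dist_sq_eq_frame (z w : R2) : dist z w ^ 2 = r ^ 2 *
    (((frame θ x₀ hr z).1 - (frame θ x₀ hr w).1) ^ 2 +
      ((frame θ x₀ hr z).2 - (frame θ x₀ hr w).2) ^ 2) := by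
  rw [dist_eq_norm, norm_sq_eq θ, frame_fst_sub, frame_snd_sub]
  field_simp

lemma dist_frame_le (z w : R2) : dist (frame θ x₀ hr z) (frame θ x₀ hr w) ≤ r⁻¹ * dist z w := by
  have h := dist_sq_eq_frame (θ := θ) (x₀ := x₀) hr z w
  have h0 : 0 ≤ r⁻¹ * dist z w := by positivity
  have h1 : (r⁻¹ * dist z w) ^ 2 = ((frame θ x₀ hr z).1 - (frame θ x₀ hr w).1) ^ 2 +
      ((frame θ x₀ hr z).2 - (frame θ x₀ hr w).2) ^ 2 := by
    rw [mul_pow, h]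
    field_simp
  rw [Prod.dist_eq, Real.dist_eq, Real.dist_eq]
  refine max_le (abs_le_of_sq_le_sq ?_ h0) (abs_le_of_sq_le_sq ?_ h0) <;> rw [h1] <;>
    nlinarith [sq_nonneg ((frame θ x₀ hr z).1 - (frame θ x₀ hr w).1),
      sq_nonneg ((frame θ x₀ hr z).2 - (frame θ x₀ hr w).2)]

lemma dist_le_dist_frame (z w : R2) :
    dist z w ≤ 2 * r * dist (frame θ x₀ hr z) (frame θ x₀ hr w) := by
  have h := dist_sq_eq_frame (θ := θ) (x₀ := x₀) hr z w
  have h1 : |(frame θ x₀ hr z).1 - (frame θ x₀ hr w).1| ≤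
      dist (frame θ x₀ hr z) (frame θ x₀ hr w) := le_max_left _ _
  have h2 : |(frame θ x₀ hr z).2 - (frame θ x₀ hr w).2| ≤
      dist (frame θ x₀ hr z) (frame θ x₀ hr w) := le_max_right _ _
  refine le_of_sq_le_sq ?_ (by positivity)
  have e1 := sq_le_sq' (by linarith [neg_abs_le ((frame θ x₀ hr z).1 - (frame θ x₀ hr w).1)])
    ((le_abs_self _).trans h1)
  have e2 := sq_le_sq' (by linarith [neg_abs_le ((frame θ x₀ hr z).2 - (frame θ x₀ hr w).2)])
    ((le_abs_self _).trans h2)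
  rw [h, mul_pow]
  nlinarith [sq_nonneg r, sq_nonneg (dist (frame θ x₀ hr z) (frame θ x₀ hr w))]

lemma cos_pos_of_mem {α : ℝ} (h0 : 0 ≤ α) (h1 : α < 1 / 8) :
    1 / 2 ≤ Real.cos (2 * Real.pi * α) := by
  have hpi := Real.pi_pos
  rw [← Real.cos_pi_div_three]
  exact Real.cos_le_cos_of_nonneg_of_le_pi (by positivity) (by linarith) (by nlinarith)

lemma proj_eq_lin_frame {α : ℝ} (hα : Real.cos (2 * Real.pi * α) ≠ 0) (z : R2) :
    proj (θ + α) z = proj (θ + α) x₀ +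
      r * Real.cos (2 * Real.pi * α) * lin (Real.tan (2 * Real.pi * α)) (frame θ x₀ hr z) := by
  have : proj (θ + α) z = proj (θ + α) x₀ + proj (θ + α) (z - x₀) := by rw [proj_sub]; ring
  rw [this, proj_add_angle θ α (z - x₀), lin, frame_fst, frame_snd, Real.tan_eq_sin_div_cos]
  generalize Real.cos (2 * Real.pi * α) = C at *
  field_simp

end frame

lemma lintegral_tan_le (θ : ℝ) (g : ℝ → ℝ≥0∞) :
    ∫⁻ t in Ico θ (θ + 1 / 8), g (Real.tan (2 * Real.pi * (t - θ))) ≤ ∫⁻ s in Ico 0 1, g s := by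
  have hpi := Real.pi_pos
  have hmem : ∀ t ∈ Ico θ (θ + 1 / 8), 0 ≤ 2 * Real.pi * (t - θ) ∧
      2 * Real.pi * (t - θ) < Real.pi / 4 := by
    rintro t ⟨h1, h2⟩
    have : 0 ≤ t - θ := by linarith
    exact ⟨by positivity, by nlinarith⟩
  have hcos : ∀ t ∈ Ico θ (θ + 1 / 8), 0 < Real.cos (2 * Real.pi * (t - θ)) := by
    intro t ht
    obtain ⟨h1, h2⟩ := hmem t ht
    exact Real.cos_pos_of_mem_Ioo ⟨by linarith, by linarith⟩
  have hderiv : ∀ t ∈ Ico θ (θ + 1 / 8),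
      HasDerivWithinAt (fun t => Real.tan (2 * Real.pi * (t - θ)))
        (1 / Real.cos (2 * Real.pi * (t - θ)) ^ 2 * (2 * Real.pi)) (Ico θ (θ + 1 / 8)) t := by
    intro t ht
    refine HasDerivAt.hasDerivWithinAt ?_
    have hlin : HasDerivAt (fun t => 2 * Real.pi * (t - θ)) (2 * Real.pi) t := by
      simpa using ((hasDerivAt_id t).sub_const θ).const_mul (2 * Real.pi)
    exact HasDerivAt.comp t (h₂ := Real.tan) (Real.hasDerivAt_tan (hcos t ht).ne') hlin
  have hinj : InjOn (fun t => Real.tan (2 * Real.pi * (t - θ))) (Ico θ (θ + 1 / 8)) := by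
    intro t ht t' ht' h
    obtain ⟨h1, h2⟩ := hmem t ht
    obtain ⟨h3, h4⟩ := hmem t' ht'
    have := Real.tan_inj_of_lt_of_lt_pi_div_two (by linarith) (by linarith) (by linarith)
      (by linarith) h
    have h5 := mul_left_cancel₀ (by positivity) this
    linarith
  have himage : (fun t => Real.tan (2 * Real.pi * (t - θ))) '' Ico θ (θ + 1 / 8) ⊆ Ico 0 1 := by
    rintro _ ⟨t, ht, rfl⟩
    obtain ⟨h1, h2⟩ := hmem t ht
    refine ⟨Real.tan_nonneg_of_nonneg_of_le_pi_div_two h1 (by linarith), ?_⟩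
    rw [← Real.tan_pi_div_four]
    exact Real.tan_lt_tan_of_lt_of_lt_pi_div_two (by linarith) (by linarith) h2
  calc ∫⁻ t in Ico θ (θ + 1 / 8), g (Real.tan (2 * Real.pi * (t - θ)))
      ≤ ∫⁻ t in Ico θ (θ + 1 / 8),
          ENNReal.ofReal |1 / Real.cos (2 * Real.pi * (t - θ)) ^ 2 * (2 * Real.pi)| *
            g (Real.tan (2 * Real.pi * (t - θ))) := by
        refine setLIntegral_mono' measurableSet_Ico fun t ht => le_mul_of_one_le_left' ?_
        rw [ENNReal.one_le_ofReal]
        refine le_trans ?_ (le_abs_self _)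
        have h0 := hcos t ht
        have h1 := Real.cos_le_one (2 * Real.pi * (t - θ))
        have h2 : 1 ≤ 1 / Real.cos (2 * Real.pi * (t - θ)) ^ 2 := by
          rw [one_le_div (by positivity)]
          nlinarith
        nlinarith [Real.pi_gt_three]
    _ = ∫⁻ s in (fun t => Real.tan (2 * Real.pi * (t - θ))) '' Ico θ (θ + 1 / 8), g s :=
        (lintegral_image_eq_lintegral_abs_deriv_mul measurableSet_Ico hderiv hinj g).symm
    _ ≤ ∫⁻ s in Ico 0 1, g s := lintegral_mono_set himage

lemma exists_arc_lintegral_ge (f : ℝ → ℝ≥0∞) :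
    ∃ θ : ℝ, ∫⁻ t in Icc (0 : ℝ) 1, f t ≤ 8 * ∫⁻ t in Ico θ (θ + 1 / 8), f t := by
  obtain ⟨j, -, hj⟩ := (Finset.univ : Finset (Fin 8)).exists_max_image
    (fun j => ∫⁻ t in Ico ((j : ℝ) / 8) ((j : ℝ) / 8 + 1 / 8), f t) Finset.univ_nonempty
  refine ⟨(j : ℝ) / 8, ?_⟩
  have hcov : Ico (0 : ℝ) 1 ⊆ ⋃ j : Fin 8, Ico ((j : ℝ) / 8) ((j : ℝ) / 8 + 1 / 8) := by
    rintro t ⟨h0, h1⟩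
    have h2 : ⌊8 * t⌋₊ < 8 := by
      rw [Nat.floor_lt (by positivity)]
      push_cast
      linarith
    refine mem_iUnion.2 ⟨⟨⌊8 * t⌋₊, h2⟩, ?_⟩
    have h3 := Nat.floor_le (show 0 ≤ 8 * t by positivity)
    have h4 := Nat.lt_floor_add_one (8 * t)
    constructor <;> simp only <;> linarith
  calc ∫⁻ t in Icc (0 : ℝ) 1, f t = ∫⁻ t in Ico (0 : ℝ) 1, f t := by
        rw [Measure.restrict_congr_set Ico_ae_eq_Icc]
    _ ≤ ∫⁻ t in ⋃ j : Fin 8, Ico ((j : ℝ) / 8) ((j : ℝ) / 8 + 1 / 8), f t := lintegral_mono_set hcov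
    _ ≤ ∑' j : Fin 8, ∫⁻ t in Ico ((j : ℝ) / 8) ((j : ℝ) / 8 + 1 / 8), f t := lintegral_iUnion_le _ _
    _ ≤ ∑ _j : Fin 8, ∫⁻ t in Ico ((j : ℝ) / 8) ((j : ℝ) / 8 + 1 / 8), f t := by
        rw [tsum_fintype]
        exact Finset.sum_le_sum hj
    _ = 8 * ∫⁻ t in Ico ((j : ℝ) / 8) ((j : ℝ) / 8 + 1 / 8), f t := by simp

section frame

variable {θ : ℝ} {x₀ : R2} {r : ℝ} (hr : 0 < r)

lemma hausdorffMeasure_proj_image_le {t : ℝ} (ht : t ∈ Ico θ (θ + 1 / 8)) (S : Set R2) :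
    μH[1] (proj t '' S) ≤ ENNReal.ofReal r *
      volume (lin (Real.tan (2 * Real.pi * (t - θ))) '' (frame θ x₀ hr '' S)) := by
  have hc := cos_pos_of_mem (α := t - θ) (by linarith [ht.1]) (by linarith [ht.2])
  have hc1 := Real.cos_le_one (2 * Real.pi * (t - θ))
  have hlip : LipschitzWith r.toNNReal fun u : ℝ =>
      proj t x₀ + r * Real.cos (2 * Real.pi * (t - θ)) * u := by
    refine LipschitzWith.of_dist_le_mul fun u v => ?_
    rw [Real.dist_eq, Real.dist_eq, add_sub_add_left_eq_sub, ← mul_sub, abs_mul,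
      abs_of_pos (by positivity), Real.coe_toNNReal _ hr.le]
    gcongr
    nlinarith
  have himg : proj t '' S = (fun u : ℝ => proj t x₀ + r * Real.cos (2 * Real.pi * (t - θ)) * u) ''
      (lin (Real.tan (2 * Real.pi * (t - θ))) '' (frame θ x₀ hr '' S)) := by
    rw [image_image, image_image]
    refine image_congr fun z _ => ?_
    have := proj_eq_lin_frame (θ := θ) (x₀ := x₀) hr (α := t - θ) (by linarith) z
    rwa [add_sub_cancel] at this
  rw [himg, ← hausdorffMeasure_real]
  simpa [ENNReal.ofReal] using hlip.hausdorffMeasure_image_le zero_le_one _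

lemma exists_frame_lintegral_ge (x₀ : R2) {κ : ℝ} (S : Set R2) (hS : ENNReal.ofReal (κ * r) ≤ Fav S) :
    ∃ θ : ℝ, ENNReal.ofReal (κ / 8) ≤
      ∫⁻ s in Ico 0 1, volume (lin s '' (frame θ x₀ hr '' S)) := by
  obtain ⟨θ, hθ⟩ := exists_arc_lintegral_ge fun t => μH[1] (proj t '' S)
  refine ⟨θ, ?_⟩
  have hint : ∫⁻ t in Ico θ (θ + 1 / 8), μH[1] (proj t '' S) ≤ ENNReal.ofReal r *
      ∫⁻ s in Ico 0 1, volume (lin s '' (frame θ x₀ hr '' S)) := by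
    refine le_trans (setLIntegral_mono' measurableSet_Ico fun t ht =>
      hausdorffMeasure_proj_image_le (x₀ := x₀) hr ht S) ?_
    rw [lintegral_const_mul' _ _ ENNReal.ofReal_ne_top]
    exact mul_le_mul_right (lintegral_tan_le θ fun s => volume (lin s '' (frame θ x₀ hr '' S))) _
  have h := hS.trans (hθ.trans (mul_le_mul_right hint 8))
  rw [ENNReal.ofReal_div_of_pos (by norm_num)]
  refine ENNReal.div_le_of_le_mul' ?_
  rw [mul_comm κ, ENNReal.ofReal_mul hr.le, mul_left_comm,
    ENNReal.mul_le_mul_iff_right (by simpa using hr) ENNReal.ofReal_ne_top] at h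
  simpa using h

/-- Points whose differences avoid a cone lie on a Lipschitz graph. -/
lemma exists_graph_of_cone_free {c₀ s : ℝ} (hc₀ : 0 < c₀) (hs : s ∈ Ico (0 : ℝ) 1) {G : Set R2}
    (hG : ∀ x ∈ G, ∀ y ∈ G, c₀ * |(frame θ x₀ hr y).2 - (frame θ x₀ hr x).2| ≤
      |lin s (frame θ x₀ hr y) - lin s (frame θ x₀ hr x)|) :
    ∃ Γ, IsLipschitzGraph (4 / c₀ + 2) Γ ∧ G ⊆ Γ := by
  have hpi := Real.pi_pos
  set α := Real.arctan s / (2 * Real.pi) with hα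
  have hα2 : 2 * Real.pi * α = Real.arctan s := by
    rw [hα]
    field_simp
  have htan : Real.tan (2 * Real.pi * α) = s := by rw [hα2, Real.tan_arctan]
  have hα0 : 0 ≤ α := div_nonneg (Real.arctan_nonneg.2 hs.1) (by positivity)
  have hα1 : α < 1 / 8 := by
    have : Real.arctan s < Real.pi / 4 := by
      rw [← Real.arctan_one]
      exact Real.arctan_strictMono hs.2
    rw [hα, div_lt_iff₀ (by positivity)]
    linarith
  have hC := cos_pos_of_mem hα0 hα1
  have hC1 := Real.cos_le_one (2 * Real.pi * α)
  have hS1 := Real.abs_sin_le_one (2 * Real.pi * α)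
  set C := Real.cos (2 * Real.pi * α) with hCdef
  have hC0 : 0 < C := by linarith
  have hkey : ∀ x ∈ G, ∀ y ∈ G, |projPerp (θ + α) y - projPerp (θ + α) x| ≤
      (4 / c₀ + 2) * |proj (θ + α) y - proj (θ + α) x| := by
    intro x hx y hy
    have h := hG x hx y hy
    have e1 : proj (θ + α) y - proj (θ + α) x =
        r * C * (lin s (frame θ x₀ hr y) - lin s (frame θ x₀ hr x)) := by
      rw [proj_eq_lin_frame (θ := θ) (x₀ := x₀) hr hC0.ne' y,
        proj_eq_lin_frame (θ := θ) (x₀ := x₀) hr hC0.ne' x, htan]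
      ring
    have e2 : |projPerp θ (y - x)| = r * |(frame θ x₀ hr y).2 - (frame θ x₀ hr x).2| := by
      rw [frame_snd_sub, abs_mul, abs_of_pos (inv_pos.2 hr), mul_inv_cancel_left₀ hr.ne']
    have e3 : |proj (θ + α) (y - x)| =
        r * C * |lin s (frame θ x₀ hr y) - lin s (frame θ x₀ hr x)| := by
      rw [proj_sub, e1, abs_mul, abs_of_pos (by positivity)]
    have e4 : c₀ * C * |projPerp θ (y - x)| ≤ |proj (θ + α) (y - x)| := by
      rw [e2, e3]
      calc c₀ * C * (r * |(frame θ x₀ hr y).2 - (frame θ x₀ hr x).2|)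
          = r * C * (c₀ * |(frame θ x₀ hr y).2 - (frame θ x₀ hr x).2|) := by ring
        _ ≤ _ := by gcongr
    have e5 : C * projPerp (θ + α) (y - x) =
        projPerp θ (y - x) - Real.sin (2 * Real.pi * α) * proj (θ + α) (y - x) := by
      rw [projPerp_add_angle, proj_add_angle θ α]
      linear_combination projPerp θ (y - x) * Real.sin_sq_add_cos_sq (2 * Real.pi * α)
    have e6 : C * |projPerp (θ + α) (y - x)| ≤
        |projPerp θ (y - x)| + |proj (θ + α) (y - x)| := by
      rw [← abs_of_pos hC0, ← abs_mul, e5]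
      refine (abs_sub _ _).trans ?_
      rw [abs_mul]
      gcongr
      exact mul_le_of_le_one_left (abs_nonneg _) hS1
    have e7 : |projPerp (θ + α) (y - x)| ≤ (4 / c₀ + 2) * |proj (θ + α) (y - x)| := by
      have a0 := abs_nonneg (projPerp (θ + α) (y - x))
      have a1 := abs_nonneg (projPerp θ (y - x))
      have a2 : |projPerp (θ + α) (y - x)| ≤
          2 * (|projPerp θ (y - x)| + |proj (θ + α) (y - x)|) := by nlinarith
      have a3 : |projPerp θ (y - x)| ≤ 2 / c₀ * |proj (θ + α) (y - x)| := by
        rw [div_mul_eq_mul_div, le_div_iff₀ hc₀]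
        nlinarith [mul_nonneg hc₀.le a1]
      calc _ ≤ _ := a2
        _ ≤ 2 * (2 / c₀ * |proj (θ + α) (y - x)| + |proj (θ + α) (y - x)|) := by gcongr
        _ = _ := by ring
    rwa [proj_sub, projPerp, proj_sub] at e7
  have hinj : InjOn (proj (θ + α)) G := by
    intro x hx y hy hxy
    have h1 := hkey x hx y hy
    rw [hxy, sub_self, abs_zero, mul_zero, abs_nonpos_iff, sub_eq_zero] at h1
    refine (rotation (θ + α)).injective ?_
    ext i
    fin_cases i
    · exact hxy
    · exact h1.symm
  have hL : 0 < 4 / c₀ + 2 := by positivity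
  have hlip : LipschitzOnWith (4 / c₀ + 2).toNNReal
      (projPerp (θ + α) ∘ Function.invFunOn (proj (θ + α)) G) (proj (θ + α) '' G) := by
    refine LipschitzOnWith.of_dist_le_mul ?_
    rintro _ ⟨x, hx, rfl⟩ _ ⟨y, hy, rfl⟩
    simp only [Function.comp_apply]
    rw [hinj.leftInvOn_invFunOn hx, hinj.leftInvOn_invFunOn hy, Real.dist_eq, Real.dist_eq,
      Real.coe_toNNReal _ hL.le]
    exact hkey y hy x hx
  obtain ⟨f, hf, hfeq⟩ := hlip.extend_real
  refine ⟨_, ⟨(rotation (θ + α)).symm, f, hf, rfl⟩, fun x hx => ?_⟩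
  refine ⟨rotation (θ + α) x, ?_, LinearIsometryEquiv.symm_apply_apply _ _⟩
  have := hfeq (mem_image_of_mem _ hx)
  simp only [Function.comp_apply] at this
  rw [hinj.leftInvOn_invFunOn hx] at this
  exact this

end frame

section frame

variable {θ : ℝ} {x₀ : R2} {r : ℝ} (hr : 0 < r)

/-- The normalized length measure on `E ∩ ball x₀ R`, in the coordinates of a frame. -/
def frameMeasure (θ : ℝ) (x₀ : R2) {r : ℝ} (hr : 0 < r) (E : Set R2) (R : ℝ) : Measure (ℝ × ℝ) :=
  ENNReal.ofReal r⁻¹ • (μH[1].restrict (E ∩ ball x₀ R)).map (frame θ x₀ hr)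

lemma frameMeasure_apply {E : Set R2} (hE : IsClosed E) (R : ℝ) (S : Set (ℝ × ℝ)) :
    frameMeasure θ x₀ hr E R S =
      ENNReal.ofReal r⁻¹ * μH[1] (frame θ x₀ hr ⁻¹' S ∩ (E ∩ ball x₀ R)) := by
  have h := (frame θ x₀ hr).toMeasurableEquiv.map_apply (μ := μH[1].restrict (E ∩ ball x₀ R)) S
  rw [Homeomorph.toMeasurableEquiv_coe] at h
  rw [frameMeasure, Measure.smul_apply, h, smul_eq_mul,
    Measure.restrict_apply' (hE.measurableSet.inter measurableSet_ball)]

lemma frameMeasure_univ_le {A : ℝ} {E : Set R2} (hE : AhlforsRegular A E) (hx₀ : x₀ ∈ E)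
    (hrE : ENNReal.ofReal r < EMetric.diam E) {R : ℝ} (hR : R ≤ r) :
    frameMeasure θ x₀ hr E R univ ≤ ENNReal.ofReal A := by
  rw [frameMeasure_apply hr hE.1, preimage_univ, univ_inter]
  calc ENNReal.ofReal r⁻¹ * μH[1] (E ∩ ball x₀ R)
      ≤ ENNReal.ofReal r⁻¹ * ENNReal.ofReal (A * r) := by
        refine mul_le_mul_right ?_ _
        exact (measure_mono (inter_subset_inter_right E (ball_subset_ball hR))).trans
          (hE.2 x₀ hx₀ r hr hrE).2
    _ = ENNReal.ofReal A := by
        rw [← ENNReal.ofReal_mul (by positivity)]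
        congr 1
        field_simp

lemma le_frameMeasure_ball {A : ℝ} {E : Set R2} (hE : AhlforsRegular A E)
    (hrE : ENNReal.ofReal r < EMetric.diam E) {R ρ : ℝ} (hρ : 0 < ρ) (hρ1 : ρ ≤ 1) {z : R2}
    (hz : z ∈ E) (hzR : ball z (r * ρ) ⊆ ball x₀ R) :
    ENNReal.ofReal (A⁻¹ * ρ) ≤ frameMeasure θ x₀ hr E R (ball (frame θ x₀ hr z) ρ) := by
  rw [frameMeasure_apply hr hE.1]
  have hsub : E ∩ ball z (r * ρ) ⊆
      frame θ x₀ hr ⁻¹' ball (frame θ x₀ hr z) ρ ∩ (E ∩ ball x₀ R) := by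
    rintro w ⟨hw, hwz⟩
    refine ⟨?_, hw, hzR hwz⟩
    rw [mem_preimage, mem_ball]
    refine (dist_frame_le hr w z).trans_lt ?_
    rw [mem_ball] at hwz
    rwa [inv_mul_lt_iff₀ hr]
  have hlow := (hE.2 z hz (r * ρ) (by positivity)
    ((ENNReal.ofReal_le_ofReal (mul_le_of_le_one_right hr.le hρ1)).trans_lt hrE)).1
  refine le_trans (le_of_eq ?_) (mul_le_mul_right (hlow.trans (measure_mono hsub)) _)
  rw [← ENNReal.ofReal_mul (by positivity)]
  congr 1
  field_simp

lemma volume_lin_image_le {E : Set R2} (hE : IsClosed E) {R : ℝ} {s : ℝ} (hs : s ∈ Ico (0 : ℝ) 1)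
    {S : Set (ℝ × ℝ)} (hS : S ⊆ frame θ x₀ hr '' (E ∩ ball x₀ R)) :
    volume (lin s '' S) ≤ 2 * frameMeasure θ x₀ hr E R S := by
  have hsub : frame θ x₀ hr ⁻¹' S ⊆ E ∩ ball x₀ R := by
    intro z hz
    obtain ⟨w, hw, hwz⟩ := hS hz
    rwa [← (frame θ x₀ hr).injective hwz]
  have himg : lin s '' S = (fun z => lin s (frame θ x₀ hr z)) '' (frame θ x₀ hr ⁻¹' S) := by
    rw [← image_image (lin s) (frame θ x₀ hr), image_preimage_eq _ (frame θ x₀ hr).surjective]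
  have hlip : LipschitzWith (2 * r⁻¹).toNNReal fun z => lin s (frame θ x₀ hr z) := by
    refine LipschitzWith.of_dist_le_mul fun z w => ?_
    rw [Real.dist_eq, Real.coe_toNNReal _ (by positivity), mul_assoc]
    refine (abs_lin_sub_le hs _ _).trans ?_
    gcongr
    exact dist_frame_le hr z w
  rw [frameMeasure_apply hr hE, inter_eq_left.2 hsub, himg, ← hausdorffMeasure_real]
  refine (hlip.hausdorffMeasure_image_le zero_le_one _).trans_eq ?_
  rw [ENNReal.rpow_one, ← mul_assoc]
  congr 1
  rw [← ENNReal.ofReal, ENNReal.ofReal_mul (by norm_num)]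
  norm_num

end frame

end FavardGraph

open FavardGraph

/-- uniformly large Favard length implies big pieces of Lipschitz graphs. -/
theorem statement1 (κ A : ℝ) (hκ : 0 < κ) (hA : 1 ≤ A) :
    ∃ (L θpc : ℝ), 0 < L ∧ 0 < θpc ∧ θpc < 1 ∧
      ∀ E : Set R2, AhlforsRegular A E →
        (∀ x ∈ E, ∀ r : ℝ, 0 < r → ENNReal.ofReal r < EMetric.diam E →
          ENNReal.ofReal (κ * r) ≤ Fav (E ∩ ball x r)) →
        ∀ x ∈ E, ∀ r : ℝ, 0 < r → ENNReal.ofReal r < EMetric.diam E →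
          ∃ Γ : Set R2, IsLipschitzGraph L Γ ∧
            ENNReal.ofReal (θpc * r) ≤ μH[1] (E ∩ ball x r ∩ Γ) := by
  have hA0 : 0 < A := by linarith
  obtain ⟨η, hη, c₀, hc₀, H⟩ := exists_big_cone_free_subset (κ := κ / 4 / 8) (A₀ := A) (a := A⁻¹)
    (by positivity) hA0 (by positivity)
  refine ⟨4 / c₀ + 2, min η (1 / 2), by positivity, by positivity,
    (min_le_right _ _).trans_lt (by norm_num), ?_⟩
  intro E hE hFav x₀ hx₀ r hr hrE
  obtain ⟨θ, hθ⟩ := exists_frame_lintegral_ge hr x₀ (κ := κ / 4) (E ∩ ball x₀ (r / 4)) (by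
    have := hFav x₀ hx₀ (r / 4) (by positivity)
      ((ENNReal.ofReal_le_ofReal (by linarith)).trans_lt hrE)
    rwa [show κ / 4 * r = κ * (r / 4) by ring])
  have hfin : ∀ R ≤ r, IsFiniteMeasure (frameMeasure θ x₀ hr E R) := fun R hR =>
    ⟨(frameMeasure_univ_le hr hE hx₀ hrE hR).trans_lt ENNReal.ofReal_lt_top⟩
  have := hfin (r / 2) (by linarith)
  have := hfin r le_rfl
  have himage : ∀ R, MeasurableSet (frame θ x₀ hr '' (E ∩ ball x₀ R)) := fun R =>
    (frame θ x₀ hr).measurableEmbedding.measurableSet_image.2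
      (hE.1.measurableSet.inter measurableSet_ball)
  have hmono : E ∩ ball x₀ (r / 4) ⊆ E ∩ ball x₀ (r / 2) :=
    inter_subset_inter_right E (ball_subset_ball (by linarith))
  obtain ⟨s, hs, G, hGK, hG, hcone⟩ := H (frameMeasure θ x₀ hr E (r / 2)) (frameMeasure θ x₀ hr E r)
    (frame θ x₀ hr '' (E ∩ ball x₀ (r / 2))) (frame θ x₀ hr '' (E ∩ ball x₀ (r / 4)))
    (by
      rw [Measure.le_iff']
      intro S
      rw [frameMeasure_apply hr hE.1, frameMeasure_apply hr hE.1]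
      gcongr
      linarith)
    (frameMeasure_univ_le hr hE hx₀ hrE le_rfl) (himage _) (himage _) (image_mono hmono)
    (by
      rintro _ ⟨z, ⟨-, hz⟩, rfl⟩ _ ⟨w, ⟨-, hw⟩, rfl⟩
      have h1 : |(frame θ x₀ hr w).2 - (frame θ x₀ hr z).2| ≤
          dist (frame θ x₀ hr w) (frame θ x₀ hr z) := le_max_right _ _
      have h2 := dist_frame_le (θ := θ) (x₀ := x₀) hr w z
      have h3 : r⁻¹ * dist w z < 3 := by
        rw [inv_mul_lt_iff₀ hr]
        have := dist_triangle_right w z x₀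
        rw [mem_ball] at hz hw
        linarith
      linarith)
    (by
      rw [frameMeasure_apply hr hE.1, preimage_compl,
        preimage_image_eq _ (frame θ x₀ hr).injective, compl_inter_self, measure_empty, mul_zero])
    (by
      rintro _ ⟨z, ⟨hzE, hz⟩, rfl⟩ ρ hρ hρ1
      refine le_frameMeasure_ball hr hE hrE hρ (by linarith) hzE ?_
      rw [mem_ball] at hz
      exact ball_subset_ball' (by nlinarith))
    (by
      rintro _ ⟨x, ⟨-, hx⟩, rfl⟩ _ ⟨z, ⟨hzE, -⟩, rfl⟩ hzx ρ hρ hρ1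
      refine le_frameMeasure_ball hr hE hrE hρ (by linarith) hzE ?_
      rw [mem_ball] at hx
      have h1 := dist_le_dist_frame (θ := θ) (x₀ := x₀) hr z x
      have h2 := dist_triangle z x x₀
      exact ball_subset_ball' (by nlinarith))
    (fun s hs S hS _ => volume_lin_image_le hr hE.1 hs (hS.trans (image_mono hmono)))
    hθ
  obtain ⟨Γ, hΓ, hGΓ⟩ := exists_graph_of_cone_free (θ := θ) (x₀ := x₀) hr hc₀ hs
    (G := frame θ x₀ hr ⁻¹' G) (fun x hx y hy => hcone _ hx _ hy)
  refine ⟨Γ, hΓ, ?_⟩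
  have hsub : frame θ x₀ hr ⁻¹' G ∩ (E ∩ ball x₀ (r / 2)) ⊆ E ∩ ball x₀ r ∩ Γ :=
    fun z hz => ⟨⟨hz.2.1, ball_subset_ball (by linarith) hz.2.2⟩, hGΓ hz.1⟩
  rw [frameMeasure_apply hr hE.1] at hG
  calc ENNReal.ofReal (min η (1 / 2) * r) ≤ ENNReal.ofReal r * ENNReal.ofReal η := by
        rw [← ENNReal.ofReal_mul hr.le, mul_comm r]
        gcongr
        exact min_le_left _ _
    _ ≤ ENNReal.ofReal r * (ENNReal.ofReal r⁻¹ *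
          μH[1] (frame θ x₀ hr ⁻¹' G ∩ (E ∩ ball x₀ (r / 2)))) := mul_le_mul_right hG _
    _ = μH[1] (frame θ x₀ hr ⁻¹' G ∩ (E ∩ ball x₀ (r / 2))) := by
        rw [← mul_assoc, ← ENNReal.ofReal_mul hr.le, mul_inv_cancel₀ hr.ne', ENNReal.ofReal_one,
          one_mul]
    _ ≤ μH[1] (E ∩ ball x₀ r ∩ Γ) := measure_mono hsub

end
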